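/- Let p be an odd prime, G_p the set of primitive roots modulo p, s, r positive integers with s | p−1 and r | p−1, and f ∈ Z_p[x], and define R = { g^s : g ∈ G_p and there exists x ∈ Z_p^* with f(g^s) = x^r } ⊆ Z_p. Suppose f is irreducible over Z_p and either deg(f) ≥ 2 or deg(f) = r = 1. Then there is an absolute constant c > 0 such that for every ε > 0 there exists p_0(ε) with: for all primes p ≥ p_0(ε) (under the above hypotheses) and all positive integers k, C_k(R, p) ≤ c·(1+ε)^k·k·deg(f)·2^{k·ω((p−1)/s)}·p^{1/2}·log p, where ω(n) is the number of distinct prime factors of n. -/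

import Mathlib

open Finset Filter

/-- The function `f_R` from the paper: `1 - |R|/q` on `R`, `-|R|/q` off `R`. -/
noncomputable def fsub (q : ℕ) (R : Finset ℕ) (n : ℕ) : ℝ :=
  if n % q ∈ R then 1 - (R.card : ℝ) / q else -((R.card : ℝ) / q)

/-- The correlation measure `C_k(R,q)` of order `k` of a subset `R ⊆ Z_q`. -/
noncomputable def corrK (R : Finset ℕ) (q k : ℕ) : ℝ :=
  sSup {x : ℝ | ∃ (M : ℕ) (d : Fin k → ℕ), 1 ≤ M ∧ M ≤ q ∧ StrictMono d ∧
    (∀ i, d i ≤ q - 1) ∧ x = |∑ n ∈ Finset.range M, ∏ i, fsub q R (n + d i)|}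

/-- `C(R,q,s) = max_{1 ≤ k ≤ s} C_k(R,q)`. -/
noncomputable def corrMeasure (R : Finset ℕ) (q s : ℕ) : ℝ :=
  sSup {x : ℝ | ∃ k, 1 ≤ k ∧ k ≤ s ∧ x = corrK R q k}

open Polynomial in
theorem X_pow_sub_C_irreducible_of_primitiveRoot {F : Type*} [Field F] {d : ℕ} (hd : 0 < d)
    {ζ : F} (hζ : IsPrimitiveRoot ζ d) {a : F} (ha : a ≠ 0)
    (h : ∀ t, 1 < t → t ∣ d → ∀ b : F, b ^ t ≠ a) : Irreducible (X ^ d - C a) := by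
  let E := AlgebraicClosure F
  obtain ⟨y, hy⟩ := IsAlgClosed.exists_pow_nat_eq (algebraMap F E a) hd
  have hy0 : y ≠ 0 := by
    rintro rfl
    rw [zero_pow hd.ne', eq_comm, map_eq_zero] at hy
    exact ha hy
  have hy_int : IsIntegral F y := Algebra.IsIntegral.isIntegral y
  have hdvd : minpoly F y ∣ X ^ d - C a := minpoly.dvd F y (by simp [hy])
  have hmonic := monic_X_pow_sub_C a hd.ne'
  have hroot : ∀ r ∈ ((minpoly F y).map (algebraMap F E)).roots,
      r / y ∈ (⊥ : IntermediateField F E) := by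
    intro r hr
    have h1 : IsRoot ((X ^ d - C a : F[X]).map (algebraMap F E)) r := by
      refine IsRoot.dvd ?_ (Polynomial.map_dvd (algebraMap F E) hdvd)
      exact isRoot_of_mem_roots hr
    have h2 : r ^ d = algebraMap F E a := by
      simpa [IsRoot, sub_eq_zero] using h1
    have hζ' : IsPrimitiveRoot (algebraMap F E ζ) d := hζ.map_of_injective (algebraMap F E).injective
    have h3 : (r / y) ^ d = 1 := by
      rw [div_pow, h2, hy, div_self]
      simpa using ha
    have : NeZero d := ⟨hd.ne'⟩
    obtain ⟨i, _, hi⟩ := hζ'.eq_pow_of_pow_eq_one h3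
    rw [← hi, ← map_pow]
    exact IntermediateField.algebraMap_mem _ _
  have hprod : ∀ s : Multiset E, (∀ r ∈ s, r / y ∈ (⊥ : IntermediateField F E)) →
      s.prod / y ^ (Multiset.card s) ∈ (⊥ : IntermediateField F E) := by
    intro s
    induction s using Multiset.induction_on with
    | empty => intro _; simp
    | cons r s ih =>
      intro hs
      have h1 := ih (fun r hr => hs r (Multiset.mem_cons_of_mem hr))
      have h2 := mul_mem (hs r (Multiset.mem_cons_self _ _)) h1
      rwa [div_mul_div_comm, ← pow_succ', ← Multiset.prod_cons, ← Multiset.card_cons] at h2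
  have hsplit : ((minpoly F y).map (algebraMap F E)).Splits := IsAlgClosed.splits _
  have hmm : ((minpoly F y).map (algebraMap F E)).Monic := (minpoly.monic hy_int).map _
  set m := (minpoly F y).natDegree with hm
  have hcard : Multiset.card ((minpoly F y).map (algebraMap F E)).roots = m := by
    rw [← hsplit.natDegree_eq_card_roots, natDegree_map]
  have hym : y ^ m ∈ (⊥ : IntermediateField F E) := by
    have h1 := hprod _ hroot
    rw [hcard] at h1
    have h2 := hsplit.coeff_zero_eq_prod_roots_of_monic hmm
    rw [coeff_map, natDegree_map] at h2
    have h3 : ((minpoly F y).map (algebraMap F E)).roots.prod ∈ (⊥ : IntermediateField F E) := by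
      have : ((minpoly F y).map (algebraMap F E)).roots.prod =
          (-1) ^ m * algebraMap F E ((minpoly F y).coeff 0) := by
        rw [h2, ← mul_assoc, ← mul_pow, neg_one_mul, neg_neg, one_pow, one_mul]
      rw [this]
      exact mul_mem (pow_mem (neg_mem (one_mem _)) _) (IntermediateField.algebraMap_mem _ _)
    have h4 : ((minpoly F y).map (algebraMap F E)).roots.prod ≠ 0 := by
      intro h0
      rw [h0, mul_zero, map_eq_zero] at h2
      exact minpoly.coeff_zero_ne_zero hy_int hy0 h2
    have h5 := div_mem h3 h1
    rwa [div_div_cancel₀ h4] at h5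
  have hyd : y ^ d ∈ (⊥ : IntermediateField F E) := by
    rw [hy]; exact IntermediateField.algebraMap_mem _ _
  have hyg : y ^ (m.gcd d) ∈ (⊥ : IntermediateField F E) := by
    have : (y ^ (m.gcd d) : E) = (y ^ m) ^ (m.gcdA d) * (y ^ d) ^ (m.gcdB d) := by
      rw [← zpow_natCast, Nat.gcd_eq_gcd_ab, zpow_add₀ hy0, zpow_mul, zpow_mul, zpow_natCast,
        zpow_natCast]
    rw [this]
    exact mul_mem (zpow_mem hym _) (zpow_mem hyd _)
  obtain ⟨b, hb⟩ := IntermediateField.mem_bot.1 hyg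
  have hgd : m.gcd d ∣ d := Nat.gcd_dvd_right _ _
  have hba : b ^ (d / m.gcd d) = a := by
    apply (algebraMap F E).injective
    rw [map_pow, hb, ← pow_mul, Nat.mul_div_cancel' hgd, hy]
  have ht : ¬ 1 < d / m.gcd d := fun ht => h _ ht (Nat.div_dvd_of_dvd hgd) b hba
  have hgpos : 0 < m.gcd d := Nat.gcd_pos_of_pos_right _ hd
  have hge : d ≤ m.gcd d := by
    by_contra hlt
    push Not at hlt
    exact ht ((Nat.lt_div_iff_mul_lt' hgd 1).2 (by simpa using hlt))
  have hmpos : 0 < m := minpoly.natDegree_pos hy_int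
  have hle : d ≤ m := hge.trans (Nat.gcd_le_left _ hmpos)
  have heq : minpoly F y = X ^ d - C a := by
    refine (eq_of_dvd_of_natDegree_le_of_leadingCoeff hdvd ?_ ?_)
    · rw [natDegree_X_pow_sub_C]; exact hle
    · rw [hmonic.leadingCoeff, (minpoly.monic hy_int).leadingCoeff]
  rw [← heq]
  exact minpoly.irreducible hy_int

/-- The matrix of multiplication by `h * ∑ kᵢ yⁱ` on `1, y, …, y ^ (d - 1)`, when `h * y ^ d = c`. -/
def kummerMatrix {R : Type*} [CommRing R] {d : ℕ} [NeZero d] (h c : R) (k : Fin d → R) :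
    Matrix (Fin d) (Fin d) R :=
  Matrix.of fun j l => (if j ≤ l then h else c) * k (l - j)

theorem kummerMatrix_map_mulVec {R S : Type*} [CommRing R] [CommRing S] {d : ℕ} [NeZero d]
    (φ : R →+* S) (h c : R) (k : Fin d → R) (y : S) (hy : φ h * y ^ d = φ c) (j : Fin d) :
    ∑ l, φ (kummerMatrix h c k j l) * y ^ (l : ℕ) =
      φ h * y ^ (j : ℕ) * ∑ i, φ (k i) * y ^ (i : ℕ) := by
  rw [← Equiv.sum_comp (Equiv.addRight j), Finset.mul_sum]
  refine Finset.sum_congr rfl fun i _ => ?_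
  simp only [Equiv.coe_addRight, kummerMatrix, Matrix.of_apply, add_sub_cancel_right, map_mul]
  have hval := Fin.val_add_eq_ite i j
  by_cases hij : d ≤ (i : ℕ) + j
  · rw [if_pos hij] at hval
    have hlt : ¬ j ≤ i + j := by
      rw [Fin.le_def, hval]; omega
    rw [if_neg hlt, hval, ← hy]
    have : y ^ (j : ℕ) * y ^ (i : ℕ) = y ^ d * y ^ ((i : ℕ) + j - d) := by
      rw [← pow_add, ← pow_add]; congr 1; omega
    linear_combination (-φ h * φ (k i)) * this
  · rw [if_neg hij] at hval
    have hlt : j ≤ i + j := by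
      rw [Fin.le_def, hval]; omega
    rw [if_pos hlt, hval, pow_add]
    ring

open Polynomial in
theorem Polynomial.natDegree_det_le_mul {K : Type*} [CommRing K] {d B : ℕ}
    (M : Matrix (Fin d) (Fin d) K[X]) (h : ∀ i j, (M i j).natDegree ≤ B) :
    M.det.natDegree ≤ d * B := by
  rw [Matrix.det_apply]
  refine natDegree_sum_le_of_forall_le _ _ fun σ _ => ?_
  refine (natDegree_smul_le _ _).trans ?_
  refine (natDegree_prod_le _ _).trans ?_
  refine (Finset.sum_le_sum fun i _ => h _ _).trans ?_
  simp

open Polynomial in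
theorem eq_zero_of_X_pow_dvd_sum {K : Type*} [Field K] {d q B D : ℕ} (hd : 0 < d)
    {ζ : K} (hζ : IsPrimitiveRoot ζ d) (H : K[X]) (c : K) (hc : c ≠ 0) (hH0 : H ≠ 0)
    (hD : H.natDegree ≤ D)
    (hpow : ∀ t, 1 < t → t ∣ d → ∀ u v : K[X], u ≠ 0 → v ≠ 0 → H * u ^ t ≠ C c * v ^ t)
    (g : K[X]) (hg : X ^ q ∣ H * g ^ d - C c) (k : Fin d → K[X])
    (hk : ∀ i, (k i).natDegree ≤ B) (hq : d * (D + B) < q)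
    (hsum : X ^ q ∣ ∑ i, k i * g ^ (i : ℕ)) : k = 0 := by
  have : NeZero d := ⟨hd.ne'⟩
  set M := kummerMatrix H (C c) k with hM
  have hdet : M.det = 0 := by
    have h1 : X ^ q ∣ M.det := by
      let φ := Ideal.Quotient.mk (Ideal.span {(X ^ q : K[X])})
      have hφ : ∀ P : K[X], φ P = 0 ↔ X ^ q ∣ P := fun P => by
        rw [Ideal.Quotient.eq_zero_iff_mem, Ideal.mem_span_singleton]
      have hy : φ H * φ g ^ d = φ (C c) := by
        rw [← map_pow, ← map_mul, ← sub_eq_zero, ← map_sub, hφ]; exact hg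
      have hs : ∑ i, φ (k i) * φ g ^ (i : ℕ) = 0 := by
        rw [← (hφ _).2 hsum, map_sum]; simp
      have hmv : (M.map φ).mulVec (fun l : Fin d => φ g ^ (l : ℕ)) = 0 := by
        funext j
        have := kummerMatrix_map_mulVec φ H (C c) k (φ g) hy j
        rw [hs, mul_zero] at this
        exact this
      have h2 : (M.map φ).det • (fun l : Fin d => φ g ^ (l : ℕ)) = 0 := by
        have := congrArg ((M.map φ).adjugate.mulVec) hmv
        rwa [Matrix.mulVec_mulVec, Matrix.adjugate_mul, Matrix.smul_mulVec, Matrix.one_mulVec,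
          Matrix.mulVec_zero] at this
      have h3 := congrFun h2 0
      rw [← hφ, RingHom.map_det]
      simpa using h3
    refine eq_zero_of_dvd_of_natDegree_lt h1 ?_
    rw [natDegree_X_pow]
    refine lt_of_le_of_lt (natDegree_det_le_mul M fun i j => ?_) hq
    have hite : (if i ≤ j then H else C c).natDegree ≤ D := by
      split_ifs
      · exact hD
      · simp
    exact natDegree_mul_le.trans (add_le_add hite (hk _))
  obtain ⟨v, hv0, hv⟩ := Matrix.exists_vecMul_eq_zero_iff.2 hdet
  let F := FractionRing K[X]
  let a : F := algebraMap K[X] F (C c) / algebraMap K[X] F H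
  have hinj := IsFractionRing.injective K[X] F
  have hHF : algebraMap K[X] F H ≠ 0 := by rwa [Ne, map_eq_zero_iff _ hinj]
  have hcF : algebraMap K[X] F (C c) ≠ 0 := by
    rw [Ne, map_eq_zero_iff _ hinj]; simpa using hc
  have hirr : Irreducible (X ^ d - C a : F[X]) := by
    have hζ' : IsPrimitiveRoot (algebraMap K[X] F (C ζ)) d :=
      (hζ.map_of_injective C_injective).map_of_injective hinj
    refine X_pow_sub_C_irreducible_of_primitiveRoot hd hζ' (div_ne_zero hcF hHF) ?_
    intro t ht htd b hb
    obtain ⟨u, v, hv, rfl⟩ := IsFractionRing.div_surjective (A := K[X]) b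
    have hv0 : v ≠ 0 := nonZeroDivisors.ne_zero hv
    have hvF : algebraMap K[X] F v ≠ 0 := by rwa [Ne, map_eq_zero_iff _ hinj]
    rw [div_pow, div_eq_div_iff (pow_ne_zero _ hvF) hHF] at hb
    simp only [← map_pow, ← map_mul] at hb
    have hb' := hinj hb
    have hu0 : u ≠ 0 := by
      rintro rfl
      rw [zero_pow (by omega), zero_mul] at hb'
      have := (mul_ne_zero (C_ne_zero.2 hc) (pow_ne_zero t hv0)) hb'.symm
      exact this
    exact hpow t ht htd u v hu0 hv0 (by rw [mul_comm, hb'])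
  have := Fact.mk hirr
  let E := AdjoinRoot (X ^ d - C a)
  let y : E := AdjoinRoot.root _
  let φ : K[X] →+* E := (AdjoinRoot.of (X ^ d - C a)).comp (algebraMap K[X] F)
  have hyd : y ^ d = AdjoinRoot.of _ a := by
    have := AdjoinRoot.eval₂_root (X ^ d - C a)
    simpa [sub_eq_zero] using this
  have hHE : φ H ≠ 0 := by
    simp only [φ, RingHom.comp_apply, Ne, map_eq_zero]; exact hHF
  have hy : φ H * y ^ d = φ (C c) := by
    simp only [φ, RingHom.comp_apply]
    rw [hyd, ← map_mul, mul_div_cancel₀ _ hHF]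
  have hind : ∀ w : Fin d → K[X], ∑ i, φ (w i) * y ^ (i : ℕ) = 0 → w = 0 := by
    intro w hw
    set P : F[X] := ∑ i, C (algebraMap K[X] F (w i)) * X ^ (i : ℕ) with hP
    have h1 : AdjoinRoot.mk (X ^ d - C a) P = 0 := by
      rw [← hw, hP, map_sum]
      refine Finset.sum_congr rfl fun i _ => ?_
      simp [φ, y]
    rw [AdjoinRoot.mk_eq_zero] at h1
    have hdeg : P.degree < (X ^ d - C a).degree := by
      rw [degree_X_pow_sub_C hd]
      refine (degree_sum_le _ _).trans_lt ?_
      rw [Finset.sup_lt_iff (by exact WithBot.bot_lt_coe d)]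
      intro i _
      refine (degree_C_mul_X_pow_le _ _).trans_lt ?_
      exact_mod_cast i.2
    have h2 : P = 0 := eq_zero_of_dvd_of_degree_lt h1 hdeg
    funext i
    have h3 : P.coeff i = algebraMap K[X] F (w i) := by
      rw [hP, finsetSum_coeff]
      simp only [coeff_C_mul, coeff_X_pow]
      rw [Finset.sum_eq_single i]
      · simp
      · intro j _ hj
        rw [if_neg (fun h => hj (Fin.ext h.symm)), mul_zero]
      · simp
    rw [h2, coeff_zero] at h3
    exact hinj (by rw [← h3]; simp)
  have hzero : (∑ j, φ (v j) * y ^ (j : ℕ)) * ∑ i, φ (k i) * y ^ (i : ℕ) = 0 := by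
    have h1 : ∑ l, φ (∑ j, v j * M j l) * y ^ (l : ℕ) = 0 := by
      refine Finset.sum_eq_zero fun l _ => ?_
      have := congrFun hv l
      simp only [Matrix.vecMul, dotProduct, Pi.zero_apply] at this
      rw [this]; simp
    have h2 : ∑ l, φ (∑ j, v j * M j l) * y ^ (l : ℕ) =
        φ H * ((∑ j, φ (v j) * y ^ (j : ℕ)) * ∑ i, φ (k i) * y ^ (i : ℕ)) := by
      simp only [map_sum, Finset.sum_mul, map_mul]
      rw [Finset.sum_comm, Finset.mul_sum]
      refine Finset.sum_congr rfl fun j _ => ?_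
      simp only [mul_assoc]
      rw [← Finset.mul_sum, kummerMatrix_map_mulVec φ H (C c) k y hy j]
      ring
    rw [h2] at h1
    exact (mul_eq_zero.1 h1).resolve_left hHE
  rcases mul_eq_zero.1 hzero with h | h
  · exact absurd (hind v h) hv0
  · exact hind k h

/-- `P` has Hasse derivatives which, on the set `H(x) ^ e = α` and up to powers of `H`, agree with
polynomials of small degree. -/
def HasTameDerivs {K : Type*} [Field K] (H : Polynomial K) (D q e : ℕ) (α : K)
    (P : Polynomial K) (a : ℕ) : Prop :=
  ∀ m < q, ∃ R : Polynomial K, R.natDegree ≤ a + D * m ∧ ∀ x, H.eval x ^ e = α →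
    H.eval x ^ m * (Polynomial.hasseDeriv m P).eval x = R.eval x

namespace HasTameDerivs

open Polynomial

variable {K : Type*} [Field K] {H : K[X]} {D q e : ℕ} {α : K}

theorem mul {P Q : K[X]} {a b : ℕ} (hP : HasTameDerivs H D q e α P a)
    (hQ : HasTameDerivs H D q e α Q b) : HasTameDerivs H D q e α (P * Q) (a + b) := by
  intro m hm
  choose! R hR hR' using hP
  choose! S hS hS' using hQ
  refine ⟨∑ ij ∈ antidiagonal m, R ij.1 * S ij.2, ?_, ?_⟩
  · refine natDegree_sum_le_of_forall_le _ _ fun ij hij => ?_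
    rw [HasAntidiagonal.mem_antidiagonal] at hij
    refine natDegree_mul_le.trans ((add_le_add (hR _ (by omega)) (hS _ (by omega))).trans ?_)
    rw [← hij]
    apply le_of_eq
    ring
  · intro x hx
    rw [hasseDeriv_mul, eval_finsetSum, eval_finsetSum, Finset.mul_sum]
    refine Finset.sum_congr rfl fun ij hij => ?_
    rw [HasAntidiagonal.mem_antidiagonal] at hij
    rw [eval_mul, eval_mul, ← hR' _ (by omega) x hx, ← hS' _ (by omega) x hx, ← hij, pow_add]
    ring

theorem of_natDegree_le {P : K[X]} {a : ℕ} (hH : H.natDegree ≤ D) (hP : P.natDegree ≤ a) :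
    HasTameDerivs H D q e α P a := by
  intro m _
  refine ⟨H ^ m * hasseDeriv m P, ?_, fun x _ => by simp⟩
  refine natDegree_mul_le.trans ?_
  have h1 : (H ^ m).natDegree ≤ D * m := by
    rw [mul_comm]; exact natDegree_pow_le.trans (Nat.mul_le_mul_left _ hH)
  have h2 : (hasseDeriv m P).natDegree ≤ a :=
    (natDegree_hasseDeriv_le P m).trans ((Nat.sub_le _ _).trans hP)
  omega

theorem pow {P : K[X]} {a : ℕ} (hH : H.natDegree ≤ D) (hP : HasTameDerivs H D q e α P a) (j : ℕ) :
    HasTameDerivs H D q e α (P ^ j) (j * a) := by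
  induction j with
  | zero => simpa using of_natDegree_le hH (by simp)
  | succ j ih =>
    rw [pow_succ, add_mul, one_mul]
    exact ih.mul hP

theorem X_pow_card [Fintype K] (hq : q = Fintype.card K) : HasTameDerivs H D q e α (X ^ q) 1 := by
  intro m hm
  have key : ∀ x : K, (hasseDeriv m (X ^ q : K[X])).eval x = if m = 0 then x else 0 := by
    intro x
    obtain ⟨p, hp⟩ := CharP.exists K
    rcases FiniteField.card K p with ⟨n, hpp, hn⟩
    have : Fact p.Prime := ⟨hpp⟩
    have h1 : (X + C x : K[X]) ^ q = X ^ q + C x := by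
      rw [hq, hn, add_pow_char_pow, ← C_pow, ← hn, FiniteField.pow_card]
    rw [← taylor_coeff, taylor_X_pow, h1, coeff_add, coeff_X_pow, coeff_C, if_neg hm.ne, zero_add]
  by_cases h0 : m = 0
  · refine ⟨X, by simp, fun x _ => ?_⟩
    rw [key, if_pos h0, h0]; simp
  · refine ⟨0, by simp, fun x _ => ?_⟩
    rw [key, if_neg h0]; simp

theorem exists_hasseDeriv_pow (hH : H.natDegree ≤ D) (n m : ℕ) :
    ∃ R : K[X], R.natDegree ≤ D * m ∧ H ^ m * hasseDeriv m (H ^ n) = H ^ n * R := by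
  induction n generalizing m with
  | zero =>
    rcases Nat.eq_zero_or_pos m with rfl | hm
    · exact ⟨1, by simp, by simp⟩
    · exact ⟨0, by simp, by rw [pow_zero, hasseDeriv_apply_one m hm]; simp⟩
  | succ n ih =>
    choose R hR hR' using ih
    have h1 : ∀ i, ∃ S : K[X], S.natDegree ≤ D * i ∧ H ^ i * hasseDeriv i H = H * S := by
      intro i
      rcases Nat.eq_zero_or_pos i with rfl | hi
      · exact ⟨1, by simp, by simp⟩
      · refine ⟨H ^ (i - 1) * hasseDeriv i H, ?_, ?_⟩
        · refine natDegree_mul_le.trans ?_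
          have h2 : (H ^ (i - 1)).natDegree ≤ (i - 1) * D :=
            natDegree_pow_le.trans (Nat.mul_le_mul_left _ hH)
          have h3 : (hasseDeriv i H).natDegree ≤ D :=
            (natDegree_hasseDeriv_le H i).trans ((Nat.sub_le _ _).trans hH)
          obtain ⟨i, rfl⟩ := Nat.exists_eq_succ_of_ne_zero hi.ne'
          simp only [Nat.succ_eq_add_one, Nat.add_sub_cancel] at *
          calc _ ≤ i * D + D := add_le_add h2 h3
            _ = D * (i + 1) := by ring
        · rw [← mul_assoc, ← pow_succ', Nat.sub_add_cancel hi]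
    choose S hS hS' using h1
    refine ⟨∑ ij ∈ antidiagonal m, R ij.1 * S ij.2, ?_, ?_⟩
    · refine natDegree_sum_le_of_forall_le _ _ fun ij hij => ?_
      rw [HasAntidiagonal.mem_antidiagonal] at hij
      refine natDegree_mul_le.trans ((add_le_add (hR _) (hS _)).trans ?_)
      rw [← hij, mul_add]
    · rw [pow_succ, hasseDeriv_mul, Finset.mul_sum, Finset.mul_sum]
      refine Finset.sum_congr rfl fun ij hij => ?_
      rw [HasAntidiagonal.mem_antidiagonal] at hij
      rw [← hij, pow_add]
      linear_combination (H ^ ij.2 * hasseDeriv ij.2 H) * hR' ij.1 + (H ^ n * R ij.1) * hS' ij.2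

theorem self_pow (hH : H.natDegree ≤ D) (i : ℕ) : HasTameDerivs H D q e α ((H ^ e) ^ i) 0 := by
  intro m _
  obtain ⟨R, hR, hR'⟩ := exists_hasseDeriv_pow (H := H) hH (e * i) m
  refine ⟨C (α ^ i) * R, ?_, fun x hx => ?_⟩
  · rw [zero_add]; exact (natDegree_C_mul_le _ _).trans hR
  · have := congrArg (eval x) hR'
    rw [← pow_mul]
    simpa [pow_mul, hx] using this

end HasTameDerivs

open Polynomial in
theorem Polynomial.mul_card_le_natDegree {K : Type*} [Field K] (P : K[X]) (hP : P ≠ 0)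
    (s : Finset K) (M : ℕ) (h : ∀ x ∈ s, ∀ m < M, (hasseDeriv m P).eval x = 0) :
    M * s.card ≤ P.natDegree := by
  have h1 : ∏ x ∈ s, (X - C x) ^ M ∣ P := by
    refine Finset.prod_dvd_of_coprime ?_ fun x hx => ?_
    · intro x _ y _ hxy
      exact (pairwise_coprime_X_sub_C Function.injective_id hxy).pow
    · have h2 : X ^ M ∣ taylor x P := X_pow_dvd_iff.2 fun m hm => by
        rw [taylor_coeff]; exact h x hx m hm
      obtain ⟨Q, hQ⟩ := h2
      refine ⟨taylor (-x) Q, ?_⟩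
      have := congrArg (taylor (-x)) hQ
      rw [taylor_taylor, taylor_mul, taylor_X_pow] at this
      simpa [sub_eq_add_neg] using this
  have h2 := natDegree_le_of_dvd h1 hP
  rw [natDegree_prod _ _ fun x _ => pow_ne_zero _ (X_sub_C_ne_zero x)] at h2
  simpa [mul_comm] using h2

open Polynomial in
theorem stepanov_mul_card_le {K : Type*} [Field K] [Fintype K] [DecidableEq K] {d e q A D J M : ℕ}
    (hd : 0 < d) (hq : q = Fintype.card K) (hde : q = d * e + 1)
    {ζ : K} (hζ : IsPrimitiveRoot ζ d) (H : K[X]) (hH : H.eval 0 ≠ 0) (hD : H.natDegree ≤ D)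
    (hpow : ∀ t, 1 < t → t ∣ d → ∀ u v : K[X], u ≠ 0 → v ≠ 0 →
      H * u ^ t ≠ C (H.eval 0) * v ^ t)
    (he : 0 < e) (α : K) (hα : α ≠ 0) (hA : A + D ≤ e) (hA0 : 0 < A) (hM : M ≤ q)
    (hcount : M * (A + J + D * M) < A * d * J) :
    M * (univ.filter fun x => H.eval x ^ e = α).card ≤ q * (J + D) := by
  classical
  have hJ : 0 < J := by
    rcases Nat.eq_zero_or_pos J with rfl | h
    · simp at hcount
    · exact h
  have hH0 : H ≠ 0 := by rintro rfl; simp at hH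
  have hqpos : 0 < q := by omega
  -- the monomials out of which the auxiliary polynomial is built
  let P : (Fin J × Fin d) × Fin A → K[X] := fun b =>
    X ^ (b.2 : ℕ) * (H ^ e) ^ (b.1.2 : ℕ) * (X ^ q) ^ (b.1.1 : ℕ)
  have hP : ∀ b, HasTameDerivs H D q e α (P b) (A + J - 1) := by
    intro b m hm
    obtain ⟨R, hR, hR'⟩ := (((HasTameDerivs.of_natDegree_le (H := H) (D := D) (q := q) (e := e)
      (α := α) hD (natDegree_X_pow_le (R := K) (b.2 : ℕ))).mul
      (HasTameDerivs.self_pow hD (b.1.2 : ℕ))).mul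
      ((HasTameDerivs.X_pow_card hq).pow hD (b.1.1 : ℕ))) m hm
    refine ⟨R, hR.trans ?_, hR'⟩
    have := b.2.2
    have := b.1.1.2
    omega
  choose! R hR hR' using hP
  let L := A + J + D * M
  let Φ : ((Fin J × Fin d) × Fin A → K) →ₗ[K] (Fin M × Fin L → K) :=
    { toFun := fun c n => ∑ b, c b * (R b n.1).coeff n.2
      map_add' := fun c c' => by
        funext n
        simp [add_mul, Finset.sum_add_distrib]
      map_smul' := fun r c => by
        funext n
        simp [Finset.mul_sum, mul_assoc] }
  obtain ⟨c, hc, hc0⟩ := (Submodule.ne_bot_iff _).1 (Φ.ker_ne_bot_of_finrank_lt (by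
    simp only [Module.finrank_fintype_fun_eq_card, Fintype.card_prod, Fintype.card_fin]
    calc M * L < A * d * J := hcount
      _ = _ := by ring))
  rw [LinearMap.mem_ker] at hc
  set Q : K[X] := ∑ b, C (c b) * P b with hQ
  have hderiv : ∀ x ∈ univ.filter (fun x => H.eval x ^ e = α), ∀ m < M,
      (hasseDeriv m Q).eval x = 0 := by
    intro x hx m hm
    rw [mem_filter] at hx
    have hHx : H.eval x ≠ 0 := by
      intro h0
      rw [h0, zero_pow he.ne'] at hx
      exact hα hx.2.symm
    have hsum : ∑ b, C (c b) * R b m = 0 := by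
      ext n
      rw [finsetSum_coeff, coeff_zero]
      simp only [coeff_C_mul]
      by_cases hn : n < L
      · exact congrFun hc (⟨m, hm⟩, ⟨n, hn⟩)
      · refine Finset.sum_eq_zero fun b _ => ?_
        rw [coeff_eq_zero_of_natDegree_lt, mul_zero]
        refine (hR b m (by omega)).trans_lt ?_
        have : D * m ≤ D * M := Nat.mul_le_mul_left _ hm.le
        omega
    have h1 : H.eval x ^ m * (hasseDeriv m Q).eval x = 0 := by
      rw [← eval_zero (x := x), ← hsum, hQ, map_sum, eval_finsetSum, eval_finsetSum,
        Finset.mul_sum]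
      refine Finset.sum_congr rfl fun b _ => ?_
      rw [← smul_eq_C_mul, map_smul, eval_smul, eval_mul, eval_C, ← hR' b m (by omega) x hx.2,
        smul_eq_mul]
      ring
    exact (mul_eq_zero.1 h1).resolve_left (pow_ne_zero _ hHx)
  let k : Fin J → Fin d → K[X] := fun j i => ∑ a : Fin A, C (c ((j, i), a)) * X ^ (a : ℕ)
  have hQk : Q = ∑ j : Fin J, (X ^ q) ^ (j : ℕ) * ∑ i, k j i * (H ^ e) ^ (i : ℕ) := by
    rw [hQ, Fintype.sum_prod_type, Fintype.sum_prod_type]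
    refine Finset.sum_congr rfl fun j _ => ?_
    rw [Finset.mul_sum]
    refine Finset.sum_congr rfl fun i _ => ?_
    rw [Finset.sum_mul, Finset.mul_sum]
    refine Finset.sum_congr rfl fun a _ => ?_
    simp only [P]
    ring
  have hQ0 : Q ≠ 0 := by
    intro hQ0
    apply hc0
    have hg : X ^ q ∣ H * (H ^ e) ^ d - C (H.eval 0) := by
      have h1 : H * (H ^ e) ^ d = expand K q H := by
        rw [hq, FiniteField.expand_card, ← hq, hde, pow_succ, ← pow_mul, mul_comm e d]
        ring
      have h2 : (X : K[X]) ∣ H - C (H.eval 0) := by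
        rw [X_dvd_iff, coeff_sub, coeff_C_zero, coeff_zero_eq_eval_zero, sub_self]
      obtain ⟨S, hS⟩ := h2
      refine ⟨expand K q S, ?_⟩
      have := congrArg (expand K q) hS
      rw [map_sub, map_mul, expand_X, expand_C] at this
      rw [h1, this]
    have hk : ∀ n, ∀ j : Fin J, (j : ℕ) = n → k j = 0 := by
      intro n
      induction n using Nat.strong_induction_on with
      | _ n ih =>
        intro j hj
        refine eq_zero_of_X_pow_dvd_sum hd hζ H (H.eval 0) hH hH0 hD hpow (H ^ e) hg (k j)
          (B := A - 1) ?_ (q := q) ?_ ?_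
        · intro i
          refine natDegree_sum_le_of_forall_le _ _ fun a _ => ?_
          refine (natDegree_C_mul_X_pow_le _ _).trans ?_
          have := a.2
          omega
        · have : d * (D + (A - 1)) ≤ d * e := Nat.mul_le_mul_left _ (by omega)
          omega
        · have h1 : (X ^ q : K[X]) ^ (n + 1) ∣ (X ^ q) ^ n * ∑ i, k j i * (H ^ e) ^ (i : ℕ) := by
            have h2 : (X ^ q) ^ n * ∑ i, k j i * (H ^ e) ^ (i : ℕ) =
                - ∑ j' ∈ univ.erase j, (X ^ q) ^ (j' : ℕ) * ∑ i, k j' i * (H ^ e) ^ (i : ℕ) := by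
              have h3 := Finset.add_sum_erase univ (fun j' : Fin J =>
                (X ^ q) ^ (j' : ℕ) * ∑ i, k j' i * (H ^ e) ^ (i : ℕ)) (mem_univ j)
              rw [eq_neg_iff_add_eq_zero, ← hj, h3, ← hQk, hQ0]
            rw [h2, dvd_neg]
            refine Finset.dvd_sum fun j' hj' => ?_
            rw [mem_erase] at hj'
            rcases lt_trichotomy (j' : ℕ) n with h | h | h
            · simp [ih _ h j' rfl]
            · exact absurd (Fin.ext (h.trans hj.symm)) hj'.1
            · exact (pow_dvd_pow _ h).mul_right _
          rw [pow_succ] at h1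
          exact (mul_dvd_mul_iff_left (pow_ne_zero _ (pow_ne_zero _ X_ne_zero))).1 h1
    funext b
    have h1 := congrFun (hk _ b.1.1 rfl) b.1.2
    have h2 := congrArg (fun f : K[X] => f.coeff b.2) h1
    simp only [k, Pi.zero_apply, coeff_zero, finsetSum_coeff, coeff_C_mul, coeff_X_pow] at h2
    rw [Finset.sum_eq_single b.2] at h2
    · simpa using h2
    · intro a _ ha
      rw [if_neg (fun h => ha (Fin.ext h.symm)), mul_zero]
    · simp
  refine (Q.mul_card_le_natDegree hQ0 _ M hderiv).trans ?_
  refine natDegree_sum_le_of_forall_le _ _ fun b _ => ?_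
  refine (natDegree_C_mul_le _ _).trans ?_
  refine natDegree_mul_le.trans ?_
  refine (add_le_add natDegree_mul_le le_rfl).trans ?_
  rw [← pow_mul, ← pow_mul, natDegree_X_pow, natDegree_X_pow]
  have h1 : (H ^ (e * (b.1.2 : ℕ))).natDegree ≤ (d * e) * D := by
    refine natDegree_pow_le.trans (Nat.mul_le_mul ?_ hD)
    rw [mul_comm]
    exact Nat.mul_le_mul_right _ b.1.2.2.le
  have h2 : q * (b.1.1 : ℕ) + q ≤ q * J := by
    rw [← Nat.mul_succ]; exact Nat.mul_le_mul_left _ b.1.1.2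
  have h3 : d * e * D ≤ q * D := Nat.mul_le_mul_right _ (by omega)
  have h4 := b.2.2
  have h5 : e ≤ d * e := Nat.le_mul_of_pos_left _ hd
  rw [mul_add]
  omega

open Polynomial in
/-- Stepanov's upper bound for the number of `x` with prescribed `d`-th power residue symbol
of `H(x)`, with an unspecified constant depending only on `d` and the degree. -/
theorem stepanov_upper_bound (d D : ℕ) (hd : 0 < d) : ∃ B : ℝ, 0 ≤ B ∧
    ∀ (K : Type) [Field K] [Fintype K] [DecidableEq K] (e : ℕ), Fintype.card K = d * e + 1 →
    ∀ H : K[X], H ≠ 0 → H.natDegree ≤ D →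
    (∀ t, 1 < t → t ∣ d → ∀ u v : K[X], u ≠ 0 → v ≠ 0 → ∀ c : K, c ≠ 0 →
      H * u ^ t ≠ C c * v ^ t) →
    ∀ α : K, α ≠ 0 →
    (d : ℝ) * (univ.filter fun x => H.eval x ^ e = α).card ≤
      Fintype.card K + B * Real.sqrt (Fintype.card K) := by
  classical
  set s := 2 * d * (1 + D * d) with hs
  refine ⟨d * (2 * s + 2) ^ 2 + 4 * (s + D), by positivity, ?_⟩
  intro K _ _ _ e hcard H hH0 hD hpow α hα
  set q := Fintype.card K with hq
  set N := (univ.filter fun x => H.eval x ^ e = α).card with hN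
  have hNq : N ≤ q := by
    rw [hN, hq, ← Finset.card_univ]; exact Finset.card_filter_le _ _
  have hq1 : (1 : ℝ) ≤ q := by exact_mod_cast (by omega : 1 ≤ q)
  have hsq1 : (1 : ℝ) ≤ Real.sqrt q := by
    rw [Real.one_le_sqrt]; exact hq1
  by_cases hsmall : q < (2 * s + 2) ^ 2
  · have h1 : (N : ℝ) ≤ (2 * s + 2) ^ 2 := by
      exact_mod_cast hNq.trans hsmall.le
    have h2 : (d : ℝ) * N ≤ (d * (2 * s + 2) ^ 2 : ℝ) * 1 := by
      rw [mul_one]; gcongr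
    have h3 : (d * (2 * s + 2) ^ 2 : ℝ) * 1 ≤ (d * (2 * s + 2) ^ 2 + 4 * (s + D) : ℝ) * √q := by
      gcongr
      have : (0 : ℝ) ≤ 4 * (s + D) := by positivity
      linarith
    linarith
  push Not at hsmall
  set J := Nat.sqrt q with hJ
  have hJs : 2 * s + 2 ≤ J := by
    rw [hJ, Nat.le_sqrt']; exact hsmall
  have hJq : J * J ≤ q := Nat.sqrt_le q
  have hqJ : q < (J + 1) * (J + 1) := Nat.lt_succ_sqrt q
  have hds : d ≤ s := by
    rw [hs, mul_comm 2 d, mul_assoc]; exact Nat.le_mul_of_pos_right _ (by omega)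
  have hqd : 2 * (1 + d * D) < q := by
    have : 2 * (1 + d * D) ≤ 2 * s := by rw [hs]; nlinarith [Nat.zero_le (D * d)]
    nlinarith
  have heD : D < e := by
    by_contra h
    push Not at h
    have := Nat.mul_le_mul_left d h
    omega
  have hcore : ∀ G : K[X], G.eval 0 ≠ 0 → G.natDegree ≤ D →
      (∀ t, 1 < t → t ∣ d → ∀ u v : K[X], u ≠ 0 → v ≠ 0 →
        G * u ^ t ≠ C (G.eval 0) * v ^ t) →
      (d * (J - s)) * (univ.filter fun x => G.eval x ^ e = α).card ≤ q * (J + D) := by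
    intro G hG0 hGD hGpow
    obtain ⟨ζ, hζ⟩ := IsCyclic.exists_generator (α := Kˣ)
    have hord : orderOf ζ = d * e := by
      rw [orderOf_eq_card_of_forall_mem_zpowers hζ, Nat.card_eq_fintype_card, Fintype.card_units,
        ← hq, hcard, Nat.add_sub_cancel]
    have hprim : IsPrimitiveRoot ((ζ : K) ^ e) d := by
      have h1 : IsPrimitiveRoot (ζ : K) (d * e) := by
        rw [← hord, ← orderOf_units]; exact IsPrimitiveRoot.orderOf _
      exact h1.pow (by rw [← hord]; exact orderOf_pos ζ) (mul_comm _ _)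
    refine stepanov_mul_card_le (A := e - D) hd hq hcard hprim G hG0 hGD hGpow (by omega) α hα
      (by omega) (by omega) ?_ ?_
    · calc d * (J - s) ≤ J * J := Nat.mul_le_mul (by omega) (by omega)
        _ ≤ q := hJq
    · obtain ⟨j, hj⟩ : ∃ j, J = j + s := ⟨J - s, by omega⟩
      obtain ⟨A, hA⟩ : ∃ A, e = A + D := ⟨e - D, by omega⟩
      rw [show e - D = A by omega, show J - s = j by omega]
      have h1 : J * J * (1 + D * d) < s * A := by
        have h2 : s * A = (1 + D * d) * (2 * (d * A)) := by rw [hs]; ring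
        have h3 : q = d * A + d * D + 1 := by rw [hcard, hA]; ring
        have h4 : J * J < 2 * (d * A) := by omega
        rw [h2, mul_comm]
        exact Nat.mul_lt_mul_of_pos_left h4 (by omega)
      have h5 : d * j * (A + J + D * (d * j)) ≤ d * (j * A + J * J * (1 + D * d)) := by
        rw [mul_assoc]
        apply Nat.mul_le_mul_left
        have hjJ : j ≤ J := by omega
        have h6 : j * J ≤ J * J := Nat.mul_le_mul_right _ hjJ
        have h7 : j * j ≤ J * J := Nat.mul_le_mul hjJ hjJ
        have h8 : D * d * (j * j) ≤ D * d * (J * J) := Nat.mul_le_mul_left _ h7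
        nlinarith
      calc _ ≤ d * (j * A + J * J * (1 + D * d)) := h5
        _ < d * (j * A + s * A) := Nat.mul_lt_mul_of_pos_left (by omega) hd
        _ = A * d * J := by rw [hj]; ring
  have hmain : (d * (J - s)) * N ≤ q * (J + D) := by
    obtain ⟨r, hr⟩ : ∃ r : K, H.eval r ≠ 0 := by
      by_contra hall
      push Not at hall
      refine hH0 (eq_zero_of_natDegree_lt_card_of_eval_eq_zero' H univ (fun x _ => hall x) ?_)
      rw [Finset.card_univ, ← hq]
      have : d * D ≥ D := Nat.le_mul_of_pos_left _ hd
      omega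
    have hcount : (univ.filter fun x => (taylor r H).eval x ^ e = α).card = N := by
      rw [hN]
      refine Finset.card_bij (fun x _ => x + r) ?_ ?_ ?_
      · intro x hx
        simpa [taylor_eval] using hx
      · intro x _ y _ h
        exact add_right_cancel h
      · intro y hy
        refine ⟨y - r, ?_, sub_add_cancel _ _⟩
        simpa [taylor_eval] using hy
    rw [← hcount]
    refine hcore _ (by simpa [taylor_eval] using hr) (by rwa [natDegree_taylor]) ?_
    intro t ht htd u v hu hv h
    refine hpow t ht htd (taylor (-r) u) (taylor (-r) v) ?_ ?_ ((taylor r H).eval 0) ?_ ?_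
    · rwa [Ne, taylor_eq_zero]
    · rwa [Ne, taylor_eq_zero]
    · simpa [taylor_eval] using hr
    · have := congrArg (taylor (-r)) h
      simpa [taylor_mul, taylor_taylor, taylor_pow] using this
  have hJR : (2 * s + 2 : ℝ) ≤ J := by exact_mod_cast hJs
  have hmainR : (d : ℝ) * ((J : ℝ) - s) * N ≤ q * (J + D) := by
    have := hmain
    rw [← Nat.cast_sub (by omega : s ≤ J)]
    exact_mod_cast this
  have hsqJ : Real.sqrt q ≤ 2 * J := by
    rw [Real.sqrt_le_left (by positivity)]
    have : (q : ℝ) ≤ (J + 1) * (J + 1) := by exact_mod_cast hqJ.le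
    nlinarith
  have hs0 : (0 : ℝ) ≤ s := by positivity
  have hJs0 : (0 : ℝ) < (J : ℝ) - s := by linarith
  have hqq : Real.sqrt q * Real.sqrt q = q := Real.mul_self_sqrt (by positivity)
  have h9 : (d : ℝ) * N ≤ q + 4 * (s + D) * √q := by
    have h10 : ((J : ℝ) - s) * ((d : ℝ) * N) ≤ ((J : ℝ) - s) * (q + 4 * (s + D) * √q) := by
      have h11 : (q : ℝ) * (s + D) ≤ ((J : ℝ) - s) * (4 * (s + D) * √q) := by
        have h12 : (q : ℝ) ≤ (2 * J) * √q := by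
          nth_rewrite 1 [← hqq]; gcongr
        have h13 : (J : ℝ) ≤ 2 * (J - s) := by linarith
        have h14 : (0:ℝ) ≤ (s + D) * √q := by positivity
        calc (q : ℝ) * (s + D) ≤ (2 * J) * √q * (s + D) := by gcongr
          _ = 2 * J * ((s + D) * √q) := by ring
          _ ≤ 2 * (2 * (J - s)) * ((s + D) * √q) := by gcongr
          _ = _ := by ring
      calc ((J : ℝ) - s) * ((d : ℝ) * N) = (d : ℝ) * ((J : ℝ) - s) * N := by ring
        _ ≤ q * (J + D) := hmainR
        _ = ((J : ℝ) - s) * q + q * (s + D) := by ring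
        _ ≤ _ := by rw [mul_add]; linarith
    exact le_of_mul_le_mul_left h10 hJs0
  have h15 : (0 : ℝ) ≤ d * (2 * s + 2) ^ 2 * √q := by positivity
  calc _ ≤ _ := h9
    _ ≤ _ := by linarith

/-- If an element of multiplicity `m` at a prime `π` becomes a constant times a `t`-th power
after multiplication by a `t`-th power, then `t ∣ m`. -/
theorem dvd_of_emultiplicity_eq_of_mul_pow_eq {R : Type*} [CommRing R] [IsDomain R]
    [WfDvdMonoid R] {π h u v c : R} {m t : ℕ} (hπ : Prime π) (hm : emultiplicity π h = m)
    (hu : u ≠ 0) (hv : v ≠ 0) (hc : IsUnit c) (huv : h * u ^ t = c * v ^ t) : t ∣ m := by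
  have hfu : FiniteMultiplicity π u := FiniteMultiplicity.of_prime_left hπ hu
  have hfv : FiniteMultiplicity π v := FiniteMultiplicity.of_prime_left hπ hv
  have h1 := congrArg (emultiplicity π) huv
  rw [emultiplicity_mul hπ, emultiplicity_mul hπ, emultiplicity_pow hπ, emultiplicity_pow hπ, hm,
    emultiplicity_of_isUnit_right hπ.not_isUnit hc,
    hfu.emultiplicity_eq_multiplicity, hfv.emultiplicity_eq_multiplicity, zero_add] at h1
  have h2 : m + t * multiplicity π u = t * multiplicity π v := by exact_mod_cast h1
  exact (Nat.dvd_add_left (Dvd.intro _ rfl)).1 (h2 ▸ Dvd.intro _ rfl)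

open Polynomial in
/-- A product of powers of irreducible polynomials over `ZMod p`, composed with an Artin–Schreier
polynomial over an extension, is not a `t`-th power up to constants and `t`-th powers. -/
theorem prod_pow_artinSchreier_ne {p : ℕ} [Fact p.Prime] {ι : Type*} [Fintype ι]
    (g : ι → (ZMod p)[X]) (hirr : ∀ j, Irreducible (g j))
    (hcop : ∀ i j, i ≠ j → IsCoprime (g i) (g j)) (f : ι → ℕ)
    {K : Type*} [Field K] [Algebra (ZMod p) K] (x₀ : K) (t : ℕ) (j : ι) (hj : ¬ t ∣ f j)
    (u v : K[X]) (hu : u ≠ 0) (hv : v ≠ 0) (c : K) (hc : c ≠ 0) :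
    (((∏ i, g i ^ f i).map (algebraMap (ZMod p) K)).comp (C x₀ + X ^ p - X)) * u ^ t
      ≠ C c * v ^ t := by
  classical
  have hp := (Fact.out : p.Prime)
  intro huv
  set A : K[X] := C x₀ + X ^ p - X with hA
  have : CharP K p := charP_of_injective_algebraMap (algebraMap (ZMod p) K).injective p
  have hAd : derivative A = -1 := by
    simp [hA, derivative_X_pow]
  set φ : (ZMod p)[X] →+* K[X] := (compRingHom A).comp (mapRingHom (algebraMap (ZMod p) K)) with hφ
  have hφa : ∀ G, φ G = (G.map (algebraMap (ZMod p) K)).comp A := fun G => by simp [hφ]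
  rw [← hφa, map_prod] at huv
  have hAdeg : A.natDegree = p := by
    have : (C x₀ + X ^ p - X : K[X]) = X ^ p + (C x₀ - X) := by ring
    rw [hA, this, natDegree_add_eq_left_of_natDegree_lt, natDegree_X_pow]
    rw [natDegree_X_pow]
    refine lt_of_le_of_lt (natDegree_sub_le _ _) ?_
    simp [hp.one_lt]
  have hsep : (φ (g j)).Separable := by
    have h1 := PerfectField.separable_of_irreducible (hirr j)
    obtain ⟨a, b, hab⟩ := h1
    refine ⟨φ a, - φ b, ?_⟩
    have h2 : derivative (φ (g j)) = - φ (derivative (g j)) := by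
      rw [hφa, derivative_comp, hAd, derivative_map, hφa]; ring
    rw [h2, neg_mul_neg, ← map_mul, ← map_mul, ← map_add, hab, map_one]
  have hunit : ¬ IsUnit (φ (g j)) := by
    intro h
    have h1 := natDegree_eq_zero_of_isUnit h
    rw [hφa, natDegree_comp, natDegree_map, hAdeg] at h1
    have := (hirr j).natDegree_pos
    have := hp.pos
    rcases Nat.mul_eq_zero.1 h1 with h | h <;> omega
  obtain ⟨π, hπ, hdvd⟩ := WfDvdMonoid.exists_irreducible_factor hunit hsep.ne_zero
  have hπp : Prime π := hπ.prime
  have hm : emultiplicity π (∏ i, φ (g i ^ f i)) = (f j : ℕ) := by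
    rw [Finset.emultiplicity_prod hπp, Finset.sum_eq_single j]
    · rw [map_pow, emultiplicity_pow hπp]
      have h1 : emultiplicity π (φ (g j)) = (1 : ℕ) := by
        rw [emultiplicity_eq_coe]
        refine ⟨by simpa using hdvd, fun h => hπ.not_isUnit ?_⟩
        exact hsep.squarefree π (by simpa [pow_two] using h)
      rw [h1]; simp
    · intro i _ hij
      rw [map_pow, emultiplicity_pow hπp, emultiplicity_eq_zero.2, mul_zero]
      intro h
      have h2 : IsCoprime (φ (g i)) (φ (g j)) := (hcop i j hij).map φ
      exact hπ.not_isUnit (h2.isUnit_of_dvd' h hdvd)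
    · simp
  exact hj (dvd_of_emultiplicity_eq_of_mul_pow_eq hπp hm hu hv
    (isUnit_C.2 (isUnit_iff_ne_zero.2 hc)) huv)

/-- Each element of trace `trace x₀` is attained at least `p` times by `z ↦ x₀ + z ^ p - z`. -/
theorem mul_card_filter_trace_le {p : ℕ} [Fact p.Prime] {K : Type*} [Field K] [Fintype K]
    [DecidableEq K] [Algebra (ZMod p) K] (x₀ : K) (P : K → Prop) [DecidablePred P] :
    p * (univ.filter fun x : K =>
        Algebra.trace (ZMod p) K x = Algebra.trace (ZMod p) K x₀ ∧ P x).card ≤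
      (univ.filter fun z : K => P (x₀ + z ^ p - z)).card := by
  classical
  have hp := (Fact.out : p.Prime)
  have : CharP K p := charP_of_injective_algebraMap (algebraMap (ZMod p) K).injective p
  have : Module.Finite (ZMod p) K := Module.Finite.of_finite
  have hZ : Fintype.card (ZMod p) = p := ZMod.card p
  let L : K →ₗ[ZMod p] K := (FiniteField.frobeniusAlgHom (ZMod p) K).toLinearMap - LinearMap.id
  have hL : ∀ z, L z = z ^ p - z := fun z => by
    simp [L]
  have hker : Module.finrank (ZMod p) (LinearMap.ker L) ≤ 1 := by
    have h1 : Fintype.card (LinearMap.ker L) ≤ p := by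
      have h2 : (Polynomial.X ^ p - Polynomial.X : Polynomial K) ≠ 0 :=
        FiniteField.X_pow_card_sub_X_ne_zero K hp.one_lt
      have h3 := Polynomial.card_roots' (Polynomial.X ^ p - Polynomial.X : Polynomial K)
      rw [FiniteField.X_pow_card_sub_X_natDegree_eq K hp.one_lt] at h3
      refine le_trans ?_ ((Multiset.toFinset_card_le _).trans h3)
      rw [← Fintype.card_coe]
      refine Fintype.card_le_of_injective (fun z => ⟨z.1, ?_⟩) ?_
      · have := z.2
        rw [LinearMap.mem_ker, hL] at this
        rw [Multiset.mem_toFinset, Polynomial.mem_roots h2]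
        simpa using this
      · intro a b hab
        ext
        simpa using congrArg Subtype.val hab
    rw [Module.card_eq_pow_finrank (K := ZMod p), hZ] at h1
    by_contra! h
    have := Nat.pow_lt_pow_right hp.one_lt h
    rw [pow_one] at this; omega
  have hle : LinearMap.range L ≤ LinearMap.ker (Algebra.trace (ZMod p) K) := by
    rintro _ ⟨z, rfl⟩
    have h1 : Algebra.trace (ZMod p) K (FiniteField.frobeniusAlgEquiv (ZMod p) K p z)
      = Algebra.trace (ZMod p) K z := Algebra.trace_eq_of_algEquiv _ _
    rw [LinearMap.mem_ker, hL, map_sub, sub_eq_zero, ← h1]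
    simp
  have hrange : LinearMap.range L = LinearMap.ker (Algebra.trace (ZMod p) K) := by
    refine Submodule.eq_of_le_of_finrank_le hle ?_
    have h1 := LinearMap.finrank_range_add_finrank_ker L
    have h2 := LinearMap.finrank_range_add_finrank_ker (Algebra.trace (ZMod p) K)
    rw [LinearMap.range_eq_top.2 (Algebra.trace_surjective (ZMod p) K), finrank_top,
      Module.finrank_self] at h2
    omega
  have hex : ∀ x : K, Algebra.trace (ZMod p) K x = Algebra.trace (ZMod p) K x₀ →
      ∃ z, x₀ + z ^ p - z = x := by
    intro x hx
    have : x - x₀ ∈ LinearMap.range L := by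
      rw [hrange, LinearMap.mem_ker, map_sub, hx, sub_self]
    obtain ⟨z, hz⟩ := this
    rw [hL] at hz
    exact ⟨z, by rw [add_sub_assoc, hz]; ring⟩
  choose! ζ hζ using hex
  have hcard : p * (univ.filter fun x : K =>
        Algebra.trace (ZMod p) K x = Algebra.trace (ZMod p) K x₀ ∧ P x).card =
      ((univ : Finset (ZMod p)) ×ˢ (univ.filter fun x : K =>
        Algebra.trace (ZMod p) K x = Algebra.trace (ZMod p) K x₀ ∧ P x)).card := by
    rw [card_product, card_univ, hZ]
  rw [hcard]
  have hkey : ∀ (a : ZMod p) (x : K), Algebra.trace (ZMod p) K x = Algebra.trace (ZMod p) K x₀ →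
      x₀ + (ζ x + algebraMap (ZMod p) K a) ^ p - (ζ x + algebraMap (ZMod p) K a) = x := by
    intro a x hx
    rw [add_pow_char, ← map_pow, ZMod.pow_card]
    linear_combination hζ x hx
  refine card_le_card_of_injOn (fun ax => ζ ax.2 + algebraMap (ZMod p) K ax.1) ?_ ?_
  · rintro ⟨a, x⟩ hax
    simp only [coe_product, Set.mem_prod, coe_univ, Set.mem_univ, true_and, coe_filter,
      mem_univ, Set.mem_ofPred_eq] at hax ⊢
    rw [hkey a x hax.1]; exact hax.2
  · rintro ⟨a, x⟩ hax ⟨b, y⟩ hby hab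
    simp only [coe_product, Set.mem_prod, coe_univ, Set.mem_univ, true_and, coe_filter,
      mem_univ, Set.mem_ofPred_eq] at hax hby hab
    have hxy : x = y := by rw [← hkey a x hax.1, ← hkey b y hby.1, hab]
    subst hxy
    simpa using hab

/-- Finitely many nontrivial elements of a finite cyclic group are powers of a common element `η`
with no common factor in the exponents. -/
theorem exists_common_generator {G ι : Type*} [CommGroup G] [Finite G] [IsCyclic G]
    [Nonempty ι] (χ : ι → G) (hχ : ∀ j, χ j ≠ 1) :
    ∃ (η : G) (f : ι → ℕ), η ≠ 1 ∧ (∀ j, f j ≠ 0) ∧ (∀ j, χ j = η ^ f j) ∧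
      ∀ t, 1 < t → t ∣ orderOf η → ∃ j, ¬ t ∣ f j := by
  classical
  let H := Subgroup.closure (Set.range χ)
  have hH : IsCyclic H := inferInstance
  obtain ⟨η, hη⟩ := (Subgroup.isCyclic_iff_exists_zpowers_eq_top H).1 hH
  have hmem : ∀ j, ∃ n : ℕ, η ^ n = χ j := by
    intro j
    have h1 : χ j ∈ Subgroup.zpowers η := by
      rw [hη]; exact Subgroup.subset_closure ⟨j, rfl⟩
    rw [mem_zpowers_iff_mem_range_orderOf] at h1
    simp only [Finset.mem_image] at h1
    obtain ⟨n, -, hn⟩ := h1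
    exact ⟨n, hn⟩
  choose f hf using hmem
  refine ⟨η, f, ?_, ?_, fun j => (hf j).symm, ?_⟩
  · rintro rfl
    obtain ⟨j⟩ := ‹Nonempty ι›
    exact hχ j (by rw [← hf j, one_pow])
  · intro j h0
    exact hχ j (by rw [← hf j, h0, pow_zero])
  · intro t ht htd
    by_contra! hall
    have hle : H ≤ Subgroup.zpowers (η ^ t) := by
      rw [Subgroup.closure_le]
      rintro _ ⟨j, rfl⟩
      obtain ⟨m, hm⟩ := hall j
      refine ⟨m, ?_⟩
      simp only [zpow_natCast]
      rw [← pow_mul, ← hm, hf]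
    have h1 : η ∈ Subgroup.zpowers (η ^ t) := hle (hη ▸ Subgroup.mem_zpowers η)
    have h2 := orderOf_dvd_of_mem_zpowers h1
    rw [orderOf_pow_of_dvd (by omega) htd] at h2
    have h3 := Nat.le_of_dvd (Nat.div_pos (Nat.le_of_dvd (orderOf_pos η) htd) (by omega)) h2
    have h4 := Nat.div_lt_self (orderOf_pos η) ht
    omega

instance {p : ℕ} [Fact p.Prime] : IsCyclic (MulChar (ZMod p) ℂ) := by
  obtain ⟨e⟩ := MulChar.mulEquiv_units (ZMod p) ℂ
  exact e.symm.isCyclic.1 inferInstance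

/-- A multiplicative character of order `d` takes the same value at units with the same
`(p - 1) / d`-th power. -/
theorem MulChar.eq_one_of_pow_eq_one {p : ℕ} [Fact p.Prime] (η : MulChar (ZMod p) ℂ) {e₀ : ℕ}
    (he : orderOf η * e₀ = p - 1) (y : (ZMod p)ˣ) (hy : y ^ e₀ = 1) : η y = 1 := by
  obtain ⟨γ, hγ⟩ := IsCyclic.exists_generator (α := (ZMod p)ˣ)
  obtain ⟨k, rfl⟩ := (mem_powers_iff_mem_zpowers.2 (hγ y))
  have h1 : orderOf γ = p - 1 := by
    rw [orderOf_eq_card_of_forall_mem_zpowers hγ, Nat.card_eq_fintype_card, ZMod.card_units]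
  have h0 : 0 < p - 1 := by have := (Fact.out : p.Prime).two_le; omega
  have he0 : 0 < e₀ := Nat.pos_of_ne_zero (by rintro rfl; omega)
  have h2 : orderOf η ∣ k := by
    have hy' : γ ^ (k * e₀) = 1 := by rw [pow_mul]; exact hy
    have := orderOf_dvd_of_pow_eq_one hy'
    rw [h1, ← he] at this
    exact Nat.dvd_of_mul_dvd_mul_right he0 this
  obtain ⟨m, rfl⟩ := h2
  have h3 : η ^ orderOf η = 1 := pow_orderOf_eq_one η
  have h4 : η γ ^ orderOf η = 1 := by
    rw [← MulChar.pow_apply_coe, h3, MulChar.one_apply_coe]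
  simp only [Units.val_pow_eq_pow_val, map_pow]
  rw [pow_mul, h4, one_pow]

/-- If a nonnegative-mass distribution on a finite set never exceeds its average by much, then
its sum against weights of modulus at most one and of total sum zero is small. -/
theorem norm_sum_mul_le_of_upper_bound {ι : Type*} (s : Finset ι) (w : ι → ℂ) (n : ι → ℝ) (U : ℝ)
    (hw : ∀ i ∈ s, ‖w i‖ ≤ 1) (hw0 : ∑ i ∈ s, w i = 0) (hn : ∀ i ∈ s, n i ≤ U) :
    ‖∑ i ∈ s, w i * n i‖ ≤ s.card * U - ∑ i ∈ s, n i := by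
  have h1 : ∑ i ∈ s, w i * n i = - ∑ i ∈ s, w i * ((U - n i : ℝ) : ℂ) := by
    push_cast
    simp_rw [mul_sub]
    rw [Finset.sum_sub_distrib, ← Finset.sum_mul, hw0]; ring
  rw [h1, norm_neg]
  calc _ ≤ ∑ i ∈ s, (U - n i) := by
        refine (norm_sum_le _ _).trans (Finset.sum_le_sum fun i hi => ?_)
        have := hn i hi
        rw [norm_mul, Complex.norm_real, Real.norm_of_nonneg (by linarith)]
        exact mul_le_of_le_one_left (by linarith) (hw i hi)
    _ = _ := by rw [Finset.sum_sub_distrib, Finset.sum_const, nsmul_eq_mul]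

theorem IsCyclic.card_pow_eq_one_of_dvd {G : Type*} [CommGroup G] [Fintype G] [DecidableEq G]
    [IsCyclic G] {e : ℕ} (he : e ∣ Fintype.card G) :
    (univ.filter fun y : G => y ^ e = 1).card = e := by
  have h0 : e ≠ 0 := fun h => Fintype.card_ne_zero (zero_dvd_iff.1 (h ▸ he))
  rw [← sum_card_orderOf_eq_card_pow_eq_one h0]
  conv_rhs => rw [← Nat.sum_totient e]
  refine Finset.sum_congr rfl fun m hm => ?_
  exact IsCyclic.card_orderOf_eq_totient ((Nat.dvd_of_mem_divisors hm).trans he)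

open Polynomial in
/-- Square-root cancellation, up to a constant independent of the extension `K` of `ZMod p`, for
the sum over `K` of a multiplicative character of `F(x)` times an additive character of `x`. -/
theorem exists_norm_sum_extension_le_aux {p : ℕ} [Fact p.Prime] (F : (ZMod p)[X]) (hF : F ≠ 0)
    (η : MulChar (ZMod p) ℂ) (hη : η ≠ 1) (ψ : AddChar (ZMod p) ℂ)
    (hpow : ∀ (K : Type) [Field K] [Algebra (ZMod p) K] (x₀ : K), ∀ t, 1 < t → t ∣ orderOf η →
      ∀ u v : K[X], u ≠ 0 → v ≠ 0 → ∀ c : K, c ≠ 0 →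
      ((F.map (algebraMap (ZMod p) K)).comp (C x₀ + X ^ p - X)) * u ^ t ≠ C c * v ^ t) :
    ∃ B : ℝ, 0 ≤ B ∧ ∀ (K : Type) [Field K] [Fintype K] [Algebra (ZMod p) K],
      ‖∑ x : K, η (Algebra.norm (ZMod p) (aeval x F)) * ψ (Algebra.trace (ZMod p) K x)‖ ≤
        B * Real.sqrt (Fintype.card K) := by
  classical
  have hp := (Fact.out : p.Prime)
  have hp2 := hp.two_le
  set d := orderOf η with hd
  have hd0 : 0 < d := orderOf_pos η
  obtain ⟨e₀, he₀⟩ : d ∣ p - 1 := by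
    have := MulChar.orderOf_dvd_card_sub_one (ZMod p) η
    rwa [ZMod.card] at this
  have he₀0 : 0 < e₀ := Nat.pos_of_ne_zero (by rintro rfl; omega)
  obtain ⟨B, hB0, hB⟩ := stepanov_upper_bound d (F.natDegree * p) hd0
  refine ⟨B + F.natDegree, by positivity, ?_⟩
  intro K _ _ _
  set q := Fintype.card K with hq
  have : Module.Finite (ZMod p) K := Module.Finite.of_finite
  have hq1 : 1 < q := Fintype.one_lt_card
  obtain ⟨m, hm⟩ : p - 1 ∣ q - 1 := by
    rw [hq, Module.card_eq_pow_finrank (K := ZMod p), ZMod.card]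
    simpa using Nat.sub_dvd_pow_sub_pow p 1 (Module.finrank (ZMod p) K)
  have hmdiv : (Nat.card K - 1) / (Nat.card (ZMod p) - 1) = m := by
    rw [Nat.card_eq_fintype_card, Nat.card_eq_fintype_card, ← hq, ZMod.card, hm]
    exact Nat.mul_div_cancel_left _ (by omega)
  have hcard : q = d * (m * e₀) + 1 := by
    have : d * (m * e₀) = q - 1 := by rw [hm, he₀]; ring
    omega
  set NF : K → ZMod p := fun x => Algebra.norm (ZMod p) (aeval x F) with hNF
  set n : (ZMod p)ˣ × ZMod p → ℕ := fun yb =>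
    (univ.filter fun x : K => Algebra.trace (ZMod p) K x = yb.2 ∧
      NF x ^ e₀ = (yb.1 : ZMod p) ^ e₀).card with hn
  have hupper : ∀ yb, (p : ℝ) * (d * n yb) ≤ q + B * Real.sqrt q := by
    rintro ⟨y, β⟩
    obtain ⟨x₀, hx₀⟩ := Algebra.trace_surjective (ZMod p) K β
    have hinj := (algebraMap (ZMod p) K).injective
    set A : K[X] := C x₀ + X ^ p - X with hA
    have hAdeg : A.natDegree = p := by
      have : (C x₀ + X ^ p - X : K[X]) = X ^ p + (C x₀ - X) := by ring
      rw [hA, this, natDegree_add_eq_left_of_natDegree_lt, natDegree_X_pow]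
      rw [natDegree_X_pow]
      refine lt_of_le_of_lt (natDegree_sub_le _ _) ?_
      simp [hp.one_lt]
    have hHdeg : ((F.map (algebraMap (ZMod p) K)).comp A).natDegree ≤ F.natDegree * p := by
      rw [natDegree_comp, natDegree_map, hAdeg]
    have hH0 : (F.map (algebraMap (ZMod p) K)).comp A ≠ 0 := by
      intro h
      rcases comp_eq_zero_iff.1 h with h | h
      · exact hF (by rwa [Polynomial.map_eq_zero] at h)
      · have := congrArg natDegree h.2
        rw [hAdeg, natDegree_C] at this; omega
    have h1 := hB K (m * e₀) hcard _ hH0 hHdeg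
      (fun t ht htd u v hu hv c hc => hpow K x₀ t ht htd u v hu hv c hc)
      (algebraMap (ZMod p) K ((y : ZMod p) ^ e₀)) (by
        rw [Ne, map_eq_zero_iff _ hinj]; exact pow_ne_zero _ y.ne_zero)
    refine le_trans ?_ h1
    have h2 := mul_card_filter_trace_le (p := p) x₀
      (fun x : K => NF x ^ e₀ = (y : ZMod p) ^ e₀)
    have h3 : (univ.filter fun z : K => NF (x₀ + z ^ p - z) ^ e₀ = (y : ZMod p) ^ e₀) =
        univ.filter fun z : K => (eval z ((F.map (algebraMap (ZMod p) K)).comp A)) ^ (m * e₀) =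
          algebraMap (ZMod p) K ((y : ZMod p) ^ e₀) := by
      refine Finset.filter_congr fun z _ => ?_
      rw [← hinj.eq_iff, map_pow, hNF, FiniteField.algebraMap_norm_eq_pow, hmdiv, ← pow_mul,
        eval_comp, eval_map_algebraMap, hA]
      simp
    rw [h3, hx₀] at h2
    have h4 : p * n (y, β) ≤ (univ.filter fun z : K =>
        (eval z ((F.map (algebraMap (ZMod p) K)).comp A)) ^ (m * e₀) =
          algebraMap (ZMod p) K ((y : ZMod p) ^ e₀)).card := h2
    have h5 : ((p * n (y, β) : ℕ) : ℝ) ≤ _ := Nat.cast_le.2 h4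
    rw [Nat.cast_mul] at h5
    calc (p : ℝ) * (d * n (y, β)) = d * (p * n (y, β)) := by ring
      _ ≤ _ := by gcongr
  have hE : (univ.filter fun y : (ZMod p)ˣ => y ^ e₀ = 1).card = e₀ :=
    IsCyclic.card_pow_eq_one_of_dvd (by rw [ZMod.card_units, he₀]; exact Dvd.intro_left _ rfl)
  have hfib : ∀ a : (ZMod p)ˣ,
      (univ.filter fun y : (ZMod p)ˣ => (a : ZMod p) ^ e₀ = (y : ZMod p) ^ e₀).card = e₀ := by
    intro a
    refine Eq.trans ?_ hE
    refine Finset.card_bij' (fun y _ => y * a⁻¹) (fun y _ => y * a) ?_ ?_ ?_ ?_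
    · intro y hy
      simp only [mem_filter, mem_univ, true_and] at hy ⊢
      have : a ^ e₀ = y ^ e₀ := by ext; simpa using hy
      rw [mul_pow, ← this, inv_pow, mul_inv_cancel]
    · intro y hy
      simp only [mem_filter, mem_univ, true_and] at hy ⊢
      have : (y * a) ^ e₀ = a ^ e₀ := by rw [mul_pow, hy, one_mul]
      simpa using congrArg Units.val this.symm
    · intro y _; simp
    · intro y _; simp
  have hηeq : ∀ a y : (ZMod p)ˣ, (a : ZMod p) ^ e₀ = (y : ZMod p) ^ e₀ → η y = η a := by
    intro a y h
    have h1 : (y * a⁻¹) ^ e₀ = 1 := by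
      have : a ^ e₀ = y ^ e₀ := by ext; simpa using h
      rw [mul_pow, ← this, inv_pow, mul_inv_cancel]
    have h2 := MulChar.eq_one_of_pow_eq_one η he₀.symm _ h1
    have h3 : y = (y * a⁻¹) * a := by simp
    rw [h3, Units.val_mul, map_mul, h2, one_mul]
  have hinner : ∀ b : ZMod p,
      ∑ y : (ZMod p)ˣ, (if b ^ e₀ = (y : ZMod p) ^ e₀ then η y else 0) = e₀ * η b := by
    intro b
    by_cases hb : b = 0
    · subst hb
      rw [MulChar.map_nonunit η not_isUnit_zero, mul_zero]
      refine Finset.sum_eq_zero fun y _ => if_neg ?_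
      rw [zero_pow he₀0.ne']
      exact (pow_ne_zero _ y.ne_zero).symm
    · lift b to (ZMod p)ˣ using isUnit_iff_ne_zero.2 hb
      rw [← Finset.sum_filter, Finset.sum_congr rfl (g := fun _ => η b), Finset.sum_const, hfib,
        nsmul_eq_mul]
      intro y hy
      exact hηeq b y (by simpa using hy)
  have hsum : ∑ yb, (η yb.1 * ψ yb.2) * ((n yb : ℝ) : ℂ) = e₀ * ∑ x : K, η (NF x) *
      ψ (Algebra.trace (ZMod p) K x) := by
    have h1 : ∀ yb : (ZMod p)ˣ × ZMod p, (η yb.1 * ψ yb.2) * ((n yb : ℝ) : ℂ) =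
        ∑ x : K, if Algebra.trace (ZMod p) K x = yb.2 ∧ NF x ^ e₀ = (yb.1 : ZMod p) ^ e₀
          then η yb.1 * ψ yb.2 else 0 := by
      intro yb
      rw [← Finset.sum_filter, Finset.sum_const, nsmul_eq_mul, mul_comm]
      simp [hn]
    simp_rw [h1]
    rw [Finset.sum_comm, Finset.mul_sum]
    refine Finset.sum_congr rfl fun x _ => ?_
    rw [Fintype.sum_prod_type, ← mul_assoc, ← hinner, Finset.sum_mul]
    refine Finset.sum_congr rfl fun y _ => ?_
    rw [Finset.sum_eq_single (Algebra.trace (ZMod p) K x)]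
    · simp only [true_and]
      split_ifs <;> simp
    · intro β _ hβ
      exact if_neg fun h => hβ h.1.symm
    · simp
  have hntot : ((q : ℝ) - F.natDegree) * e₀ ≤ ∑ yb, (n yb : ℝ) := by
    have h1 : ∀ yb : (ZMod p)ˣ × ZMod p, (n yb : ℝ) =
        ∑ x : K, if Algebra.trace (ZMod p) K x = yb.2 ∧ NF x ^ e₀ = (yb.1 : ZMod p) ^ e₀
          then 1 else 0 := by
      intro yb
      simp [hn]
    simp_rw [h1]
    rw [Finset.sum_comm]
    have h2 : ∀ x : K, (if NF x = 0 then 0 else (e₀ : ℝ)) ≤ ∑ yb : (ZMod p)ˣ × ZMod p,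
        if Algebra.trace (ZMod p) K x = yb.2 ∧ NF x ^ e₀ = (yb.1 : ZMod p) ^ e₀
          then (1 : ℝ) else 0 := by
      intro x
      split_ifs with h0
      · positivity
      · rw [Fintype.sum_prod_type]
        obtain ⟨a, ha⟩ := isUnit_iff_ne_zero.2 h0
        rw [← ha]
        conv_lhs => rw [← hfib a, Finset.card_filter]
        push_cast
        refine le_of_eq (Finset.sum_congr rfl fun y _ => ?_)
        rw [Finset.sum_eq_single (Algebra.trace (ZMod p) K x)]
        · simp
        · intro β _ hβ
          exact if_neg fun h => hβ h.1.symm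
        · simp
    refine le_trans ?_ (Finset.sum_le_sum fun x _ => h2 x)
    have hroots : (univ.filter fun x : K => NF x = 0).card ≤ F.natDegree := by
      have hmap0 : F.map (algebraMap (ZMod p) K) ≠ 0 := by rwa [Ne, Polynomial.map_eq_zero]
      have h3 := Polynomial.card_roots' (F.map (algebraMap (ZMod p) K))
      rw [natDegree_map] at h3
      refine le_trans (Finset.card_le_card ?_) ((Multiset.toFinset_card_le _).trans h3)
      intro x hx
      simp only [mem_filter, mem_univ, true_and, hNF, Algebra.norm_eq_zero_iff] at hx
      rw [Multiset.mem_toFinset, mem_roots hmap0, IsRoot, eval_map_algebraMap, hx]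
    have h4 : ∑ x : K, (if NF x = 0 then 0 else (e₀ : ℝ)) =
        (q - (univ.filter fun x : K => NF x = 0).card) * e₀ := by
      have : ∀ x : K, (if NF x = 0 then 0 else (e₀ : ℝ)) = e₀ - if NF x = 0 then (e₀:ℝ) else 0 := by
        intro x; split_ifs <;> simp
      simp_rw [this]
      rw [Finset.sum_sub_distrib, ← Finset.sum_filter, Finset.sum_const, Finset.sum_const,
        card_univ, nsmul_eq_mul, nsmul_eq_mul]
      ring
    rw [h4]
    have : ((univ.filter fun x : K => NF x = 0).card : ℝ) ≤ F.natDegree := by exact_mod_cast hroots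
    gcongr
  have hpd : (0 : ℝ) < p * d := by have := hp.pos; positivity
  have hmain := norm_sum_mul_le_of_upper_bound (univ : Finset ((ZMod p)ˣ × ZMod p))
    (fun yb => η yb.1 * ψ yb.2) (fun yb => (n yb : ℝ)) ((q + B * Real.sqrt q) / (p * d))
    (by
      rintro ⟨y, β⟩ -
      rw [norm_mul, AddChar.norm_apply, mul_one]
      exact DirichletCharacter.norm_le_one η y)
    (by
      rw [Fintype.sum_prod_type]
      simp_rw [← Finset.mul_sum]
      rw [← Finset.sum_mul]
      have h1 := MulChar.sum_eq_zero_of_ne_one hη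
      have h2 : ∑ y : (ZMod p)ˣ, η y = 0 := by
        rw [← h1]
        exact Fintype.sum_of_injective _ Units.val_injective _ _
          (fun y hy => MulChar.map_nonunit η (fun hu => hy ⟨hu.unit, rfl⟩)) (fun _ => rfl)
      rw [h2, zero_mul])
    (by
      intro yb _
      rw [le_div_iff₀ hpd]
      have := hupper yb
      linarith)
  rw [hsum, norm_mul, Complex.norm_natCast, card_univ, Fintype.card_prod, ZMod.card,
    ZMod.card_units, he₀] at hmain
  have hp0 : (p : ℝ) ≠ 0 := by exact_mod_cast hp.ne_zero
  have hd0' : (d : ℝ) ≠ 0 := by exact_mod_cast hd0.ne'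
  have h5 : ((d * e₀ * p : ℕ) : ℝ) * ((q + B * Real.sqrt q) / (p * d)) =
      e₀ * (q + B * Real.sqrt q) := by
    push_cast
    field_simp
  rw [h5] at hmain
  have he₀pos : (0 : ℝ) < e₀ := by exact_mod_cast he₀0
  have hsq : 1 ≤ Real.sqrt q := by
    rw [Real.one_le_sqrt]; exact_mod_cast hq1.le
  refine le_of_mul_le_mul_left (hmain.trans ?_) he₀pos
  have hFd : (F.natDegree : ℝ) ≤ F.natDegree * Real.sqrt q := le_mul_of_one_le_right (by positivity) hsq
  nlinarith

open Polynomial in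
/-- Square-root cancellation, up to a constant independent of the extension, for mixed character
sums with nontrivial multiplicative characters of pairwise coprime irreducible polynomials. -/
theorem exists_norm_sum_extension_le {p : ℕ} [Fact p.Prime] {ι : Type*} [Fintype ι] [Nonempty ι]
    (g : ι → (ZMod p)[X]) (hirr : ∀ j, Irreducible (g j))
    (hcop : ∀ i j, i ≠ j → IsCoprime (g i) (g j)) (χ : ι → MulChar (ZMod p) ℂ)
    (hχ : ∀ j, χ j ≠ 1) (ψ : AddChar (ZMod p) ℂ) :
    ∃ B : ℝ, 0 ≤ B ∧ ∀ (K : Type) [Field K] [Fintype K] [Algebra (ZMod p) K],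
      ‖∑ x : K, (∏ j, χ j (Algebra.norm (ZMod p) (aeval x (g j)))) *
        ψ (Algebra.trace (ZMod p) K x)‖ ≤ B * Real.sqrt (Fintype.card K) := by
  obtain ⟨η, f, hη, hf0, hf, hnd⟩ := exists_common_generator χ hχ
  obtain ⟨B, hB0, hB⟩ := exists_norm_sum_extension_le_aux (∏ j, g j ^ f j)
    (Finset.prod_ne_zero_iff.2 fun j _ => pow_ne_zero _ (hirr j).ne_zero) η hη ψ (by
      intro K _ _ x₀ t ht htd u v hu hv c hc
      obtain ⟨j, hj⟩ := hnd t ht htd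
      exact prod_pow_artinSchreier_ne g hirr hcop f x₀ t j hj u v hu hv c hc)
  refine ⟨B, hB0, fun K _ _ _ => ?_⟩
  convert hB K using 5 with x
  rw [map_prod, map_prod, map_prod]
  refine Finset.prod_congr rfl fun j _ => ?_
  rw [hf j, MulChar.pow_apply' _ (hf0 j), map_pow, map_pow, map_pow]

namespace Polynomial

variable {F : Type*} [Field F]

theorem finite_monic_natDegree_eq (F : Type*) [Field F] [Finite F] (n : ℕ) :
    {P : F[X] | P.Monic ∧ P.natDegree = n}.Finite := by
  have e := (monicEquivDegreeLT (R := F) n).trans (degreeLTEquiv F n).toEquiv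
  exact Set.finite_coe_iff.1 (Finite.of_equiv _ e.symm)

/-- The finite set of monic polynomials of degree `n` over a finite field. -/
noncomputable def monicsOfNatDegree (F : Type*) [Field F] [Finite F] (n : ℕ) : Finset F[X] :=
  (finite_monic_natDegree_eq F n).toFinset

@[simp]
theorem mem_monicsOfNatDegree [Finite F] {n : ℕ} {P : F[X]} :
    P ∈ monicsOfNatDegree F n ↔ P.Monic ∧ P.natDegree = n := by
  simp [monicsOfNatDegree]

open scoped Classical in
/-- Over a finite extension of degree `m`, a monic irreducible `Q` is the minimal polynomial of
`deg Q` elements if `deg Q ∣ m` and of none otherwise. -/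
theorem card_filter_minpoly_eq [Finite F] {K : Type*} [Field K] [Fintype K]
    [Algebra F K] {Q : F[X]} (hQ : Irreducible Q) (hm : Q.Monic) :
    (univ.filter fun x : K => minpoly F x = Q).card =
      if Q.natDegree ∣ Module.finrank F K then Q.natDegree else 0 := by
  have : Module.Finite F K := Module.Finite.of_finite
  have hiff : ∀ x : K, minpoly F x = Q ↔ aeval x Q = 0 := fun x =>
    ⟨fun h => h ▸ minpoly.aeval F x, fun h => (minpoly.eq_of_irreducible_of_monic hQ h hm).symm⟩
  split_ifs with hd
  · have h1 := (hQ.natDegree_dvd_iff_dvd_X_pow_card_pow_sub_X).1 hd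
    rw [← Module.natCard_eq_pow_finrank (K := F) (V := K), Nat.card_eq_fintype_card] at h1
    have h2 : Q.map (algebraMap F K) ∣ X ^ Fintype.card K - X := by
      have := map_dvd (algebraMap F K) h1
      simpa using this
    have hne : (X ^ Fintype.card K - X : K[X]) ≠ 0 :=
      FiniteField.X_pow_card_sub_X_ne_zero K Fintype.one_lt_card
    have hs : (X ^ Fintype.card K - X : K[X]).Splits := by
      rw [splits_iff_card_roots, FiniteField.roots_X_pow_card_sub_X,
        FiniteField.X_pow_card_sub_X_natDegree_eq K Fintype.one_lt_card]
      rfl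
    have hQs := hs.of_dvd hne h2
    have hnd : (Q.map (algebraMap F K)).roots.Nodup := by
      refine Multiset.nodup_of_le (roots.le_of_dvd hne h2) ?_
      rw [FiniteField.roots_X_pow_card_sub_X]
      exact Finset.nodup _
    rw [← natDegree_map (algebraMap F K), hQs.natDegree_eq_card_roots,
      ← Multiset.toFinset_card_of_nodup hnd]
    congr 1
    ext x
    have h0 : Q.map (algebraMap F K) ≠ 0 := (hm.map _).ne_zero
    simp [hiff, h0, IsRoot, eval_map_algebraMap]
  · rw [Finset.card_eq_zero, Finset.filter_eq_empty_iff]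
    intro x _ hx
    exact hd (hx ▸ minpoly.degree_dvd (Algebra.IsIntegral.isIntegral x))

open scoped Classical in
theorem sum_count_normalizedFactors_mul_natDegree {f : F[X]} (hf : f.Monic) :
    ∑ Q ∈ (UniqueFactorizationMonoid.normalizedFactors f).toFinset,
      (UniqueFactorizationMonoid.normalizedFactors f).count Q * Q.natDegree = f.natDegree := by
  conv_rhs => rw [← hf.normalize_eq_self, ← UniqueFactorizationMonoid.prod_normalizedFactors_eq
    hf.ne_zero, natDegree_multiset_prod _ (UniqueFactorizationMonoid.zero_notMem_normalizedFactors _),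
    Finset.sum_multiset_map_count]
  simp

open scoped Classical in
/-- Counting the elements `x` of the extensions of degree `1, …, n` whose characteristic polynomial
divides the monic polynomial `f` of degree `n`: there are `n` of them. -/
theorem sum_card_filter_minpoly_pow_dvd [Finite F] (K : ℕ → Type*)
    [∀ m, Field (K m)] [∀ m, Fintype (K m)] [∀ m, Algebra F (K m)]
    (hK : ∀ m, m ≠ 0 → Module.finrank F (K m) = m) {f : F[X]} (hf : f.Monic) :
    ∑ m ∈ Icc 1 f.natDegree, (univ.filter fun x : K m =>
      minpoly F x ^ (m / (minpoly F x).natDegree) ∣ f).card = f.natDegree := by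
  have hf0 := hf.ne_zero
  have : ∀ m, Module.Finite F (K m) := fun m => Module.Finite.of_finite
  set T := UniqueFactorizationMonoid.normalizedFactors f with hT
  have hTirr : ∀ Q ∈ T, Irreducible Q := fun Q hQ =>
    UniqueFactorizationMonoid.irreducible_of_normalized_factor Q hQ
  have hTmon : ∀ Q ∈ T, Q.Monic := fun Q hQ => by
    rw [← normalize_eq_self_iff_monic (hTirr Q hQ).ne_zero]
    exact UniqueFactorizationMonoid.normalize_normalized_factor Q hQ
  have hpow : ∀ Q ∈ T, ∀ k, Q ^ k ∣ f ↔ k ≤ T.count Q := by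
    intro Q hQ k
    rw [UniqueFactorizationMonoid.dvd_iff_normalizedFactors_le_normalizedFactors
      (pow_ne_zero _ (hTirr Q hQ).ne_zero) hf0, UniqueFactorizationMonoid.normalizedFactors_pow,
      UniqueFactorizationMonoid.normalizedFactors_irreducible (hTirr Q hQ),
      (hTmon Q hQ).normalize_eq_self, Multiset.nsmul_singleton, Multiset.le_count_iff_replicate_le]
  have hdeg : ∀ m, 1 ≤ m → ∀ x : K m, (minpoly F x).natDegree ∣ m := fun m hm x => by
    conv_rhs => rw [← hK m (by omega)]
    exact minpoly.degree_dvd (Algebra.IsIntegral.isIntegral x)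
  have hcm : ∀ m ∈ Icc 1 f.natDegree, (univ.filter fun x : K m =>
      minpoly F x ^ (m / (minpoly F x).natDegree) ∣ f).card =
      ∑ Q ∈ T.toFinset, if Q.natDegree ∣ m ∧ Q ^ (m / Q.natDegree) ∣ f then Q.natDegree else 0 := by
    intro m hm
    rw [mem_Icc] at hm
    rw [Finset.card_eq_sum_card_fiberwise (f := fun x : K m => minpoly F x) (t := T.toFinset)]
    · refine Finset.sum_congr rfl fun Q hQ => ?_
      rw [Multiset.mem_toFinset] at hQ
      rw [Finset.filter_filter]
      have h1 := card_filter_minpoly_eq (K := K m) (hTirr Q hQ) (hTmon Q hQ)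
      rw [hK m (by omega)] at h1
      by_cases hd : Q ^ (m / Q.natDegree) ∣ f
      · simp only [hd, and_true]
        rw [← h1]
        congr 1
        refine Finset.filter_congr fun x _ => ?_
        exact ⟨fun h => h.2, fun h => ⟨by rw [h]; exact hd, h⟩⟩
      · simp only [hd, and_false, if_false, Finset.card_eq_zero]
        rw [Finset.filter_eq_empty_iff]
        rintro x _ ⟨h2, rfl⟩
        exact hd h2
    · intro x hx
      simp only [coe_filter, mem_univ, true_and, Set.mem_ofPred_eq] at hx
      rw [Finset.mem_coe, Multiset.mem_toFinset]
      have hirr := minpoly.irreducible (Algebra.IsIntegral.isIntegral (R := F) x)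
      have hmon := minpoly.monic (Algebra.IsIntegral.isIntegral (R := F) x)
      have hpos : m / (minpoly F x).natDegree ≠ 0 :=
        (Nat.div_pos (Nat.le_of_dvd (by omega) (hdeg m hm.1 x)) hirr.natDegree_pos).ne'
      have h3 := (dvd_pow_self _ hpos).trans hx
      obtain ⟨Q, hQ, hass⟩ := UniqueFactorizationMonoid.exists_mem_normalizedFactors_of_dvd
        hf0 hirr h3
      have h4 := eq_of_monic_of_associated hmon (hTmon Q hQ) hass
      rw [← h4] at hQ
      exact hQ
  rw [Finset.sum_congr rfl hcm, Finset.sum_comm]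
  conv_rhs => rw [← sum_count_normalizedFactors_mul_natDegree hf, ← hT]
  refine Finset.sum_congr rfl fun Q hQ => ?_
  have hQT := Multiset.mem_toFinset.1 hQ
  have hQpos := (hTirr Q hQT).natDegree_pos
  rw [← Finset.sum_filter, Finset.sum_const, smul_eq_mul]
  congr 1
  have himg : ((Icc 1 f.natDegree).filter fun m => Q.natDegree ∣ m ∧ Q ^ (m / Q.natDegree) ∣ f) =
      (Icc 1 (T.count Q)).image (· * Q.natDegree) := by
    ext m
    simp only [mem_filter, mem_Icc, mem_image]
    constructor
    · rintro ⟨⟨h1, -⟩, ⟨k, rfl⟩, h3⟩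
      rw [Nat.mul_div_cancel_left _ hQpos, hpow Q hQT] at h3
      exact ⟨k, ⟨Nat.pos_of_ne_zero (by rintro rfl; omega), h3⟩, Nat.mul_comm _ _⟩
    · rintro ⟨k, ⟨h1, h2⟩, rfl⟩
      have h3 := (hpow Q hQT k).2 h2
      have h4 := natDegree_le_of_dvd h3 hf0
      rw [natDegree_pow] at h4
      refine ⟨⟨Nat.mul_pos h1 hQpos, h4⟩, Dvd.intro_left _ rfl, ?_⟩
      rwa [Nat.mul_div_cancel _ hQpos]
  rw [himg, Finset.card_image_of_injective _ (fun a b hab => Nat.eq_of_mul_eq_mul_right hQpos hab),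
    Nat.card_Icc, Nat.add_sub_cancel]

end Polynomial

namespace Polynomial

variable {F : Type*} [Field F]

/-- The `n`-th coefficient of the `L`-function of a multiplicative function on monic
polynomials. -/
noncomputable def lCoeff [Finite F] (Λ : F[X] → ℂ) (n : ℕ) : ℂ :=
  ∑ P ∈ monicsOfNatDegree F n, Λ P

theorem lCoeff_zero [Finite F] {Λ : F[X] → ℂ} (h1 : Λ 1 = 1) : lCoeff Λ 0 = 1 := by
  have : monicsOfNatDegree F 0 = {1} := by
    ext P
    rw [mem_monicsOfNatDegree, mem_singleton]
    exact ⟨fun h => h.1.natDegree_eq_zero.1 h.2, by rintro rfl; simp⟩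
  rw [lCoeff, this, sum_singleton, h1]

theorem sum_filter_dvd_monicsOfNatDegree [Finite F] {Λ : F[X] → ℂ}
    [∀ P Q : F[X], Decidable (P ∣ Q)]
    (hmul : ∀ P Q : F[X], P.Monic → Q.Monic → Λ (P * Q) = Λ P * Λ Q) {P : F[X]} (hP : P.Monic)
    {n : ℕ} (hn : P.natDegree ≤ n) :
    ∑ f ∈ (monicsOfNatDegree F n).filter (P ∣ ·), Λ f = Λ P * lCoeff Λ (n - P.natDegree) := by
  rw [lCoeff, Finset.mul_sum]
  symm
  refine Finset.sum_bij (fun h _ => P * h) ?_ ?_ ?_ ?_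
  · intro h hh
    rw [mem_monicsOfNatDegree] at hh
    rw [mem_filter, mem_monicsOfNatDegree, hP.natDegree_mul hh.1]
    exact ⟨⟨hP.mul hh.1, by omega⟩, dvd_mul_right _ _⟩
  · intro a _ b _ hab
    exact mul_left_cancel₀ hP.ne_zero hab
  · intro f hf
    rw [mem_filter, mem_monicsOfNatDegree] at hf
    obtain ⟨⟨hf1, hf2⟩, h, rfl⟩ := hf
    have hh := hP.of_mul_monic_left hf1
    refine ⟨h, ?_, rfl⟩
    rw [mem_monicsOfNatDegree]
    rw [hP.natDegree_mul hh] at hf2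
    exact ⟨hh, by omega⟩
  · intro h hh
    rw [mem_monicsOfNatDegree] at hh
    rw [hmul P h hP hh.1]

/-- The coefficientwise form of `T L'(T) / L(T) = ∑ S_m T ^ m`. -/
theorem natCast_mul_lCoeff [Finite F] (K : ℕ → Type*)
    [∀ m, Field (K m)] [∀ m, Fintype (K m)] [∀ m, Algebra F (K m)]
    (hK : ∀ m, m ≠ 0 → Module.finrank F (K m) = m) {Λ : F[X] → ℂ}
    (hmul : ∀ P Q : F[X], P.Monic → Q.Monic → Λ (P * Q) = Λ P * Λ Q) (n : ℕ) :
    n * lCoeff Λ n = ∑ m ∈ Icc 1 n,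
      (∑ x : K m, Λ (minpoly F x ^ (m / (minpoly F x).natDegree))) * lCoeff Λ (n - m) := by
  classical
  have : ∀ m, Module.Finite F (K m) := fun m => Module.Finite.of_finite
  have h1 : ∀ f ∈ monicsOfNatDegree F n, (n : ℂ) * Λ f = ∑ m ∈ Icc 1 n, ∑ x : K m,
      if minpoly F x ^ (m / (minpoly F x).natDegree) ∣ f then Λ f else 0 := by
    intro f hf
    rw [mem_monicsOfNatDegree] at hf
    have h2 := sum_card_filter_minpoly_pow_dvd K hK hf.1
    rw [hf.2] at h2
    conv_lhs => rw [← h2]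
    push_cast
    rw [Finset.sum_mul]
    refine Finset.sum_congr rfl fun m _ => ?_
    rw [← Finset.sum_filter, Finset.sum_const, nsmul_eq_mul]
  rw [lCoeff, Finset.mul_sum, Finset.sum_congr rfl h1, Finset.sum_comm]
  refine Finset.sum_congr rfl fun m hm => ?_
  rw [mem_Icc] at hm
  rw [Finset.sum_comm, Finset.sum_mul]
  refine Finset.sum_congr rfl fun x _ => ?_
  have hy_int := Algebra.IsIntegral.isIntegral (R := F) x
  have hmon := (minpoly.monic hy_int).pow (m / (minpoly F x).natDegree)
  have hd : (minpoly F x).natDegree ∣ m := by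
    conv_rhs => rw [← hK m (by omega)]
    exact minpoly.degree_dvd hy_int
  have hdeg : (minpoly F x ^ (m / (minpoly F x).natDegree)).natDegree = m := by
    rw [natDegree_pow, Nat.div_mul_cancel hd]
  rw [← Finset.sum_filter, sum_filter_dvd_monicsOfNatDegree hmul hmon (by rw [hdeg]; exact hm.2),
    hdeg]

theorem lCoeff_eq_zero_of_injOn [Finite F] {Λ : F[X] → ℂ} {n : ℕ} (φ : F[X] → F[X]) (c : ℂ)
    (hc : c ≠ 1) (hmaps : ∀ P ∈ monicsOfNatDegree F n, φ P ∈ monicsOfNatDegree F n)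
    (hinj : Set.InjOn φ (monicsOfNatDegree F n))
    (hφ : ∀ P ∈ monicsOfNatDegree F n, Λ (φ P) = c * Λ P) : lCoeff Λ n = 0 := by
  have h1 : lCoeff Λ n = ∑ P ∈ monicsOfNatDegree F n, Λ (φ P) := by
    symm
    refine Finset.sum_bij (fun P _ => φ P) hmaps (fun a ha b hb h => hinj ha hb h) ?_ (fun _ _ => rfl)
    intro Q hQ
    obtain ⟨P, hP, h⟩ := Finset.surj_on_of_inj_on_of_card_le (fun P _ => φ P) hmaps
      (fun a b ha hb h => hinj ha hb h) le_rfl Q hQ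
    exact ⟨P, hP, h.symm⟩
  rw [Finset.sum_congr rfl hφ, ← Finset.mul_sum, ← lCoeff] at h1
  have h2 : (c - 1) * lCoeff Λ n = 0 := by linear_combination -h1
  exact (mul_eq_zero.1 h2).resolve_left (sub_ne_zero.2 hc)

/-- The product of multiplicative characters of residues of `P` modulo the `g j` and an additive
character of the trace of `P`, normalised so that its value at a characteristic polynomial is a
character of the corresponding element. -/
noncomputable def mixedChar {ι : Type*} [Fintype ι] (g : ι → F[X]) (χ : ι → MulChar F ℂ)
    (ψ : AddChar F ℂ) (P : F[X]) : ℂ :=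
  (∏ j, χ j ((-1) ^ (P.natDegree * (g j).natDegree) *
    Algebra.norm F (AdjoinRoot.mk (g j) P))) * ψ (-P.nextCoeff)

variable {ι : Type*} [Fintype ι] (g : ι → F[X]) (χ : ι → MulChar F ℂ) (ψ : AddChar F ℂ)

theorem mixedChar_one : mixedChar g χ ψ 1 = 1 := by
  have : nextCoeff (1 : F[X]) = 0 := by rw [← C_1]; exact nextCoeff_C_eq_zero 1
  simp [mixedChar, this]

theorem mixedChar_mul (P Q : F[X]) (hP : P.Monic) (hQ : Q.Monic) :
    mixedChar g χ ψ (P * Q) = mixedChar g χ ψ P * mixedChar g χ ψ Q := by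
  rw [mixedChar, mixedChar, mixedChar, hP.natDegree_mul hQ, hP.nextCoeff_mul hQ, neg_add,
    AddChar.map_add_eq_mul, mul_mul_mul_comm, ← Finset.prod_mul_distrib]
  congr 1
  refine Finset.prod_congr rfl fun j _ => ?_
  rw [← map_mul (χ j), map_mul (AdjoinRoot.mk (g j)), map_mul (Algebra.norm F), add_mul, pow_add]
  congr 1; ring

theorem mixedChar_pow {P : F[X]} (hP : P.Monic) (k : ℕ) :
    mixedChar g χ ψ (P ^ k) = mixedChar g χ ψ P ^ k := by
  induction k with
  | zero => simp [mixedChar_one]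
  | succ k ih => rw [pow_succ, mixedChar_mul _ _ _ _ _ (hP.pow k) hP, ih, pow_succ]

/-- The additive part makes the high coefficients of the `L`-function vanish. -/
theorem lCoeff_mixedChar_eq_zero_of_addChar [Finite F] (hg : ∀ j, (g j).Monic)
    (hψ : ψ ≠ 1) {n : ℕ} (hn : ∑ j, (g j).natDegree < n) :
    lCoeff (mixedChar g χ ψ) n = 0 := by
  obtain ⟨c, hc⟩ := (AddChar.ne_one_iff).1 hψ
  set G := ∏ j, g j with hG
  have hGm : G.Monic := monic_prod_of_monic _ _ fun j _ => hg j
  have hGd : G.natDegree = ∑ j, (g j).natDegree := natDegree_prod_of_monic _ _ fun j _ => hg j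
  set A : F[X] := C (-c) * (X ^ (n - 1 - G.natDegree) * G) with hA
  have hAd : A.natDegree ≤ n - 1 := by
    rw [hA]
    refine (natDegree_C_mul_le _ _).trans ?_
    rw [(monic_X_pow _).natDegree_mul hGm, natDegree_X_pow]; omega
  have hAc : A.coeff (n - 1) = -c := by
    have h1 : (X ^ (n - 1 - G.natDegree) * G).Monic := (monic_X_pow _).mul hGm
    have h2 : (X ^ (n - 1 - G.natDegree) * G).natDegree = n - 1 := by
      rw [(monic_X_pow _).natDegree_mul hGm, natDegree_X_pow]; omega
    rw [hA, coeff_C_mul]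
    have h3 := h1.coeff_natDegree
    rw [h2] at h3
    rw [h3, mul_one]
  have hAlt : ∀ P : F[X], P.Monic → P.natDegree = n → A.degree < P.degree := by
    intro P hP hPn
    rw [degree_eq_natDegree hP.ne_zero, hPn]
    exact (degree_le_of_natDegree_le hAd).trans_lt (by exact_mod_cast (by omega))
  refine lCoeff_eq_zero_of_injOn (fun P => P + A) (ψ c) hc ?_ ?_ ?_
  · intro P hP
    rw [mem_monicsOfNatDegree] at hP ⊢
    exact ⟨hP.1.add_of_left (hAlt P hP.1 hP.2),
      (natDegree_add_eq_left_of_degree_lt (hAlt P hP.1 hP.2)).trans hP.2⟩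
  · intro P _ Q _ h
    exact add_right_cancel h
  · intro P hP
    rw [mem_monicsOfNatDegree] at hP
    have hd : (P + A).natDegree = P.natDegree :=
      natDegree_add_eq_left_of_degree_lt (hAlt P hP.1 hP.2)
    have hnc : (P + A).nextCoeff = P.nextCoeff - c := by
      rw [nextCoeff_of_natDegree_pos (by omega), nextCoeff_of_natDegree_pos (by omega), hd,
        coeff_add, hP.2, hAc]; ring
    rw [mixedChar, mixedChar, hd, hnc, neg_sub, sub_eq_add_neg, AddChar.map_add_eq_mul]
    have : ∀ j, AdjoinRoot.mk (g j) (P + A) = AdjoinRoot.mk (g j) P := by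
      intro j
      rw [AdjoinRoot.mk_eq_mk, add_sub_cancel_left]
      exact ((Finset.dvd_prod_of_mem g (mem_univ j)).mul_left _).mul_left _
    simp_rw [this]
    ring

/-- The multiplicative part makes the high coefficients of the `L`-function vanish if the
additive part is trivial. -/
theorem lCoeff_mixedChar_one_eq_zero [Finite F] [Nonempty ι] (hg : ∀ j, (g j).Monic)
    (hirr : ∀ j, Irreducible (g j)) (hcop : ∀ i j, i ≠ j → IsCoprime (g i) (g j))
    (hχ : ∀ j, χ j ≠ 1) {n : ℕ} (hn : ∑ j, (g j).natDegree ≤ n) :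
    lCoeff (mixedChar g χ 1) n = 0 := by
  classical
  set G := ∏ j, g j with hG
  have hGm : G.Monic := monic_prod_of_monic _ _ fun j _ => hg j
  have hGd : G.natDegree = ∑ j, (g j).natDegree := natDegree_prod_of_monic _ _ fun j _ => hg j
  obtain ⟨i⟩ := ‹Nonempty ι›
  obtain ⟨y, hy⟩ := MulChar.ne_one_iff.1 (hχ i)
  have hfact : ∀ j, Fact (Irreducible (g j)) := fun j => ⟨hirr j⟩
  have hfin : ∀ j, Module.Finite F (AdjoinRoot (g j)) := fun j => (hg j).finite_adjoinRoot
  have hfinite : ∀ j, Finite (AdjoinRoot (g j)) := fun j => Module.finite_of_finite F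
  obtain ⟨w, hw⟩ := FiniteField.norm_surjective F (AdjoinRoot (g i)) (y : F)
  obtain ⟨w, rfl⟩ := AdjoinRoot.mk_surjective w
  have hw0 : ¬ g i ∣ w := by
    intro h
    rw [AdjoinRoot.mk_eq_zero.2 h, Algebra.norm_zero] at hw
    exact y.ne_zero hw.symm
  -- the Chinese remainder theorem
  have hcopi : IsCoprime (g i) (∏ j ∈ univ.erase i, g j) :=
    IsCoprime.prod_right fun j hj => hcop i j (ne_of_mem_erase hj).symm
  obtain ⟨a, b, hab⟩ := hcopi
  set u : F[X] := w * (b * ∏ j ∈ univ.erase i, g j) + a * g i with hu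
  have hui : g i ∣ u - w := by
    refine ⟨a - w * a, ?_⟩
    rw [hu]
    linear_combination w * hab
  have huj : ∀ j, j ≠ i → g j ∣ u - 1 := by
    intro j hj
    have h1 : u - 1 = (w - 1) * b * ∏ j ∈ univ.erase i, g j := by
      rw [hu]; linear_combination hab
    rw [h1]
    exact (Finset.dvd_prod_of_mem g (mem_erase.2 ⟨hj, mem_univ j⟩)).mul_left _
  have hu0 : ∀ j, ¬ g j ∣ u := by
    intro j h
    by_cases hj : j = i
    · subst hj
      exact hw0 (by have := dvd_sub h hui; rwa [sub_sub_cancel] at this)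
    · have h1 : g j ∣ 1 := by
        have := dvd_sub h (huj j hj)
        rwa [sub_sub_cancel] at this
      exact (hirr j).not_isUnit (isUnit_of_dvd_one h1)
  have hucop : IsCoprime G u :=
    IsCoprime.prod_left fun j _ => ((hirr j).coprime_iff_not_dvd).2 (hu0 j)
  have hmodlt : ∀ P Q : F[X], Q.Monic → Q.natDegree = n → (P %ₘ G).degree < Q.degree := by
    intro P Q hQ hQn
    refine (degree_modByMonic_lt P hGm).trans_le ?_
    rw [degree_eq_natDegree hQ.ne_zero, degree_eq_natDegree hGm.ne_zero, hQn, hGd]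
    exact_mod_cast hn
  have hlow : ∀ P : F[X], P.Monic → P.natDegree = n →
      ((u * P) %ₘ G - P %ₘ G).degree < P.degree := fun P hP hPn =>
    (degree_sub_le _ _).trans_lt (max_lt (hmodlt _ P hP hPn) (hmodlt _ P hP hPn))
  have hdvd : ∀ P : F[X], G ∣ (P + ((u * P) %ₘ G - P %ₘ G)) - u * P := by
    intro P
    refine ⟨P /ₘ G - (u * P) /ₘ G, ?_⟩
    have h1 := modByMonic_add_div P G
    have h2 := modByMonic_add_div (u * P) G
    linear_combination -h1 + h2
  refine lCoeff_eq_zero_of_injOn (fun P => P + ((u * P) %ₘ G - P %ₘ G)) (χ i y) hy ?_ ?_ ?_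
  · intro P hP
    rw [mem_monicsOfNatDegree] at hP ⊢
    exact ⟨hP.1.add_of_left (hlow P hP.1 hP.2),
      (natDegree_add_eq_left_of_degree_lt (hlow P hP.1 hP.2)).trans hP.2⟩
  · intro P _ Q _ h
    simp only at h
    have h1 : G ∣ u * (P - Q) := by
      have := dvd_sub (hdvd Q) (hdvd P)
      rw [h] at this
      convert this using 1; ring
    have h2 : G ∣ P - Q := hucop.dvd_of_dvd_mul_left h1
    have h3 : P %ₘ G = Q %ₘ G := (modByMonic_eq_of_dvd_sub hGm h2)
    have h4 : (u * P) %ₘ G = (u * Q) %ₘ G :=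
      modByMonic_eq_of_dvd_sub hGm (by rw [← mul_sub]; exact h1)
    rw [h3, h4] at h
    exact add_right_cancel h
  · intro P hP
    rw [mem_monicsOfNatDegree] at hP
    have hd : (P + ((u * P) %ₘ G - P %ₘ G)).natDegree = P.natDegree :=
      natDegree_add_eq_left_of_degree_lt (hlow P hP.1 hP.2)
    rw [mixedChar, mixedChar, hd, AddChar.one_apply, AddChar.one_apply, mul_one, mul_one]
    have h1 : ∀ j, AdjoinRoot.mk (g j) (P + ((u * P) %ₘ G - P %ₘ G)) =
        AdjoinRoot.mk (g j) u * AdjoinRoot.mk (g j) P := by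
      intro j
      rw [← map_mul, AdjoinRoot.mk_eq_mk]
      exact (Finset.dvd_prod_of_mem g (mem_univ j)).trans (hdvd P)
    have h2 : χ i y = ∏ j, χ j (Algebra.norm F (AdjoinRoot.mk (g j) u)) := by
      rw [Finset.prod_eq_single i]
      · rw [← hw, AdjoinRoot.mk_eq_mk.2 hui]
      · intro j _ hj
        rw [AdjoinRoot.mk_eq_mk.2 (huj j hj)]; simp
      · simp
    rw [h2, ← Finset.prod_mul_distrib]
    refine Finset.prod_congr rfl fun j _ => ?_
    rw [h1, ← map_mul (χ j), map_mul (Algebra.norm F)]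
    congr 1; ring

end Polynomial

namespace Polynomial

variable {F : Type*} [Field F]

theorem norm_adjoinRoot_mk_eq_resultant [PerfectField F] {f : F[X]} (hf : f.Monic)
    (hirr : Irreducible f) (P : F[X]) :
    Algebra.norm F (AdjoinRoot.mk f P) = resultant f P := by
  classical
  have : Fact (Irreducible f) := ⟨hirr⟩
  let E := AlgebraicClosure F
  have : Module.Finite F (AdjoinRoot f) := hf.finite_adjoinRoot
  have hsep : Algebra.IsSeparable F (AdjoinRoot f) := inferInstance
  apply (algebraMap F E).injective
  rw [Algebra.norm_eq_prod_embeddings F E, ← resultant_map_map]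
  have h1 : (f.map (algebraMap F E)).natDegree = f.natDegree := natDegree_map _
  have h2 := resultant_eq_prod_eval (f.map (algebraMap F E)) (P.map (algebraMap F E)) P.natDegree
    natDegree_map_le (IsAlgClosed.splits _)
  rw [h1, (hf.map _).leadingCoeff, one_pow, one_mul] at h2
  have hnd : (f.aroots E).Nodup := nodup_roots (Separable.map (PerfectField.separable_of_irreducible hirr))
  rw [h2]
  change _ = ((f.aroots E).map _).prod
  rw [← hnd.dedup, ← Multiset.toFinset_val]
  change _ = ∏ x ∈ (f.aroots E).toFinset, _
  have hev : ∀ σ : AdjoinRoot f →ₐ[F] E, σ (AdjoinRoot.mk f P) =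
      (P.map (algebraMap F E)).eval (σ (AdjoinRoot.root f)) := fun σ => by
    rw [← AdjoinRoot.aeval_eq, ← aeval_algHom_apply, eval_map_algebraMap]
  refine Finset.prod_bij (fun σ _ => σ (AdjoinRoot.root f)) ?_ ?_ ?_ ?_
  · intro σ _
    rw [Multiset.mem_toFinset, mem_aroots, aeval_algHom_apply, AdjoinRoot.aeval_eq,
      AdjoinRoot.mk_self, map_zero]
    exact ⟨hf.ne_zero, rfl⟩
  · intro σ _ τ _ h
    exact AdjoinRoot.algHom_ext h
  · intro x hx
    rw [Multiset.mem_toFinset, mem_aroots] at hx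
    refine ⟨AdjoinRoot.liftAlgHom f (Algebra.ofId F E) x ?_, Finset.mem_univ _, ?_⟩
    · exact hx.2
    · exact AdjoinRoot.liftAlgHom_root ..
  · intro σ _
    exact hev σ

theorem norm_aeval_eq_resultant_pow [PerfectField F] {K : Type*} [Field K] [Algebra F K]
    [FiniteDimensional F K] (x : K) (g : F[X]) :
    Algebra.norm F (aeval x g) =
      resultant (minpoly F x) g ^ (Module.finrank F K / (minpoly F x).natDegree) := by
  have hx : IsIntegral F x := .of_finite F x
  let L := IntermediateField.adjoin F {x}
  let y : L := IntermediateField.AdjoinSimple.gen F x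
  have h1 : aeval x g = algebraMap L K (aeval y g) := by
    rw [← aeval_algebraMap_apply]; rfl
  have h2 : aeval y g = IntermediateField.adjoinRootEquivAdjoin F hx
      (AdjoinRoot.mk (minpoly F x) g) := by
    rw [← AdjoinRoot.aeval_eq, ← AlgEquiv.coe_toAlgHom, ← aeval_algHom_apply]
    congr 2
    exact (IntermediateField.adjoinRootEquivAdjoin_apply_root F hx).symm
  have h3 : Module.finrank F K / (minpoly F x).natDegree = Module.finrank L K := by
    rw [← Module.finrank_mul_finrank F L K, IntermediateField.adjoin.finrank hx,
      Nat.mul_div_cancel_left _ (minpoly.natDegree_pos hx)]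
  rw [h1, ← Algebra.norm_norm (S := L), Algebra.norm_algebraMap, map_pow, h3, h2,
    ← norm_adjoinRoot_mk_eq_resultant (minpoly.monic hx) (minpoly.irreducible hx)]
  congr 1
  exact (Algebra.norm_eq_of_algEquiv _ _)

variable {ι : Type*} [Fintype ι] (g : ι → F[X]) (χ : ι → MulChar F ℂ) (ψ : AddChar F ℂ)

theorem mixedChar_minpoly_pow [PerfectField F] (hg : ∀ j, (g j).Monic)
    (hirr : ∀ j, Irreducible (g j)) {K : Type*} [Field K] [Algebra F K]
    [FiniteDimensional F K] (x : K) :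
    mixedChar g χ ψ (minpoly F x ^ (Module.finrank F K / (minpoly F x).natDegree)) =
      (∏ j, χ j (Algebra.norm F (aeval x (g j)))) * ψ (Algebra.trace F K x) := by
  have hx : IsIntegral F x := .of_finite F x
  have h3 : Module.finrank F K / (minpoly F x).natDegree =
      Module.finrank (IntermediateField.adjoin F {x}) K := by
    rw [← Module.finrank_mul_finrank F (IntermediateField.adjoin F {x}) K,
      IntermediateField.adjoin.finrank hx, Nat.mul_div_cancel_left _ (minpoly.natDegree_pos hx)]
  rw [mixedChar_pow _ _ _ (minpoly.monic hx), mixedChar, mul_pow, ← Finset.prod_pow,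
    ← AddChar.map_nsmul_eq_pow, trace_eq_finrank_mul_minpoly_nextCoeff, ← h3, nsmul_eq_mul]
  congr 1
  refine Finset.prod_congr rfl fun j _ => ?_
  rw [norm_aeval_eq_resultant_pow, ← map_pow, resultant_comm,
    norm_adjoinRoot_mk_eq_resultant (hg j) (hirr j)]

end Polynomial

open Polynomial in
/-- If `T L'(T) = G(T) L(T)` with `G` converging for `|T| < q⁻¹`, then `L` has no zeros there. -/
theorem eval_ne_zero_of_natCast_mul_coeff_eq {L : ℂ[X]} {S : ℕ → ℂ} {B q : ℝ}
    (hq : 0 < q) (hS : ∀ m, ‖S m‖ ≤ B * q ^ m)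
    (hLS : ∀ n : ℕ, n * L.coeff n = ∑ x ∈ antidiagonal n, S x.1 * L.coeff x.2)
    (hL : L.coeff 0 ≠ 0) {z : ℂ} (hz : ‖z‖ < q⁻¹) : L.eval z ≠ 0 := by
  intro hzero
  have hB : 0 ≤ B := by simpa using (norm_nonneg _).trans (hS 0)
  have hL0 : L ≠ 0 := by rintro rfl; simp at hL
  have hz0 : z ≠ 0 := by
    rintro rfl
    rw [← coeff_zero_eq_eval_zero] at hzero
    exact hL hzero
  obtain ⟨ρ, hzρ, hρ⟩ := exists_between hz
  have hρ0 : 0 ≤ ρ := (norm_nonneg z).trans hzρ.le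
  have hρq : q * ρ < 1 := by
    have := mul_lt_mul_of_pos_left hρ hq
    rwa [mul_inv_cancel₀ hq.ne'] at this
  have hgeo : Summable fun m : ℕ => B * (q * ρ) ^ m :=
    (summable_geometric_of_lt_one (by positivity) hρq).mul_left B
  have hbd : ∀ w : ℂ, ‖w‖ ≤ ρ → ∀ m, ‖S m * w ^ m‖ ≤ B * (q * ρ) ^ m := fun w hw m => by
    rw [norm_mul, norm_pow, mul_pow, ← mul_assoc]
    exact mul_le_mul (hS m) (pow_le_pow_left₀ (norm_nonneg _) hw m) (by positivity) (by positivity)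
  set C := ∑' m : ℕ, B * (q * ρ) ^ m
  have key : ∀ w : ℂ, ‖w‖ ≤ ρ → ‖w * L.derivative.eval w‖ ≤ C * ‖L.eval w‖ := by
    intro w hw
    have hs1 : Summable fun m => ‖S m * w ^ m‖ :=
      Summable.of_nonneg_of_le (fun _ => norm_nonneg _) (hbd w hw) hgeo
    have hfin : ∀ n : ℕ, n ∉ Finset.range (L.natDegree + 1) → L.coeff n = 0 := fun n hn =>
      coeff_eq_zero_of_natDegree_lt (by rw [Finset.mem_range] at hn; omega)
    have hs2 : Summable fun m => ‖L.coeff m * w ^ m‖ :=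
      summable_of_ne_finset_zero (s := Finset.range (L.natDegree + 1)) fun n hn => by simp [hfin n hn]
    have h1 : L.eval w = ∑' m, L.coeff m * w ^ m := by
      rw [tsum_eq_sum (s := Finset.range (L.natDegree + 1)) fun n hn => by simp [hfin n hn],
        eval_eq_sum_range]
    have h2 : w * L.derivative.eval w = ∑' n : ℕ, (n * L.coeff n) * w ^ n := by
      rw [tsum_eq_sum (s := Finset.range (L.natDegree + 1)) fun n hn => by simp [hfin n hn],
        derivative_eval, sum_over_range _ (by simp), Finset.mul_sum]
      refine Finset.sum_congr rfl fun n _ => ?_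
      rcases n with _ | n
      · simp
      · push_cast
        ring
    have h3 := tsum_mul_tsum_eq_tsum_sum_antidiagonal_of_summable_norm hs1 hs2
    have h4 : w * L.derivative.eval w = (∑' m, S m * w ^ m) * L.eval w := by
      rw [h1, h3, h2]
      refine tsum_congr fun n => ?_
      rw [hLS, Finset.sum_mul]
      refine Finset.sum_congr rfl fun x hx => ?_
      rw [← HasAntidiagonal.mem_antidiagonal.1 hx, pow_add]
      ring
    rw [h4, norm_mul]
    exact mul_le_mul_of_nonneg_right (tsum_of_norm_bounded hgeo.hasSum (hbd w hw)) (norm_nonneg _)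
  obtain ⟨M, hM, hMz⟩ := exists_eq_pow_rootMultiplicity_mul_and_not_dvd L hL0 z
  have hk : 0 < L.rootMultiplicity z := (rootMultiplicity_pos hL0).2 hzero
  obtain ⟨k, hk'⟩ := Nat.exists_eq_add_of_lt hk
  rw [hk', zero_add] at hM
  rw [dvd_iff_isRoot] at hMz
  have key2 : ∀ᶠ w in nhdsWithin z {z}ᶜ, ‖w * ((k + 1) * M.eval w + (w - z) * M.derivative.eval w)‖
      ≤ C * ‖(w - z) * M.eval w‖ := by
    have hnh : ∀ᶠ w in nhds z, ‖w‖ ≤ ρ :=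
      (continuous_norm.tendsto z).eventually (eventually_le_nhds hzρ)
    filter_upwards [nhdsWithin_le_nhds hnh, self_mem_nhdsWithin] with w hw hwz
    have hwz' : w - z ≠ 0 := sub_ne_zero.2 hwz
    have h := key w hw
    have e1 : L.eval w = (w - z) ^ k * ((w - z) * M.eval w) := by
      rw [hM]; simp; ring
    have e2 : w * L.derivative.eval w =
        (w - z) ^ k * (w * ((k + 1) * M.eval w + (w - z) * M.derivative.eval w)) := by
      rw [hM]; simp [derivative_pow]; ring
    rw [e1, e2, norm_mul, norm_mul ((w - z) ^ k), mul_left_comm] at h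
    exact le_of_mul_le_mul_left h (norm_pos_iff.2 (pow_ne_zero _ hwz'))
  have hl : Tendsto (fun w => ‖w * ((k + 1) * M.eval w + (w - z) * M.derivative.eval w)‖)
      (nhdsWithin z {z}ᶜ) (nhds ‖z * ((k + 1) * M.eval z + (z - z) * M.derivative.eval z)‖) := by
    refine Tendsto.mono_left (Continuous.tendsto ?_ z) nhdsWithin_le_nhds
    fun_prop
  have hr : Tendsto (fun w => C * ‖(w - z) * M.eval w‖)
      (nhdsWithin z {z}ᶜ) (nhds (C * ‖(z - z) * M.eval z‖)) := by
    refine Tendsto.mono_left (Continuous.tendsto ?_ z) nhdsWithin_le_nhds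
    fun_prop
  have := le_of_tendsto_of_tendsto hl hr key2
  simp only [sub_self, zero_mul, add_zero, norm_zero, mul_zero, norm_le_zero_iff] at this
  have hk1 : (k + 1 : ℂ) ≠ 0 := by exact_mod_cast k.succ_ne_zero
  exact mul_ne_zero hz0 (mul_ne_zero hk1 hMz) this

open Polynomial in
theorem norm_coeff_one_le_of_natCast_mul_eq {a S : ℕ → ℂ} {B q : ℝ} {D : ℕ}
    (hq : 0 < q) (h0 : a 0 = 1) (hD : ∀ n, D < n → a n = 0)
    (hS : ∀ m, m ≠ 0 → ‖S m‖ ≤ B * q ^ m) (hB : 0 ≤ B)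
    (h : ∀ n : ℕ, n * a n = ∑ m ∈ Icc 1 n, S m * a (n - m)) :
    ‖a 1‖ ≤ D * q := by
  rcases Nat.eq_zero_or_pos D with rfl | hDpos
  · rw [hD 1 one_pos]; simp
  let L : ℂ[X] := ∑ n ∈ range (D + 1), monomial n (a n)
  have hLc : ∀ n, L.coeff n = a n := fun n => by
    simp only [L, finsetSum_coeff, coeff_monomial, Finset.sum_ite_eq', Finset.mem_range]
    split_ifs with hn
    · rfl
    · rw [hD n (by omega)]
  let P : ℂ[X] := ∑ n ∈ range (D + 1), monomial (D - n) (a n)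
  have hPc : ∀ n, n ≤ D → P.coeff (D - n) = a n := fun n hn => by
    simp only [P, finsetSum_coeff, coeff_monomial]
    rw [Finset.sum_eq_single n]
    · simp
    · intro b hb hbn
      rw [Finset.mem_range] at hb
      rw [if_neg (by omega)]
    · intro hn'
      exact absurd (Finset.mem_range.2 (by omega)) hn'
  have hPdeg : P.natDegree ≤ D := natDegree_sum_le_of_forall_le _ _ fun n _ =>
    (natDegree_monomial_le _).trans (by omega)
  have hPD : P.coeff D = 1 := by simpa [h0] using hPc 0 (by omega)
  have hnat : P.natDegree = D := le_antisymm hPdeg (le_natDegree_of_ne_zero (by simp [hPD]))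
  have hPm : P.Monic := by rw [Monic, leadingCoeff, hnat, hPD]
  have ha1 : a 1 = -P.roots.sum := by
    have h1 := (IsAlgClosed.splits P).nextCoeff_eq_neg_sum_roots_of_monic hPm
    rw [← h1, nextCoeff_of_natDegree_pos (by omega), hnat, hPc 1 hDpos]
  have hroot : ∀ α ∈ P.roots, ‖α‖ ≤ q := by
    intro α hα
    rcases eq_or_ne α 0 with rfl | hα0
    · simpa using hq.le
    by_contra! hlt
    refine eval_ne_zero_of_natCast_mul_coeff_eq (L := L) (S := fun m => if m = 0 then 0 else S m)
      (B := B) hq ?_ ?_ (by simp [hLc, h0]) (z := α⁻¹) ?_ ?_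
    · intro m
      split_ifs with hm
      · simp only [norm_zero]; positivity
      · exact hS m hm
    · intro n
      rw [hLc, h, Finset.Nat.sum_antidiagonal_eq_sum_range_succ
        (fun i j => (if i = 0 then 0 else S i) * L.coeff j)]
      refine Finset.sum_subset_zero_on_sdiff (fun m hm => ?_) (fun m hm => ?_) fun m hm => ?_
      · rw [Finset.mem_Icc] at hm
        exact Finset.mem_range.2 (by omega)
      · rw [Finset.mem_sdiff, Finset.mem_range, Finset.mem_Icc] at hm
        rw [if_pos (by omega), zero_mul]
      · rw [Finset.mem_Icc] at hm
        rw [if_neg (by omega), hLc]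
    · rw [norm_inv]
      exact inv_strictAnti₀ hq hlt
    · have h2 : P.eval α = 0 := (mem_roots hPm.ne_zero).1 hα
      have h3 : P.eval α = α ^ D * L.eval α⁻¹ := by
        simp only [P, L, eval_finsetSum, eval_monomial, Finset.mul_sum]
        refine Finset.sum_congr rfl fun n hn => ?_
        rw [Finset.mem_range] at hn
        rw [pow_sub₀ _ hα0 (by omega), inv_pow]
        ring
      rw [h3] at h2
      exact (mul_eq_zero.1 h2).resolve_left (pow_ne_zero _ hα0)
  rw [ha1, norm_neg]
  calc ‖P.roots.sum‖ ≤ (P.roots.map norm).sum := norm_multiset_sum_le _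
    _ ≤ (P.roots.map norm).card • q := Multiset.sum_le_card_nsmul _ _ fun x hx => by
        obtain ⟨α, hα, rfl⟩ := Multiset.mem_map.1 hx
        exact hroot α hα
    _ = D * q := by
        rw [Multiset.card_map, ← hnat, nsmul_eq_mul, (IsAlgClosed.splits P).natDegree_eq_card_roots]

open Polynomial in
/-- The **Weil bound** for mixed character sums over a prime field. -/
theorem norm_sum_prod_mulChar_mul_addChar_le {p : ℕ} [Fact p.Prime] {ι : Type*} [Fintype ι]
    [Nonempty ι] (g : ι → (ZMod p)[X]) (hg : ∀ j, (g j).Monic) (hirr : ∀ j, Irreducible (g j))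
    (hcop : ∀ i j, i ≠ j → IsCoprime (g i) (g j))
    (χ : ι → MulChar (ZMod p) ℂ) (hχ : ∀ j, χ j ≠ 1) (ψ : AddChar (ZMod p) ℂ) :
    ‖∑ x : ZMod p, (∏ j, χ j ((g j).eval x)) * ψ x‖ ≤
      (∑ j, (g j).natDegree : ℕ) * Real.sqrt p := by
  obtain ⟨B, hB, hbound⟩ := exists_norm_sum_extension_le g hirr hcop χ hχ ψ
  let _ : ∀ m, Fintype (GaloisField p m) := fun m => Fintype.ofFinite _
  have hp0 : 0 < p := (Fact.out : p.Prime).pos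
  have hfin : ∀ m, m ≠ 0 → Module.finrank (ZMod p) (GaloisField p m) = m :=
    fun m hm => GaloisField.finrank p hm
  have hid := natCast_mul_lCoeff (F := ZMod p) (fun m => GaloisField p m) hfin
    (Λ := mixedChar g χ ψ) (mixedChar_mul g χ ψ)
  have hS : ∀ m, m ≠ 0 → ∀ x : GaloisField p m,
      mixedChar g χ ψ (minpoly (ZMod p) x ^ (m / (minpoly (ZMod p) x).natDegree)) =
      (∏ j, χ j (Algebra.norm (ZMod p) (aeval x (g j)))) *
        ψ (Algebra.trace (ZMod p) (GaloisField p m) x) := fun m hm x => by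
    rw [← mixedChar_minpoly_pow g χ ψ hg hirr x, hfin m hm]
  have h1 := norm_coeff_one_le_of_natCast_mul_eq (a := lCoeff (mixedChar g χ ψ))
    (S := fun m => ∑ x : GaloisField p m,
      mixedChar g χ ψ (minpoly (ZMod p) x ^ (m / (minpoly (ZMod p) x).natDegree)))
    (B := B) (q := Real.sqrt p) (D := ∑ j, (g j).natDegree)
    (Real.sqrt_pos.2 (by exact_mod_cast hp0)) (lCoeff_zero (mixedChar_one g χ ψ)) ?_ ?_ hB hid
  · convert h1 using 2
    have h2 := hid 1
    rw [Icc_self, sum_singleton, Nat.sub_self, lCoeff_zero (mixedChar_one g χ ψ), Nat.cast_one,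
      one_mul, mul_one] at h2
    rw [h2]
    refine (Fintype.sum_equiv (GaloisField.equivZmodP p).toEquiv _ _ fun x => ?_).symm
    rw [hS 1 one_ne_zero]
    have h3 : ∀ y : GaloisField p 1, Algebra.norm (ZMod p) y = GaloisField.equivZmodP p y :=
      fun y => by
        rw [← Algebra.norm_eq_of_algEquiv (GaloisField.equivZmodP p) y, Algebra.norm_self]; rfl
    have h4 : ∀ y : GaloisField p 1,
        Algebra.trace (ZMod p) (GaloisField p 1) y = GaloisField.equivZmodP p y :=
      fun y => by
        rw [← Algebra.trace_eq_of_algEquiv (GaloisField.equivZmodP p) y, Algebra.trace_self]; rfl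
    simp only [h3, h4]
    congr 1
    refine Finset.prod_congr rfl fun j _ => ?_
    rw [← AlgEquiv.coe_toAlgHom, ← aeval_algHom_apply, coe_aeval_eq_eval]
    rfl
  · intro n hn
    by_cases hψ : ψ = 1
    · subst hψ
      exact lCoeff_mixedChar_one_eq_zero g χ hg hirr hcop hχ hn.le
    · exact lCoeff_mixedChar_eq_zero_of_addChar g χ ψ hg hψ hn
  · intro m hm
    simp only [hS m hm]
    refine (hbound (GaloisField p m)).trans_eq ?_
    rw [Fintype.card_eq_nat_card, GaloisField.card p m hm]
    congr 1
    rw [Nat.cast_pow, Real.sqrt_eq_iff_mul_self_eq (by positivity) (by positivity), ← mul_pow,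
      Real.mul_self_sqrt (by positivity)]

theorem ZMod.sum_eq_sum_range {p : ℕ} [NeZero p] {M : Type*} [AddCommMonoid M] (F : ZMod p → M) :
    ∑ x, F x = ∑ n ∈ range p, F (n : ZMod p) :=
  Finset.sum_nbij' ZMod.val (fun n => (n : ZMod p))
    (fun x _ => Finset.mem_range.2 (ZMod.val_lt x)) (fun _ _ => Finset.mem_univ _)
    (fun x _ => ZMod.natCast_zmod_val x)
    (fun _ hn => ZMod.val_cast_of_lt (Finset.mem_range.1 hn))
    (fun x _ => by rw [ZMod.natCast_zmod_val])

theorem le_norm_stdAddChar_neg_sub_one {p : ℕ} [NeZero p] {a : ℕ} (hap : a ≤ p) :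
    4 / p * min (a : ℝ) (p - a) ≤ ‖ZMod.stdAddChar (-(a : ZMod p)) - 1‖ := by
  have hp : (0 : ℝ) < p := by exact_mod_cast Nat.pos_of_ne_zero (NeZero.ne p)
  have hap' : (a : ℝ) ≤ p := by exact_mod_cast hap
  have h1 : (ZMod.stdAddChar (-(a : ZMod p)) : ℂ) =
      Complex.exp (Complex.I * ((-(2 * Real.pi * a / p) : ℝ) : ℂ)) := by
    have := ZMod.stdAddChar_coe (N := p) (-(a : ℤ))
    push_cast at this ⊢
    rw [this]
    congr 1
    ring
  rw [h1, Complex.norm_exp_I_mul_ofReal_sub_one, norm_mul, Real.norm_eq_abs, Real.norm_eq_abs,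
    show -(2 * Real.pi * a / p) / 2 = -(Real.pi * a / p) by ring, Real.sin_neg, abs_neg, abs_two]
  have h2 : 2 / p * min (a : ℝ) (p - a) ≤ Real.sin (Real.pi * a / p) := by
    rcases le_total (a : ℝ) (p - a) with h | h
    · rw [min_eq_left h]
      have := Real.mul_le_sin (x := Real.pi * a / p) (by positivity) (by
        rw [div_le_div_iff₀ hp two_pos]
        nlinarith [Real.pi_pos])
      convert this using 1
      field_simp
    · rw [min_eq_right h, ← Real.sin_pi_sub]
      have h3 : Real.pi - Real.pi * a / p = Real.pi * (p - a) / p := by field_simp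
      rw [h3]
      have := Real.mul_le_sin (x := Real.pi * (p - a) / p)
        (div_nonneg (mul_nonneg Real.pi_pos.le (by linarith)) hp.le) (by
          rw [div_le_div_iff₀ hp two_pos]
          nlinarith [Real.pi_pos])
      convert this using 1
      field_simp
  have h4 := le_abs_self (Real.sin (Real.pi * a / p))
  calc 4 / p * min (a : ℝ) (p - a) = 2 * (2 / p * min (a : ℝ) (p - a)) := by ring
    _ ≤ _ := by linarith

theorem norm_sum_range_stdAddChar_le {p : ℕ} [NeZero p] {a : ℕ} (ha : 0 < a) (hap : a < p)
    (M : ℕ) : ‖∑ n ∈ range M, (ZMod.stdAddChar (-((a : ZMod p) * (n : ZMod p))) : ℂ)‖ ≤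
      p / 2 * ((a : ℝ)⁻¹ + ((p - a : ℕ) : ℝ)⁻¹) := by
  have hp : (0 : ℝ) < p := by exact_mod_cast Nat.pos_of_ne_zero (NeZero.ne p)
  have ha' : (0 : ℝ) < a := by exact_mod_cast ha
  have hap' : (0 : ℝ) < p - a := by
    have : (a : ℝ) < p := by exact_mod_cast hap
    linarith
  rw [Nat.cast_sub hap.le]
  have hmin : 0 < min (a : ℝ) (p - a) := lt_min ha' hap'
  have hle := le_norm_stdAddChar_neg_sub_one hap.le
  have hpos : 0 < ‖(ZMod.stdAddChar (-(a : ZMod p)) : ℂ) - 1‖ := lt_of_lt_of_le (by positivity) hle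
  have h1 : ∀ n : ℕ, (ZMod.stdAddChar (-((a : ZMod p) * (n : ZMod p))) : ℂ) =
      (ZMod.stdAddChar (-(a : ZMod p)) : ℂ) ^ n := fun n => by
    rw [← AddChar.map_nsmul_eq_pow, nsmul_eq_mul]
    congr 1
    ring
  simp only [h1]
  rw [geom_sum_eq (fun h => by rw [h] at hpos; simp at hpos), norm_div]
  have h2 : ‖(ZMod.stdAddChar (-(a : ZMod p)) : ℂ) ^ M - 1‖ ≤ 2 := by
    refine (norm_sub_le _ _).trans ?_
    rw [norm_pow, AddChar.norm_apply, one_pow, norm_one]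
    norm_num
  have h3 : (min (a : ℝ) (p - a))⁻¹ ≤ (a : ℝ)⁻¹ + (p - a : ℝ)⁻¹ := by
    rcases min_choice (a : ℝ) (p - a) with h | h <;> rw [h]
    · linarith [inv_pos.2 hap']
    · linarith [inv_pos.2 ha']
  calc _ ≤ 2 / (4 / p * min (a : ℝ) (p - a)) := div_le_div₀ (by norm_num) h2 (by positivity) hle
    _ = p / 2 * (min (a : ℝ) (p - a))⁻¹ := by field_simp; norm_num
    _ ≤ _ := by gcongr

/-- Completing an incomplete sum. -/
theorem norm_sum_range_le_of_forall_addChar {p : ℕ} [Fact p.Prime] (Φ : ZMod p → ℂ) {B : ℝ}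
    (hB : ∀ ψ : AddChar (ZMod p) ℂ, ‖∑ x, Φ x * ψ x‖ ≤ B) {M : ℕ} (hM : M ≤ p) :
    ‖∑ n ∈ range M, Φ n‖ ≤ B * (2 + Real.log p) := by
  have hp : (0 : ℝ) < p := by exact_mod_cast (Fact.out : p.Prime).pos
  have hB0 : 0 ≤ B := (norm_nonneg _).trans (hB 1)
  have h1 : (p : ℂ) * ∑ n ∈ range M, Φ n = ∑ a : ZMod p,
      (∑ n ∈ range M, (ZMod.stdAddChar (-(a * (n : ZMod p))) : ℂ)) *
        ∑ x, Φ x * ZMod.stdAddChar.mulShift a x := by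
    have h2 : ∀ n : ℕ, (p : ℂ) * Φ n =
        ∑ x, Φ x * ∑ a : ZMod p, ZMod.stdAddChar (a * (x - (n : ZMod p))) := fun n => by
      simp only [AddChar.sum_mulShift _ (ZMod.isPrimitive_stdAddChar p), ZMod.card, sub_eq_zero]
      rw [Finset.sum_eq_single (n : ZMod p)]
      · simp [mul_comm]
      · intro b _ hb
        simp [hb]
      · simp
    rw [Finset.mul_sum]
    simp only [h2, Finset.mul_sum, Finset.sum_mul]
    rw [Finset.sum_comm]
    simp only [Finset.sum_comm (s := range M)]
    rw [Finset.sum_comm]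
    refine Finset.sum_congr rfl fun a _ => Finset.sum_congr rfl fun x _ =>
      Finset.sum_congr rfl fun n _ => ?_
    rw [mul_sub, sub_eq_add_neg, AddChar.map_add_eq_mul, AddChar.mulShift_apply]
    ring
  have h3 : ‖(p : ℂ) * ∑ n ∈ range M, Φ n‖ ≤
      ∑ a ∈ range p, ‖∑ n ∈ range M, (ZMod.stdAddChar (-((a : ZMod p) * (n : ZMod p))) : ℂ)‖ * B := by
    rw [h1, ← ZMod.sum_eq_sum_range
      (fun a : ZMod p => ‖∑ n ∈ range M, (ZMod.stdAddChar (-(a * (n : ZMod p))) : ℂ)‖ * B)]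
    refine (norm_sum_le _ _).trans (Finset.sum_le_sum fun a _ => ?_)
    rw [norm_mul]
    exact mul_le_mul_of_nonneg_left (hB _) (norm_nonneg _)
  have h4 : ∑ a ∈ range p, ‖∑ n ∈ range M, (ZMod.stdAddChar (-((a : ZMod p) * (n : ZMod p))) : ℂ)‖ ≤
      p * (2 + Real.log p) := by
    obtain ⟨q, hq⟩ := Nat.exists_eq_add_of_lt (Fact.out : p.Prime).pos
    rw [zero_add] at hq
    have hharm := harmonic_le_one_add_log q
    have hlog : Real.log q ≤ Real.log p := by
      rcases Nat.eq_zero_or_pos q with h | h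
      · rw [h]; simpa using Real.log_natCast_nonneg p
      · exact Real.log_le_log (by exact_mod_cast h) (by exact_mod_cast (by omega))
    have hr : range p = range (q + 1) := by rw [hq]
    rw [hr, Finset.sum_range_succ']
    have h5 : ‖∑ n ∈ range M, (ZMod.stdAddChar (-(((0 : ℕ) : ZMod p) * (n : ZMod p))) : ℂ)‖ ≤ p := by
      simp
      exact_mod_cast hM
    have h6 : ∑ a ∈ range q, ‖∑ n ∈ range M, (ZMod.stdAddChar (-(((a + 1 : ℕ) : ZMod p) * (n : ZMod p))) : ℂ)‖
        ≤ ∑ a ∈ range q, p / 2 * (((a + 1 : ℕ) : ℝ)⁻¹ + ((q - 1 - a + 1 : ℕ) : ℝ)⁻¹) := by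
      refine Finset.sum_le_sum fun a ha => ?_
      rw [Finset.mem_range] at ha
      have h := norm_sum_range_stdAddChar_le (p := p) (a := a + 1) (by omega) (by omega) M
      rwa [show p - (a + 1) = q - 1 - a + 1 by omega] at h
    have h7 : ∑ a ∈ range q, (((a + 1 : ℕ) : ℝ))⁻¹ = (harmonic q : ℝ) := by
      simp [harmonic]
    have h8 : ∑ a ∈ range q, (((q - 1 - a + 1 : ℕ) : ℝ))⁻¹ = (harmonic q : ℝ) := by
      rw [Finset.sum_range_reflect (fun a => ((a + 1 : ℕ) : ℝ)⁻¹), h7]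
    rw [← Finset.mul_sum, Finset.sum_add_distrib, h7, h8] at h6
    nlinarith
  rw [norm_mul, Complex.norm_natCast, ← Finset.sum_mul] at h3
  have h9 : (p : ℝ) * ‖∑ n ∈ range M, Φ n‖ ≤ p * (B * (2 + Real.log p)) := by
    refine h3.trans ((mul_le_mul_of_nonneg_right h4 hB0).trans_eq (by ring))
  exact le_of_mul_le_mul_left h9 hp

noncomputable instance {F : Type*} [Field F] [Finite F] : Fintype (MulChar F ℂ) :=
  Fintype.ofFinite _

/-- `h` is a combination of multiplicative characters, with coefficients of total size at
most `C`. -/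
def HasMulCharExpansion {F : Type*} [Field F] [Finite F] (h : F → ℂ) (C : ℝ) : Prop :=
  ∃ u : MulChar F ℂ → ℂ, (∀ y, h y = ∑ χ, u χ * χ y) ∧ ∑ χ, ‖u χ‖ ≤ C

namespace HasMulCharExpansion

variable {F : Type*} [Field F] [Finite F] {h₁ h₂ : F → ℂ} {C₁ C₂ : ℝ}

theorem nonneg (H₁ : HasMulCharExpansion h₁ C₁) : 0 ≤ C₁ := by
  obtain ⟨u, -, hu⟩ := H₁
  exact (Finset.sum_nonneg fun _ _ => norm_nonneg _).trans hu

theorem mulChar (χ : MulChar F ℂ) : HasMulCharExpansion (fun y => χ y) 1 := by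
  classical
  refine ⟨fun χ' => if χ' = χ then 1 else 0, fun y => ?_, ?_⟩
  · simp
  · simp [apply_ite]

theorem sub (H₁ : HasMulCharExpansion h₁ C₁) (H₂ : HasMulCharExpansion h₂ C₂) :
    HasMulCharExpansion (fun y => h₁ y - h₂ y) (C₁ + C₂) := by
  obtain ⟨u, hu, hu'⟩ := H₁
  obtain ⟨v, hv, hv'⟩ := H₂
  refine ⟨fun χ => u χ - v χ, fun y => ?_, ?_⟩
  · dsimp only
    rw [hu, hv, ← Finset.sum_sub_distrib]
    exact Finset.sum_congr rfl fun _ _ => by ring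
  · refine (Finset.sum_le_sum fun χ _ => norm_sub_le _ _).trans ?_
    rw [Finset.sum_add_distrib]
    exact add_le_add hu' hv'

theorem mul (H₁ : HasMulCharExpansion h₁ C₁) (H₂ : HasMulCharExpansion h₂ C₂) :
    HasMulCharExpansion (fun y => h₁ y * h₂ y) (C₁ * C₂) := by
  have hC := H₁.nonneg
  obtain ⟨u, hu, hu'⟩ := H₁
  obtain ⟨v, hv, hv'⟩ := H₂
  have key : ∀ χ, ∀ a : MulChar F ℂ → MulChar F ℂ → ℝ,
      ∑ θ, a χ (χ⁻¹ * θ) = ∑ θ, a χ θ := fun χ a =>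
    Fintype.sum_equiv (Equiv.mulLeft χ⁻¹) _ _ fun _ => rfl
  refine ⟨fun θ => ∑ χ, u χ * v (χ⁻¹ * θ), fun y => ?_, ?_⟩
  · dsimp only
    rw [hu, hv, Finset.sum_mul]
    simp only [Finset.sum_mul, Finset.mul_sum]
    rw [Finset.sum_comm (s := univ) (t := univ) (f := fun θ χ => u χ * v (χ⁻¹ * θ) * θ y)]
    refine Finset.sum_congr rfl fun χ _ => ?_
    refine Fintype.sum_equiv (Equiv.mulLeft χ) _ _ fun θ => ?_
    rw [Equiv.coe_mulLeft, inv_mul_cancel_left, MulChar.mul_apply]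
    ring
  · calc ∑ θ, ‖∑ χ, u χ * v (χ⁻¹ * θ)‖ ≤ ∑ θ, ∑ χ, ‖u χ‖ * ‖v (χ⁻¹ * θ)‖ :=
        Finset.sum_le_sum fun θ _ => (norm_sum_le _ _).trans_eq (by simp only [norm_mul])
      _ = (∑ χ, ‖u χ‖) * ∑ θ, ‖v θ‖ := by
        rw [Finset.sum_comm, Finset.sum_mul]
        refine Finset.sum_congr rfl fun χ _ => ?_
        rw [key χ fun χ θ => ‖u χ‖ * ‖v θ‖, Finset.mul_sum]
      _ ≤ C₁ * C₂ := mul_le_mul hu' hv' (Finset.sum_nonneg fun _ _ => norm_nonneg _) hC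

theorem prod {ι : Type*} (s : Finset ι) (h : ι → F → ℂ) (C : ℝ)
    (H : ∀ i ∈ s, HasMulCharExpansion (h i) C) {h₀ : F → ℂ} (H₀ : HasMulCharExpansion h₀ 1) :
    HasMulCharExpansion (fun y => h₀ y * ∏ i ∈ s, h i y) (C ^ s.card) := by
  classical
  induction s using Finset.induction_on with
  | empty => simpa using H₀
  | insert a s ha ih =>
    have h1 := (H a (Finset.mem_insert_self _ _)).mul
      (ih fun i hi => H i (Finset.mem_insert_of_mem hi))
    rw [Finset.card_insert_of_notMem ha, pow_succ']
    convert h1 using 2 with y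
    rw [Finset.prod_insert ha]
    ring

end HasMulCharExpansion

/-- The characters of order dividing `r` detect the subgroup of `r`-th powers. -/
theorem sum_filter_pow_eq_one_mulChar_apply {p : ℕ} [Fact p.Prime] {e r : ℕ} (h : e * r = p - 1)
    (y : ZMod p) [DecidableEq (MulChar (ZMod p) ℂ)] :
    ∑ χ : MulChar (ZMod p) ℂ with χ ^ r = 1, χ y = if y ^ e = 1 then (r : ℂ) else 0 := by
  have hp := (Fact.out : p.Prime).two_le
  have he : e ≠ 0 := by rintro rfl; omega
  have hr : r ≠ 0 := by rintro rfl; omega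
  have hcard : Fintype.card (MulChar (ZMod p) ℂ) = p - 1 := by
    rw [← ZMod.card_units p, Fintype.card_eq_nat_card, Fintype.card_eq_nat_card]
    exact MulChar.card_eq_card_units_of_hasEnoughRootsOfUnity (ZMod p) ℂ
  split_ifs with hy
  · have h1 : ∀ χ ∈ univ.filter (fun χ : MulChar (ZMod p) ℂ => χ ^ r = 1), χ y = 1 := by
      intro χ hχ
      obtain ⟨z, hz⟩ : IsUnit y := IsUnit.of_pow_eq_one hy he
      have hd : orderOf χ ∣ r := orderOf_dvd_of_pow_eq_one (Finset.mem_filter.1 hχ).2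
      obtain ⟨c, hc⟩ := hd
      rw [← hz]
      refine MulChar.eq_one_of_pow_eq_one χ (e₀ := c * e) (by rw [← h, hc]; ring) z ?_
      ext
      rw [Units.val_pow_eq_pow_val, hz, mul_comm, pow_mul, hy, one_pow, Units.val_one]
    rw [Finset.sum_congr rfl h1, Finset.sum_const, IsCyclic.card_pow_eq_one_of_dvd
      (by rw [hcard, ← h]; exact dvd_mul_left _ _), nsmul_eq_mul, mul_one]
  · by_cases hy0 : IsUnit y
    · obtain ⟨θ, hθ⟩ := MulChar.exists_apply_ne_one_of_hasEnoughRootsOfUnity (ZMod p) ℂ hy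
      have hθr : (θ ^ e) ^ r = 1 := by
        rw [← pow_mul, h, ← hcard]; exact pow_card_eq_one
      have h2 : ∑ χ : MulChar (ZMod p) ℂ with χ ^ r = 1, χ y =
          (θ ^ e) y * ∑ χ : MulChar (ZMod p) ℂ with χ ^ r = 1, χ y := by
        rw [Finset.mul_sum]
        symm
        refine Finset.sum_equiv (Equiv.mulLeft (θ ^ e)) (fun χ => ?_) fun χ _ => ?_
        · simp [mul_pow, hθr]
        · rw [Equiv.coe_mulLeft, MulChar.mul_apply]
      rw [MulChar.pow_apply' _ he, ← map_pow] at h2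
      by_contra h3
      exact hθ (mul_right_cancel₀ h3 (by rw [one_mul]; exact h2.symm))
    · exact Finset.sum_eq_zero fun χ _ => χ.map_nonunit hy0

theorem exists_mulChar_expansion_pow_eq_one {p : ℕ} [Fact p.Prime] {e r : ℕ} (h : e * r = p - 1) :
    ∃ u : MulChar (ZMod p) ℂ → ℂ, (∀ y : ZMod p, (if y ^ e = 1 then 1 else 0) = ∑ χ, u χ * χ y) ∧
      ∑ χ, ‖u χ‖ ≤ 1 ∧ ∀ χ, u χ ≠ 0 → χ ^ r = 1 := by
  classical
  have hr0 : (r : ℂ) ≠ 0 := by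
    rintro h0
    rw [Nat.cast_eq_zero] at h0
    have := (Fact.out : p.Prime).two_le
    rw [h0] at h
    omega
  have hcard : Fintype.card (MulChar (ZMod p) ℂ) = p - 1 := by
    rw [← ZMod.card_units p, Fintype.card_eq_nat_card, Fintype.card_eq_nat_card]
    exact MulChar.card_eq_card_units_of_hasEnoughRootsOfUnity (ZMod p) ℂ
  refine ⟨fun χ => if χ ^ r = 1 then (r : ℂ)⁻¹ else 0, fun y => ?_, ?_, fun χ hχ => ?_⟩
  · simp only [ite_mul, zero_mul]
    rw [← Finset.sum_filter, ← Finset.mul_sum, sum_filter_pow_eq_one_mulChar_apply h]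
    split_ifs <;> simp [hr0]
  · simp only [apply_ite norm, norm_zero]
    rw [← Finset.sum_filter, Finset.sum_const, IsCyclic.card_pow_eq_one_of_dvd
      (by rw [hcard, ← h]; exact dvd_mul_left _ _), nsmul_eq_mul, norm_inv, Complex.norm_natCast,
      mul_inv_cancel₀ (by exact_mod_cast hr0)]
  · by_contra hne
    exact hχ (if_neg hne)

theorem hasMulCharExpansion_pow_eq_one {p : ℕ} [Fact p.Prime] {e : ℕ} (h : e ∣ p - 1) :
    HasMulCharExpansion (fun y : ZMod p => if y ^ e = 1 then 1 else 0) 1 := by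
  obtain ⟨r, hr⟩ := h
  obtain ⟨u, hu, hu1, -⟩ := exists_mulChar_expansion_pow_eq_one hr.symm
  exact ⟨u, hu, hu1⟩

theorem hasMulCharExpansion_orderOf_eq {p : ℕ} [Fact p.Prime] {m : ℕ} (hm : m ∣ p - 1) :
    HasMulCharExpansion (fun y : ZMod p => if orderOf y = m then 1 else 0)
      (2 ^ m.primeFactors.card) := by
  have hp := (Fact.out : p.Prime).two_le
  have hm0 : 0 < m := Nat.pos_of_dvd_of_pos hm (by omega)
  have h1 := HasMulCharExpansion.prod m.primeFactors
    (fun q (y : ZMod p) => (1 : MulChar (ZMod p) ℂ) y - if y ^ (m / q) = 1 then 1 else 0) (1 + 1)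
    (fun q hq => (HasMulCharExpansion.mulChar 1).sub (hasMulCharExpansion_pow_eq_one
      ((Nat.div_dvd_of_dvd (Nat.dvd_of_mem_primeFactors hq)).trans hm)))
    (hasMulCharExpansion_pow_eq_one hm)
  rw [one_add_one_eq_two] at h1
  convert h1 using 2 with y
  by_cases hy : y ^ m = 1
  · have hu : IsUnit y := IsUnit.of_pow_eq_one hy hm0.ne'
    rw [if_pos hy, one_mul]
    simp only [MulChar.one_apply hu]
    split_ifs with ho
    · symm
      refine Finset.prod_eq_one fun q hq => ?_
      rw [if_neg, sub_zero]
      have hq' := Nat.prime_of_mem_primeFactors hq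
      exact pow_ne_one_of_lt_orderOf
        (Nat.div_pos (Nat.le_of_dvd hm0 (Nat.dvd_of_mem_primeFactors hq)) hq'.pos).ne'
        ((Nat.div_lt_self hm0 hq'.one_lt).trans_eq ho.symm)
    · symm
      by_contra hne
      refine ho (orderOf_eq_of_pow_and_pow_div_prime hm0 hy fun q hq hqm hyq => hne ?_)
      exact Finset.prod_eq_zero (Nat.mem_primeFactors.2 ⟨hq, hqm, hm0.ne'⟩) (by simp [hyq])
  · rw [if_neg hy, zero_mul, if_neg]
    rintro rfl
    exact hy (pow_orderOf_eq_one y)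

theorem ZMod.exists_orderOf_eq_sub_one_and_pow_eq {p : ℕ} [Fact p.Prime] {s : ℕ} (hs : s ∣ p - 1)
    {y : ZMod p} : (∃ g : ZMod p, orderOf g = p - 1 ∧ y = g ^ s) ↔ orderOf y = (p - 1) / s := by
  have hp := (Fact.out : p.Prime).two_le
  have hs0 : 0 < s := Nat.pos_of_dvd_of_pos hs (by omega)
  constructor
  · rintro ⟨g, hg, rfl⟩
    rw [orderOf_pow' _ hs0.ne', hg, Nat.gcd_eq_right hs]
  · intro hy
    obtain ⟨γ, hγ⟩ := IsCyclic.exists_generator (α := (ZMod p)ˣ)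
    have hγo : orderOf γ = p - 1 := by
      rw [orderOf_eq_card_of_forall_mem_zpowers hγ, Nat.card_eq_fintype_card, ZMod.card_units]
    obtain ⟨m, hm⟩ := hs
    have hm0 : m ≠ 0 := by rintro rfl; omega
    rw [hm, Nat.mul_div_cancel_left _ hs0] at hy
    obtain ⟨z, rfl⟩ : IsUnit y := IsUnit.of_pow_eq_one (n := m) (hy ▸ pow_orderOf_eq_one y) hm0
    rw [orderOf_units] at hy
    obtain ⟨j, rfl⟩ := mem_powers_iff_mem_zpowers.2 (hγ z)
    have hsj : s ∣ j := by
      have h1 : (γ ^ j) ^ m = 1 := hy ▸ pow_orderOf_eq_one (γ ^ j)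
      rw [← pow_mul] at h1
      have h2 := orderOf_dvd_of_pow_eq_one h1
      rw [hγo, hm] at h2
      exact Nat.dvd_of_mul_dvd_mul_right (Nat.pos_of_ne_zero hm0) h2
    obtain ⟨i, rfl⟩ := hsj
    have hco : i.Coprime m := by
      have h3 : orderOf (γ ^ (s * i)) = _ := orderOf_pow γ
      dsimp only at hy
      rw [hy, hγo, hm, Nat.gcd_mul_left, Nat.mul_div_mul_left _ _ hs0] at h3
      have h4 : Nat.gcd m i ∣ m := Nat.gcd_dvd_left _ _
      have h5 := Nat.div_mul_cancel h4
      rw [← h3] at h5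
      exact Nat.coprime_comm.1 (Nat.eq_of_mul_eq_mul_left (Nat.pos_of_ne_zero hm0)
        (by rw [h5, mul_one]))
    have : NeZero (p - 1) := ⟨by omega⟩
    obtain ⟨v, hv⟩ := ZMod.unitsMap_surjective (n := m) (m := p - 1) ⟨s, by rw [hm, mul_comm]⟩
      (ZMod.unitOfCoprime i hco)
    refine ⟨((γ ^ (v : ZMod (p - 1)).val : (ZMod p)ˣ) : ZMod p), ?_, ?_⟩
    · rw [orderOf_units, orderOf_pow, hγo, Nat.coprime_iff_gcd_eq_one.1
        (ZMod.val_coe_unit_coprime v).symm, Nat.div_one]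
    · rw [← Units.val_pow_eq_pow_val, Units.val_inj, ← pow_mul]
      rw [pow_eq_pow_iff_modEq, hγo, mul_comm _ s]
      suffices h7 : i ≡ (v : ZMod (p - 1)).val [MOD m] by
        have h8 := h7.mul_left' s
        rwa [← hm] at h8
      rw [← ZMod.natCast_eq_natCast_iff]
      have h6 := congrArg Units.val hv
      rw [ZMod.unitsMap_val, ZMod.coe_unitOfCoprime] at h6
      rw [← h6, ZMod.natCast_val]

namespace Polynomial

theorem irreducible_taylor_iff {F : Type*} [Field F] {f : F[X]} (r : F) :
    Irreducible (taylor r f) ↔ Irreducible f := by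
  rw [← coe_taylorEquiv]
  exact MulEquiv.irreducible_iff (taylorEquiv r)

theorem Monic.taylor {F : Type*} [Field F] {f : F[X]} (hf : f.Monic) (r : F) :
    (Polynomial.taylor r f).Monic := by
  rw [Monic, leadingCoeff_taylor, hf]

theorem isCoprime_of_monic_of_irreducible_of_ne {F : Type*} [Field F] {f g : F[X]} (hf : f.Monic)
    (hg : g.Monic) (hf' : Irreducible f) (hg' : Irreducible g) (h : f ≠ g) : IsCoprime f g :=
  hf'.coprime_iff_not_dvd.2 fun hd =>
    h (eq_of_monic_of_associated hf hg (hf'.associated_of_dvd hg' hd))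

theorem taylor_left_injective {p : ℕ} [Fact p.Prime] {f : (ZMod p)[X]} (h0 : f.natDegree ≠ 0)
    (hp : f.natDegree < p) : Function.Injective fun r => taylor r f := by
  intro a b hab
  by_contra hne
  have hc : a - b ≠ 0 := sub_ne_zero.2 hne
  have h1 : ∀ x, f.eval (x + (a - b)) = f.eval x := fun x => by
    have h := congrArg (eval (x - b)) hab
    simp only [taylor_eval] at h
    rw [show x + (a - b) = x - b + a by ring, h, sub_add_cancel]
  have h2 : ∀ n : ℕ, f.eval (n * (a - b)) = f.eval 0 := fun n => by
    induction n with
    | zero => simp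
    | succ n ih => rw [Nat.cast_succ, add_mul, one_mul, h1, ih]
  have h3 : f - C (f.eval 0) = 0 := by
    refine eq_zero_of_natDegree_lt_card_of_eval_eq_zero' _ univ (fun x _ => ?_) ?_
    · have h4 := h2 (x / (a - b)).val
      rw [ZMod.natCast_zmod_val, div_mul_cancel₀ _ hc] at h4
      rw [eval_sub, eval_C, h4, sub_self]
    · rwa [natDegree_sub_C, Finset.card_univ, ZMod.card]
  exact h0 (by rw [sub_eq_zero.1 h3, natDegree_C])

theorem card_filter_exists_eval_eq_zero_le {F ι : Type*} [Field F] [Fintype F] [Fintype ι]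
    [DecidableEq F] {f : F[X]} (hf : f ≠ 0) (d : ι → F)
    [DecidablePred fun x => ∃ i, x + d i = 0 ∨ f.eval (x + d i) = 0] :
    (univ.filter fun x => ∃ i, x + d i = 0 ∨ f.eval (x + d i) = 0).card ≤
      Fintype.card ι * (f.natDegree + 1) := by
  have h1 : (univ.filter fun x => ∃ i, x + d i = 0 ∨ f.eval (x + d i) = 0) ⊆
      univ.biUnion fun i => insert (-d i) (taylor (d i) f).roots.toFinset := by
    intro x hx
    obtain ⟨i, hi⟩ := (Finset.mem_filter.1 hx).2
    rw [Finset.mem_biUnion]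
    refine ⟨i, Finset.mem_univ _, ?_⟩
    rw [Finset.mem_insert, Multiset.mem_toFinset, mem_roots (by rwa [Ne, taylor_eq_zero]), IsRoot,
      taylor_eval]
    exact hi.imp eq_neg_of_add_eq_zero_left id
  refine (Finset.card_le_card h1).trans ((Finset.card_biUnion_le).trans ?_)
  rw [← Finset.card_univ, ← smul_eq_mul]
  refine Finset.sum_le_card_nsmul _ _ _ fun i _ => (Finset.card_insert_le _ _).trans ?_
  refine Nat.succ_le_succ ((Multiset.toFinset_card_le _).trans ((card_roots' _).trans_eq ?_))
  rw [natDegree_taylor]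

end Polynomial

open Polynomial in
theorem norm_sum_prod_mulChar_shift_le {p : ℕ} [Fact p.Prime] {ι : Type*} [Fintype ι]
    {f : (ZMod p)[X]} (hf : Irreducible f) (hfp : f.natDegree < p) {d : ι → ZMod p}
    (hd : Function.Injective d) (χ ψ : ι → MulChar (ZMod p) ℂ)
    (h1 : f.natDegree = 1 → ∀ i, ψ i = 1) (hne : ∃ i, χ i ≠ 1 ∨ ψ i ≠ 1)
    (θ : AddChar (ZMod p) ℂ) :
    ‖∑ x, (∏ i, χ i (x + d i) * ψ i (f.eval (x + d i))) * θ x‖ ≤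
      Fintype.card ι * (f.natDegree + 1) * (Real.sqrt p + 1) := by
  classical
  have hf0 := hf.ne_zero
  have hfd : 0 < f.natDegree := hf.natDegree_pos
  set a := f.leadingCoeff with ha
  have ha0 : a ≠ 0 := leadingCoeff_ne_zero.2 hf0
  set f₀ := f * C a⁻¹ with hf₀
  have hmon : f₀.Monic := monic_mul_leadingCoeff_inv hf0
  have hirr : Irreducible f₀ :=
    (associated_mul_unit_right f _ (isUnit_C.2 (inv_ne_zero ha0).isUnit)).irreducible hf
  have hdeg : f₀.natDegree = f.natDegree := natDegree_mul_C (inv_ne_zero ha0)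
  have hev : ∀ y, f.eval y = a * f₀.eval y := fun y => by
    rw [hf₀, eval_mul, eval_C, mul_comm (eval y f), mul_inv_cancel_left₀ ha0]
  let J := {i // χ i ≠ 1} ⊕ {i // ψ i ≠ 1}
  let g : J → (ZMod p)[X] := Sum.elim (fun i => taylor (d i) X) (fun i => taylor (d i) f₀)
  let Χ : J → MulChar (ZMod p) ℂ := Sum.elim (fun i => χ i) (fun i => ψ i)
  have hJ : Nonempty J := by
    obtain ⟨i, hi | hi⟩ := hne
    exacts [⟨Sum.inl ⟨i, hi⟩⟩, ⟨Sum.inr ⟨i, hi⟩⟩]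
  have hgm : ∀ j, (g j).Monic := by
    rintro (i | i)
    exacts [monic_X.taylor _, hmon.taylor _]
  have hgi : ∀ j, Irreducible (g j) := by
    rintro (i | i)
    exacts [(irreducible_taylor_iff _).2 irreducible_X, (irreducible_taylor_iff _).2 hirr]
  have hdeg1 : ∀ i, ψ i ≠ 1 → f₀.natDegree ≠ 1 := fun i hi h => hi (h1 (hdeg ▸ h) i)
  have hgc : ∀ i j, i ≠ j → IsCoprime (g i) (g j) := by
    intro i j hij
    refine isCoprime_of_monic_of_irreducible_of_ne (hgm i) (hgm j) (hgi i) (hgi j) fun h => ?_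
    rcases i with i | i <;> rcases j with j | j
    · refine hij (congrArg Sum.inl (Subtype.ext (hd (taylor_left_injective
        (f := (X : (ZMod p)[X])) ?_ ?_ h))))
      · rw [natDegree_X]; exact one_ne_zero
      · rw [natDegree_X]; exact (Fact.out : p.Prime).one_lt
    · have h2 := congrArg natDegree h
      simp only [g, Sum.elim_inl, Sum.elim_inr, natDegree_taylor, natDegree_X] at h2
      exact hdeg1 j j.2 h2.symm
    · have h2 := congrArg natDegree h
      simp only [g, Sum.elim_inl, Sum.elim_inr, natDegree_taylor, natDegree_X] at h2
      exact hdeg1 i i.2 h2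
    · exact hij (congrArg Sum.inr (Subtype.ext (hd (taylor_left_injective
        (by rw [hdeg]; exact hfd.ne') (by rwa [hdeg]) h))))
  have hΧ : ∀ j, Χ j ≠ 1 := by
    rintro (i | i)
    exacts [i.2, i.2]
  have hweil := norm_sum_prod_mulChar_mul_addChar_le g hgm hgi hgc Χ hΧ θ
  have hsum : ∑ j, (g j).natDegree ≤ Fintype.card ι * (f.natDegree + 1) := by
    rw [Fintype.sum_sum_type]
    simp only [g, Sum.elim_inl, Sum.elim_inr, natDegree_taylor, natDegree_X, hdeg,
      Finset.sum_const, Finset.card_univ, smul_eq_mul, mul_one]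
    have e1 := Fintype.card_subtype_le fun i => χ i ≠ 1
    have e2 := Nat.mul_le_mul_right f.natDegree (Fintype.card_subtype_le fun i => ψ i ≠ 1)
    linarith
  set c := ∏ i : {i // ψ i ≠ 1}, ψ i a with hc
  have hcn : ‖c‖ ≤ 1 := by
    rw [hc, norm_prod]
    exact Finset.prod_le_one (fun _ _ => norm_nonneg _)
      fun i _ => DirichletCharacter.norm_le_one (ψ i) _
  set A : ZMod p → ℂ := fun x => ∏ i, χ i (x + d i) * ψ i (f.eval (x + d i))
  set B : ZMod p → ℂ := fun x => ∏ j, Χ j ((g j).eval x)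
  have hB : ∀ x, ‖B x‖ ≤ 1 := fun x => by
    rw [norm_prod]
    exact Finset.prod_le_one (fun _ _ => norm_nonneg _)
      fun i _ => DirichletCharacter.norm_le_one (Χ i) _
  have hAB : ∀ x, ‖A x * θ x - c * (B x * θ x)‖ ≤
      if ∃ i, x + d i = 0 ∨ f.eval (x + d i) = 0 then 1 else 0 := by
    intro x
    split_ifs with hx
    · obtain ⟨i, hi⟩ := hx
      have : A x = 0 := by
        refine Finset.prod_eq_zero (Finset.mem_univ i) ?_
        rcases hi with hi | hi
        · rw [hi, MulChar.map_zero, zero_mul]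
        · rw [hi, MulChar.map_zero, mul_zero]
      rw [this, zero_mul, zero_sub, norm_neg, norm_mul, norm_mul, AddChar.norm_apply, mul_one]
      exact mul_le_one₀ hcn (norm_nonneg _) (hB x)
    · push Not at hx
      have hsub : ∀ (η : ι → MulChar (ZMod p) ℂ) (y : ι → ZMod p), (∀ i, y i ≠ 0) →
          ∏ i, η i (y i) = ∏ i : {i // η i ≠ 1}, η i (y i) := fun η y hy => by
        rw [← Finset.prod_subtype (univ.filter fun i => η i ≠ 1) (by simp) fun i => η i (y i)]
        refine (Finset.prod_filter_of_ne (p := fun i => η i ≠ 1) fun i _ hi h => hi ?_).symm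
        rw [h, MulChar.one_apply (hy i).isUnit]
      have : A x = c * B x := by
        have hBx : B x = (∏ i : {i // χ i ≠ 1}, χ i (x + d i)) *
            ∏ i : {i // ψ i ≠ 1}, ψ i (f₀.eval (x + d i)) := by
          refine (Fintype.prod_sum_type _).trans ?_
          simp only [g, Χ, Sum.elim_inl, Sum.elim_inr, taylor_eval, eval_X]
        rw [hBx]
        simp only [A]
        rw [Finset.prod_mul_distrib, hsub χ _ fun i => (hx i).1, hsub ψ _ fun i => (hx i).2]
        simp only [hev, map_mul, Finset.prod_mul_distrib]
        ring
      rw [this, mul_assoc, sub_self, norm_zero]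
  have hdiff : ‖∑ x, A x * θ x - c * ∑ x, B x * θ x‖ ≤ Fintype.card ι * (f.natDegree + 1) := by
    rw [Finset.mul_sum, ← Finset.sum_sub_distrib]
    refine (norm_sum_le _ _).trans ((Finset.sum_le_sum fun x _ => hAB x).trans ?_)
    rw [Finset.sum_ite, Finset.sum_const_zero, add_zero, Finset.sum_const, nsmul_eq_mul, mul_one]
    exact_mod_cast card_filter_exists_eval_eq_zero_le hf0 d
  have hcB : ‖c * ∑ x, B x * θ x‖ ≤ Fintype.card ι * (f.natDegree + 1) * Real.sqrt p := by
    rw [norm_mul]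
    refine (mul_le_of_le_one_left (norm_nonneg _) hcn).trans (hweil.trans ?_)
    refine mul_le_mul_of_nonneg_right ?_ (Real.sqrt_nonneg _)
    exact_mod_cast hsum
  calc ‖∑ x, A x * θ x‖ = ‖c * ∑ x, B x * θ x + (∑ x, A x * θ x - c * ∑ x, B x * θ x)‖ := by
        congr 1; ring
    _ ≤ _ := (norm_add_le _ _).trans (add_le_add hcB hdiff)
    _ = _ := by ring

open Polynomial in
theorem norm_sub_natCast_sum_mul_le {p : ℕ} [Fact p.Prime] {f : (ZMod p)[X]} (hf : Irreducible f)
    (hfp : f.natDegree < p) {h : ZMod p → ℂ} {w : MulChar (ZMod p) ℂ × MulChar (ZMod p) ℂ → ℂ}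
    (hw : ∀ y, h y = ∑ t, w t * (t.1 y * t.2 (f.eval y))) {V : ℝ} (hV : ∑ t, ‖w t‖ ≤ V)
    (hw1 : f.natDegree = 1 → ∀ t, w t ≠ 0 → t.2 = 1) :
    ‖p * w 1 - ∑ y, h y‖ ≤ V * ((f.natDegree + 1) * (Real.sqrt p + 1)) := by
  classical
  set E : ℝ := (f.natDegree + 1) * (Real.sqrt p + 1) with hE
  have hE0 : 0 ≤ E := by positivity
  have h1 : p * w 1 - ∑ y, h y = ∑ t, w t * ((if t = 1 then (p : ℂ) else 0) -
      ∑ y, (t.1 y * t.2 (f.eval y))) := by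
    simp only [mul_sub, Finset.sum_sub_distrib, mul_ite, mul_zero, Finset.sum_ite_eq',
      Finset.mem_univ, if_true, hw]
    rw [Finset.sum_comm, mul_comm]
    simp only [Finset.mul_sum]
  have h2 : ∀ t, ‖w t * ((if t = 1 then (p : ℂ) else 0) - ∑ y, (t.1 y * t.2 (f.eval y)))‖ ≤
      ‖w t‖ * E := by
    intro t
    rcases eq_or_ne (w t) 0 with h0 | h0
    · simp [h0]
    rw [norm_mul]
    refine mul_le_mul_of_nonneg_left ?_ (norm_nonneg _)
    by_cases ht : t = 1
    · subst ht
      rw [if_pos rfl]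
      have h3 : (p : ℂ) = ∑ _y : ZMod p, 1 := by simp
      rw [h3, ← Finset.sum_sub_distrib]
      have h4 : ∀ y : ZMod p, ‖(1 : ℂ) - (1 : MulChar (ZMod p) ℂ) y *
          (1 : MulChar (ZMod p) ℂ) (f.eval y)‖ ≤
          if ∃ _i : Fin 1, y + 0 = 0 ∨ f.eval (y + 0) = 0 then 1 else 0 := by
        intro y
        simp only [add_zero, exists_const]
        split_ifs with hy
        · rcases hy with hy | hy
          · rw [hy, MulChar.map_zero, zero_mul, sub_zero, norm_one]
          · rw [hy, MulChar.map_zero, mul_zero, sub_zero, norm_one]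
        · push Not at hy
          rw [MulChar.one_apply hy.1.isUnit, MulChar.one_apply hy.2.isUnit]
          simp
      refine (norm_sum_le _ _).trans ((Finset.sum_le_sum fun y _ => h4 y).trans ?_)
      rw [Finset.sum_ite, Finset.sum_const_zero, add_zero, Finset.sum_const, nsmul_eq_mul, mul_one]
      have h5 := card_filter_exists_eval_eq_zero_le hf.ne_zero (fun _ : Fin 1 => (0 : ZMod p))
      rw [Fintype.card_fin, one_mul] at h5
      have h6 : (_ : ℝ) ≤ ((f.natDegree + 1 : ℕ) : ℝ) := Nat.cast_le.2 h5
      refine h6.trans ?_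
      rw [hE]
      push_cast
      nlinarith [Real.sqrt_nonneg (p : ℝ), Nat.cast_nonneg (α := ℝ) f.natDegree]
    · rw [if_neg ht, zero_sub, norm_neg]
      have h5 := norm_sum_prod_mulChar_shift_le hf hfp (d := fun _ : Fin 1 => (0 : ZMod p))
        (Function.injective_of_subsingleton _) (fun _ => t.1) (fun _ => t.2)
        (fun hd _ => hw1 hd t h0) (by
          by_contra! hcon
          obtain ⟨hc1, hc2⟩ := hcon 0
          exact ht (Prod.ext hc1 hc2)) 1
      simpa using h5
  rw [h1]
  refine (norm_sum_le _ _).trans ((Finset.sum_le_sum fun t _ => h2 t).trans ?_)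
  rw [← Finset.sum_mul]
  exact mul_le_mul_of_nonneg_right hV hE0

open Polynomial in
theorem norm_sum_range_prod_sub_le {p : ℕ} [Fact p.Prime] {f : (ZMod p)[X]} (hf : Irreducible f)
    (hfp : f.natDegree < p) {h : ZMod p → ℂ} {w : MulChar (ZMod p) ℂ × MulChar (ZMod p) ℂ → ℂ}
    (hw : ∀ y, h y = ∑ t, w t * (t.1 y * t.2 (f.eval y))) {V : ℝ} (hV : ∑ t, ‖w t‖ ≤ V)
    (hw1 : f.natDegree = 1 → ∀ t, w t ≠ 0 → t.2 = 1) {α : ℂ} (hα : p * α = ∑ y, h y)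
    {k : ℕ} (hk : 0 < k) {d : Fin k → ZMod p} (hd : Function.Injective d) {M : ℕ} (hM : M ≤ p) :
    ‖∑ n ∈ range M, ∏ i, (h (n + d i) - α * ((1 : MulChar (ZMod p) ℂ) (n + d i) *
      (1 : MulChar (ZMod p) ℂ) (f.eval (n + d i))))‖ ≤
      (V * (1 + (f.natDegree + 1) * (Real.sqrt p + 1) / p)) ^ k *
        ((f.natDegree + 1) * (Real.sqrt p + 1)) * (k * (2 + Real.log p) + 1) := by
  classical
  have hp : (0 : ℝ) < p := by exact_mod_cast (Fact.out : p.Prime).pos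
  set E : ℝ := (f.natDegree + 1) * (Real.sqrt p + 1) with hE
  have hE0 : 0 ≤ E := by positivity
  have hV0 : 0 ≤ V := (Finset.sum_nonneg fun _ _ => norm_nonneg _).trans hV
  set w' : MulChar (ZMod p) ℂ × MulChar (ZMod p) ℂ → ℂ := fun t => if t = 1 then w 1 - α else w t
    with hw'
  set W := V * (1 + E / p) with hW
  have hW0 : 0 ≤ W := by positivity
  have hδ : ‖w' 1‖ ≤ V * E / p := by
    have h1 := norm_sub_natCast_sum_mul_le hf hfp hw hV hw1
    rw [← hα, ← mul_sub, norm_mul, Complex.norm_natCast] at h1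
    rw [le_div_iff₀ hp, mul_comm]
    simpa [hw'] using h1
  have hsum : ∑ t, ‖w' t‖ ≤ W := by
    rw [← Finset.add_sum_erase _ _ (Finset.mem_univ 1)]
    have h1 : ∑ t ∈ univ.erase 1, ‖w' t‖ ≤ V := by
      refine le_trans ?_ hV
      rw [← Finset.add_sum_erase _ (fun t => ‖w t‖) (Finset.mem_univ 1)]
      refine (Finset.sum_le_sum fun t ht => ?_).trans (le_add_of_nonneg_left (norm_nonneg _))
      rw [hw']
      simp only [if_neg (Finset.ne_of_mem_erase ht), le_refl]
    calc _ ≤ V * E / p + V := add_le_add hδ h1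
      _ = W := by rw [hW]; ring
  have hexp : ∀ y, h y - α * ((1 : MulChar (ZMod p) ℂ) y * (1 : MulChar (ZMod p) ℂ) (f.eval y)) =
      ∑ t, w' t * (t.1 y * t.2 (f.eval y)) := by
    intro y
    rw [hw, ← Finset.add_sum_erase _ _ (Finset.mem_univ 1),
      ← Finset.add_sum_erase univ (fun t => w' t * (t.1 y * t.2 (f.eval y))) (Finset.mem_univ 1)]
    have h1 : ∑ t ∈ univ.erase 1, w' t * (t.1 y * t.2 (f.eval y)) =
        ∑ t ∈ univ.erase 1, w t * (t.1 y * t.2 (f.eval y)) :=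
      Finset.sum_congr rfl fun t ht => by
        rw [hw']
        simp only [if_neg (Finset.ne_of_mem_erase ht)]
    rw [h1]
    simp only [hw', if_true, Prod.fst_one, Prod.snd_one]
    ring
  let S : (Fin k → MulChar (ZMod p) ℂ × MulChar (ZMod p) ℂ) → ℂ := fun τ =>
    ∑ n ∈ range M, ∏ i, ((τ i).1 (n + d i) * (τ i).2 (f.eval (n + d i)))
  have hS : ∑ n ∈ range M, ∏ i, (h (n + d i) - α * ((1 : MulChar (ZMod p) ℂ) (n + d i) *
      (1 : MulChar (ZMod p) ℂ) (f.eval (n + d i)))) = ∑ τ, (∏ i, w' (τ i)) * S τ := by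
    simp only [hexp, Fintype.prod_sum, S, Finset.mul_sum]
    rw [Finset.sum_comm]
    refine Finset.sum_congr rfl fun τ _ => Finset.sum_congr rfl fun n _ => ?_
    rw [Finset.prod_mul_distrib]
  have hlog := Real.log_natCast_nonneg p
  set U := k * E * (2 + Real.log p) with hU
  have hU0 : 0 ≤ U := by positivity
  have hbd : ∀ τ, ‖(∏ i, w' (τ i)) * S τ‖ ≤
      (∏ i, ‖w' (τ i)‖) * U + if τ = 1 then W ^ k * E else 0 := by
    intro τ
    rw [norm_mul, norm_prod]
    have hprod0 : 0 ≤ ∏ i, ‖w' (τ i)‖ := Finset.prod_nonneg fun _ _ => norm_nonneg _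
    split_ifs with hτ
    · subst hτ
      refine le_add_of_nonneg_of_le (by positivity) ?_
      have h1 : ‖S 1‖ ≤ p := by
        refine (norm_sum_le _ _).trans ((Finset.sum_le_card_nsmul _ _ 1 fun n _ => ?_).trans ?_)
        · rw [norm_prod]
          refine Finset.prod_le_one (fun _ _ => norm_nonneg _) fun i _ => ?_
          rw [norm_mul]
          exact mul_le_one₀ (DirichletCharacter.norm_le_one (1 : MulChar (ZMod p) ℂ) _)
            (norm_nonneg _) (DirichletCharacter.norm_le_one (1 : MulChar (ZMod p) ℂ) _)
        · rw [Finset.card_range, nsmul_eq_mul, mul_one]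
          exact_mod_cast hM
      simp only [Pi.one_apply, Finset.prod_const, Finset.card_univ, Fintype.card_fin]
      obtain ⟨l, hl⟩ : ∃ l, k = l + 1 := ⟨k - 1, by omega⟩
      have hpow : ∀ x : ℝ, x ^ k = x ^ l * x := fun x => by rw [hl, pow_succ]
      rw [hpow, hpow]
      have hδW : ‖w' 1‖ ≤ W := (Finset.single_le_sum (fun t _ => norm_nonneg (w' t))
        (Finset.mem_univ 1)).trans hsum
      have hVW : V ≤ W := by rw [hW]; nlinarith [div_nonneg hE0 hp.le]
      calc ‖w' 1‖ ^ l * ‖w' 1‖ * ‖S 1‖ ≤ W ^ l * (V * E / p) * p := by gcongr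
        _ = W ^ l * (V * E) := by field_simp
        _ ≤ W ^ l * (W * E) := by gcongr
        _ = _ := by ring
    · rw [add_zero]
      by_cases h0 : ∃ i, w' (τ i) = 0
      · obtain ⟨i, hi⟩ := h0
        rw [Finset.prod_eq_zero (Finset.mem_univ i) (by rw [hi, norm_zero]), zero_mul, zero_mul]
      · push Not at h0
        refine mul_le_mul_of_nonneg_left ?_ hprod0
        have hadm : f.natDegree = 1 → ∀ i, (τ i).2 = 1 := by
          intro hd1 i
          by_cases hi : τ i = 1
          · rw [hi]; rfl
          · refine hw1 hd1 _ ?_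
            have := h0 i
            rw [hw'] at this
            simpa only [if_neg hi] using this
        have hnt : ∃ i, (τ i).1 ≠ 1 ∨ (τ i).2 ≠ 1 := by
          by_contra! hcon
          exact hτ (funext fun i => Prod.ext (hcon i).1 (hcon i).2)
        refine (norm_sum_range_le_of_forall_addChar
          (fun x => ∏ i, ((τ i).1 (x + d i) * (τ i).2 (f.eval (x + d i))))
          (norm_sum_prod_mulChar_shift_le hf hfp hd (fun i => (τ i).1) (fun i => (τ i).2)
            hadm hnt) hM).trans_eq ?_
        rw [Fintype.card_fin, hU, hE]
        ring
  rw [hS]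
  refine (norm_sum_le _ _).trans ((Finset.sum_le_sum fun τ _ => hbd τ).trans ?_)
  rw [Finset.sum_add_distrib, ← Finset.sum_mul, Finset.sum_ite_eq', if_pos (Finset.mem_univ _),
    ← Fintype.prod_sum (fun _ : Fin k => fun t => ‖w' t‖), Finset.prod_const, Finset.card_univ,
    Fintype.card_fin]
  have h2 : (∑ t, ‖w' t‖) ^ k ≤ W ^ k :=
    pow_le_pow_left₀ (Finset.sum_nonneg fun _ _ => norm_nonneg _) hsum k
  calc _ ≤ W ^ k * U + W ^ k * E := by gcongr
    _ = _ := by rw [hU]; ring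

theorem ZMod.exists_units_pow_eq_iff {p : ℕ} [Fact p.Prime] {e r : ℕ} (h : e * r = p - 1)
    {z : ZMod p} : (∃ x : (ZMod p)ˣ, z = (x : ZMod p) ^ r) ↔ z ^ e = 1 := by
  have hp := (Fact.out : p.Prime).two_le
  constructor
  · rintro ⟨x, rfl⟩
    rw [← pow_mul, mul_comm, h, ZMod.pow_card_sub_one_eq_one x.ne_zero]
  · intro hz
    have he : e ≠ 0 := by
      rintro rfl
      omega
    obtain ⟨u, rfl⟩ := IsUnit.of_pow_eq_one hz he
    obtain ⟨γ, hγ⟩ := IsCyclic.exists_generator (α := (ZMod p)ˣ)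
    have ho : orderOf γ = e * r := by
      rw [orderOf_eq_card_of_forall_mem_zpowers hγ, Nat.card_eq_fintype_card, ZMod.card_units, h]
    obtain ⟨j, rfl⟩ := (mem_powers_iff_mem_zpowers.2 (hγ u))
    have h1 : (γ ^ j) ^ e = 1 := by
      ext
      simpa using hz
    rw [← pow_mul, ← orderOf_dvd_iff_pow_eq_one, ho, mul_comm j] at h1
    obtain ⟨i, rfl⟩ := Nat.dvd_of_mul_dvd_mul_left (Nat.pos_of_ne_zero he) h1
    refine ⟨γ ^ i, ?_⟩
    simp only [Units.val_pow_eq_pow_val, ← pow_mul]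
    rw [mul_comm]

open Polynomial in
/-- The indicator function of the set `R` is a combination of products of multiplicative characters
of `y` and of `f(y)`. -/
theorem exists_mulChar_expansion_indicator {p : ℕ} [Fact p.Prime] {m e r : ℕ} (hm : m ∣ p - 1)
    (h : e * r = p - 1) (f : (ZMod p)[X]) :
    ∃ w : MulChar (ZMod p) ℂ × MulChar (ZMod p) ℂ → ℂ,
      (∀ y : ZMod p, (if orderOf y = m ∧ f.eval y ^ e = 1 then 1 else 0) =
        ∑ t, w t * (t.1 y * t.2 (f.eval y))) ∧
      ∑ t, ‖w t‖ ≤ 2 ^ m.primeFactors.card ∧ ∀ t, w t ≠ 0 → t.2 ^ r = 1 := by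
  obtain ⟨u, hu, hu1⟩ := hasMulCharExpansion_orderOf_eq hm
  obtain ⟨v, hv, hv1, hv2⟩ := exists_mulChar_expansion_pow_eq_one h
  refine ⟨fun t => u t.1 * v t.2, fun y => ?_, ?_, fun t ht => hv2 _ (right_ne_zero_of_mul ht)⟩
  · rw [ite_and, ← one_mul (if f.eval y ^ e = 1 then (1 : ℂ) else 0), ← ite_zero_mul]
    rw [Fintype.sum_prod_type, show (if orderOf y = m then (1 : ℂ) else 0) = _ from hu y, hv,
      Finset.sum_mul_sum]
    exact Finset.sum_congr rfl fun _ _ => Finset.sum_congr rfl fun _ _ => by ring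
  · simp only [norm_mul, Fintype.sum_prod_type, ← Finset.mul_sum, ← Finset.sum_mul]
    refine (mul_le_mul hu1 hv1 (Finset.sum_nonneg fun _ _ => norm_nonneg _)
      (by positivity)).trans_eq (mul_one _)

theorem abs_fsub_le_one {q : ℕ} {R : Finset ℕ} (hR : R.card ≤ q) (n : ℕ) : |fsub q R n| ≤ 1 := by
  have h0 : (0 : ℝ) ≤ R.card / q := by positivity
  have h1 : (R.card : ℝ) / q ≤ 1 := div_le_one_of_le₀ (by exact_mod_cast hR) (by positivity)
  rw [fsub, abs_le]
  split_ifs <;> constructor <;> linarith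

open Polynomial in
theorem abs_sum_prod_fsub_le {p : ℕ} [Fact p.Prime] {f : (ZMod p)[X]} (hf : Irreducible f)
    (hfp : f.natDegree < p) {m e r : ℕ} (hm : m ∣ p - 1) (h : e * r = p - 1)
    (hr : f.natDegree = 1 → r = 1) {R : Finset ℕ} (hRp : R ⊆ range p)
    (hR : ∀ n < p, n ∈ R ↔ orderOf (n : ZMod p) = m ∧ f.eval (n : ZMod p) ^ e = 1)
    {k : ℕ} (hk : 0 < k) {d : Fin k → ℕ} (hd : StrictMono d) (hdp : ∀ i, d i ≤ p - 1) {M : ℕ}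
    (hM : M ≤ p) :
    |∑ n ∈ range M, ∏ i, fsub p R (n + d i)| ≤
      (2 ^ m.primeFactors.card * (1 + (f.natDegree + 1) * (Real.sqrt p + 1) / p)) ^ k *
        ((f.natDegree + 1) * (Real.sqrt p + 1)) * (k * (2 + Real.log p) + 1) +
        k * (f.natDegree + 1) := by
  classical
  have hp := (Fact.out : p.Prime).pos
  have hRc : R.card ≤ p := (Finset.card_le_card hRp).trans_eq (Finset.card_range p)
  obtain ⟨w, hw, hw1, hw2⟩ := exists_mulChar_expansion_indicator hm h f
  set H : ZMod p → ℂ := fun y => if orderOf y = m ∧ f.eval y ^ e = 1 then 1 else 0 with hH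
  have hHn : ∀ n : ℕ, H n = if n % p ∈ R then 1 else 0 := by
    intro n
    rw [← ZMod.natCast_mod n p]
    simp only [hH, hR _ (Nat.mod_lt n hp)]
  have hHsum : ∑ y, H y = R.card := by
    rw [ZMod.sum_eq_sum_range, Finset.sum_congr rfl fun n hn => by
      rw [hHn, Nat.mod_eq_of_lt (Finset.mem_range.1 hn)], Finset.sum_ite_mem,
      Finset.inter_eq_right.2 hRp]
    simp
  set α : ℂ := (R.card : ℂ) / p with hα
  have hα' : p * α = ∑ y, H y := by
    rw [hHsum, hα, mul_div_cancel₀ _ (by exact_mod_cast hp.ne')]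
  have hinj : Function.Injective fun i => (d i : ZMod p) := by
    intro i j hij
    have := (ZMod.natCast_eq_natCast_iff' _ _ _).1 hij
    rw [Nat.mod_eq_of_lt (by have := hdp i; omega), Nat.mod_eq_of_lt (by have := hdp j; omega)]
      at this
    exact hd.injective this
  have hmain := norm_sum_range_prod_sub_le hf hfp hw hw1
    (fun hd1 t ht => by simpa [hr hd1] using hw2 t ht) hα' hk hinj hM
  let G : ℕ → ℂ := fun n => ∏ i, (H (n + (d i : ZMod p)) - α *
    ((1 : MulChar (ZMod p) ℂ) (n + (d i : ZMod p)) *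
      (1 : MulChar (ZMod p) ℂ) (f.eval (n + (d i : ZMod p)))))
  let bad : ZMod p → Prop := fun x => ∃ i, x + (d i : ZMod p) = 0 ∨ f.eval (x + (d i : ZMod p)) = 0
  have hfs : ∀ n : ℕ, (fsub p R n : ℂ) = H n - α := by
    intro n
    rw [hHn, fsub, hα]
    split_ifs <;> push_cast <;> ring
  have hdiff : ∀ n : ℕ, ‖((∏ i, fsub p R (n + d i) : ℝ) : ℂ) - G n‖ ≤ if bad n then 1 else 0 := by
    intro n
    split_ifs with hb
    · obtain ⟨i, hi⟩ := hb
      have hG : G n = 0 := by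
        refine Finset.prod_eq_zero (Finset.mem_univ i) ?_
        have he0 : e ≠ 0 := by
          rintro rfl
          have := (Fact.out : p.Prime).two_le
          omega
        have hm0 : m ≠ 0 := by
          rintro rfl
          have := (Fact.out : p.Prime).two_le
          rw [zero_dvd_iff] at hm
          omega
        have hH0 : H (n + (d i : ZMod p)) = 0 := by
          rw [hH]
          refine if_neg ?_
          rintro ⟨h1, h2⟩
          rcases hi with hi | hi
          · rw [hi] at h1
            have := orderOf_pos_iff.1 (h1 ▸ Nat.pos_of_ne_zero hm0)
            obtain ⟨j, hj, hj'⟩ := isOfFinOrder_iff_pow_eq_one.1 this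
            rw [zero_pow hj.ne'] at hj'
            exact zero_ne_one hj'
          · rw [hi, zero_pow he0] at h2
            exact zero_ne_one h2
        rw [hH0]
        rcases hi with hi | hi <;> rw [hi, MulChar.map_zero] <;> ring
      rw [hG, sub_zero, Complex.norm_real, Real.norm_eq_abs, Finset.abs_prod]
      exact Finset.prod_le_one (fun _ _ => abs_nonneg _) fun _ _ => abs_fsub_le_one hRc _
    · have hG : G n = ((∏ i, fsub p R (n + d i) : ℝ) : ℂ) := by
        rw [Complex.ofReal_prod]
        refine Finset.prod_congr rfl fun i _ => ?_
        have hi : ¬ (n + (d i : ZMod p) = 0 ∨ f.eval (n + (d i : ZMod p)) = 0) :=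
          fun hi => hb ⟨i, hi⟩
        push Not at hi
        rw [hfs, MulChar.one_apply hi.1.isUnit, MulChar.one_apply hi.2.isUnit, mul_one, mul_one,
          Nat.cast_add]
      rw [hG, sub_self, norm_zero]
  have hbad : ∑ n ∈ range M, (if bad n then (1 : ℝ) else 0) ≤ k * (f.natDegree + 1) := by
    have h1 : ∑ n ∈ range M, (if bad n then (1 : ℝ) else 0) ≤
        ∑ n ∈ range p, if bad n then (1 : ℝ) else 0 :=
      Finset.sum_le_sum_of_subset_of_nonneg (Finset.range_mono hM)
        fun n _ _ => by split_ifs <;> norm_num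
    rw [← ZMod.sum_eq_sum_range (fun x => if bad x then (1 : ℝ) else 0)] at h1
    refine h1.trans ?_
    have h2 := Polynomial.card_filter_exists_eval_eq_zero_le hf.ne_zero fun i => (d i : ZMod p)
    rw [Fintype.card_fin] at h2
    rw [Finset.sum_boole]
    exact_mod_cast h2
  rw [← Real.norm_eq_abs, ← Complex.norm_real, Complex.ofReal_sum]
  have hsplit : ∑ n ∈ range M, ((∏ i, fsub p R (n + d i) : ℝ) : ℂ) = ∑ n ∈ range M, G n +
      ∑ n ∈ range M, (((∏ i, fsub p R (n + d i) : ℝ) : ℂ) - G n) := by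
    rw [Finset.sum_sub_distrib]
    ring
  rw [hsplit]
  refine (norm_add_le _ _).trans (add_le_add hmain ?_)
  exact (norm_sum_le _ _).trans ((Finset.sum_le_sum fun n _ => hdiff n).trans hbad)

theorem numeric_bound_of_large_degree {x D L ε : ℝ} (hx : 0 ≤ x) (hε : 0 < ε) (hL : 4 / ε ≤ L)
    (hD : ε * x / 4 < D) : x ^ 2 ≤ D * x * L := by
  have h1 : 4 ≤ L * ε := (div_le_iff₀ hε).1 hL
  have hL0 : 0 ≤ L := (by positivity : 0 ≤ 4 / ε).trans hL
  nlinarith [mul_le_mul_of_nonneg_right hD.le (mul_nonneg hx hL0),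
    mul_le_mul_of_nonneg_right h1 (mul_nonneg hx hx)]

theorem numeric_bound_of_small_degree {x D L ε V K : ℝ} {k : ℕ} (hx : 1 ≤ x) (hD1 : 1 ≤ D)
    (hL : 1 ≤ L) (hε : 0 ≤ ε) (hV : 1 ≤ V) (hK : 1 ≤ K) (hD : D ≤ ε * x / 4) :
    (V * (1 + (D + 1) * (x + 1) / x ^ 2)) ^ k * ((D + 1) * (x + 1)) * (K * (2 + L) + 1) +
      K * (D + 1) ≤ 18 * (V * (1 + ε)) ^ k * (K * D * x * L) := by
  have hx0 : 0 < x := by linarith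
  have hE : (D + 1) * (x + 1) ≤ 4 * (D * x) := by nlinarith
  have hEp : (D + 1) * (x + 1) / x ^ 2 ≤ ε := by
    rw [div_le_iff₀ (by positivity)]
    nlinarith
  have hT : (1 : ℝ) ≤ (V * (1 + ε)) ^ k := one_le_pow₀ (by nlinarith)
  have hKL : K * (2 + L) + 1 ≤ 4 * (K * L) := by nlinarith
  have h1 : (V * (1 + (D + 1) * (x + 1) / x ^ 2)) ^ k ≤ (V * (1 + ε)) ^ k := by gcongr
  have h2 : K * (D + 1) ≤ (V * (1 + ε)) ^ k * (2 * (K * D * x * L)) := by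
    have h3 : K * (D + 1) ≤ 2 * (K * D) := by nlinarith
    have h4 : K * D * 1 ≤ K * D * (x * L) := by
      gcongr
      nlinarith
    have h5 : 0 ≤ K * D * x * L := by positivity
    nlinarith
  calc _ ≤ (V * (1 + ε)) ^ k * (4 * (D * x)) * (4 * (K * L)) +
        (V * (1 + ε)) ^ k * (2 * (K * D * x * L)) := by gcongr
    _ = _ := by ring

open Polynomial in
theorem corrK_le {p : ℕ} [Fact p.Prime] {ε₀ ε : ℝ} (hε : 0 < ε) (hε1 : ε ≤ 1) (hεε₀ : ε ≤ ε₀)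
    (hL : 4 / ε ≤ Real.log p) {s r : ℕ} (hsp : s ∣ p - 1) (hrp : r ∣ p - 1) {f : (ZMod p)[X]}
    (hf : Irreducible f) (hdeg : 2 ≤ f.natDegree ∨ (f.natDegree = 1 ∧ r = 1)) {R : Finset ℕ}
    (hRp : R ⊆ range p)
    (hR : ∀ n < p, n ∈ R ↔ (∃ g : ZMod p, orderOf g = p - 1 ∧ (n : ZMod p) = g ^ s) ∧
      ∃ x : (ZMod p)ˣ, f.eval (n : ZMod p) = (x : ZMod p) ^ r) {k : ℕ} (hk : 0 < k) :
    corrK R p k ≤ 18 * (1 + ε₀) ^ k * k * f.natDegree *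
      2 ^ (k * ((p - 1) / s).primeFactors.card) * Real.sqrt p * Real.log p := by
  have hp0 : (0 : ℝ) < p := by exact_mod_cast (Fact.out : p.Prime).pos
  have hL1 : 1 ≤ Real.log p := by
    refine le_trans ?_ hL
    rw [le_div_iff₀ hε]
    linarith
  have hx1 : 1 ≤ Real.sqrt p := Real.one_le_sqrt.2 (by exact_mod_cast (Fact.out : p.Prime).one_lt.le)
  have hxx : Real.sqrt p ^ 2 = p := Real.sq_sqrt hp0.le
  have hD1 : 1 ≤ f.natDegree := by omega
  have hD1' : (1 : ℝ) ≤ f.natDegree := by exact_mod_cast hD1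
  have hk1 : (1 : ℝ) ≤ k := by exact_mod_cast hk
  set V : ℝ := 2 ^ ((p - 1) / s).primeFactors.card with hV
  have hV1 : 1 ≤ V := one_le_pow₀ (by norm_num)
  have hT : 18 * (V * (1 + ε)) ^ k * (k * f.natDegree * Real.sqrt p * Real.log p) ≤
      18 * (1 + ε₀) ^ k * k * f.natDegree * 2 ^ (k * ((p - 1) / s).primeFactors.card) *
        Real.sqrt p * Real.log p := by
    calc _ ≤ 18 * (V * (1 + ε₀)) ^ k * (k * f.natDegree * Real.sqrt p * Real.log p) := by
          gcongr
      _ = _ := by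
          rw [mul_pow, hV, ← pow_mul, mul_comm k]
          ring
  refine le_trans ?_ hT
  refine Real.sSup_le ?_ (by positivity)
  rintro _ ⟨M, d, -, hM, hd, hdp, rfl⟩
  rcases le_or_gt (f.natDegree : ℝ) (ε * Real.sqrt p / 4) with hD | hD
  · have hfp : f.natDegree < p := by
      have : (f.natDegree : ℝ) < p := by nlinarith
      exact_mod_cast this
    have her : (p - 1) / r * r = p - 1 := Nat.div_mul_cancel hrp
    have h1 := abs_sum_prod_fsub_le hf hfp (Nat.div_dvd_of_dvd hsp) her (fun h1 => by omega) hRp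
      (fun n hn => by
        rw [← ZMod.exists_orderOf_eq_sub_one_and_pow_eq hsp, ← ZMod.exists_units_pow_eq_iff her,
          hR n hn]) hk hd hdp hM
    have h2 := numeric_bound_of_small_degree (k := k) hx1 hD1' hL1 hε.le hV1 hk1 hD
    rw [hxx] at h2
    rw [← hV] at h1
    exact h1.trans h2
  · have h1 : |∑ n ∈ range M, ∏ i, fsub p R (n + d i)| ≤ p := by
      refine (Finset.abs_sum_le_sum_abs _ _).trans
        ((Finset.sum_le_card_nsmul _ _ 1 fun n _ => ?_).trans ?_)
      · rw [Finset.abs_prod]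
        exact Finset.prod_le_one (fun _ _ => abs_nonneg _) fun _ _ => abs_fsub_le_one
          ((Finset.card_le_card hRp).trans_eq (Finset.card_range p)) _
      · rw [Finset.card_range, nsmul_eq_mul, mul_one]
        exact_mod_cast hM
    have h2 := numeric_bound_of_large_degree (Real.sqrt_nonneg _) hε hL hD
    rw [hxx] at h2
    refine h1.trans (h2.trans ?_)
    have hT1 : (1 : ℝ) ≤ (V * (1 + ε)) ^ k := one_le_pow₀ (by nlinarith)
    have h3 : 0 ≤ f.natDegree * Real.sqrt p * Real.log p := by positivity
    calc f.natDegree * Real.sqrt p * Real.log p =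
          1 * 1 * (1 * (f.natDegree * Real.sqrt p * Real.log p)) := by ring
      _ ≤ 18 * (V * (1 + ε)) ^ k * (k * (f.natDegree * Real.sqrt p * Real.log p)) := by
        gcongr
        norm_num
      _ = _ := by ring

open scoped Classical in
theorem statement14 :
    ∃ c > (0 : ℝ), ∀ ε > (0 : ℝ), ∃ p₀ : ℕ, ∀ p : ℕ, p₀ ≤ p → p.Prime → Odd p →
      ∀ s r : ℕ, 0 < s → 0 < r → s ∣ p - 1 → r ∣ p - 1 →
      ∀ f : Polynomial (ZMod p), Irreducible f →
      (2 ≤ f.natDegree ∨ (f.natDegree = 1 ∧ r = 1)) →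
      ∀ k : ℕ, 0 < k →
      corrK ((Finset.range p).filter
          (fun n => ∃ g : ZMod p, orderOf g = p - 1 ∧ (n : ZMod p) = g ^ s ∧
            ∃ x : (ZMod p)ˣ, f.eval (n : ZMod p) = (x : ZMod p) ^ r)) p k ≤
        c * (1 + ε) ^ k * k * f.natDegree *
          2 ^ (k * ((p - 1) / s).primeFactors.card) * Real.sqrt p * Real.log p := by
  refine ⟨18, by norm_num, fun ε hε => ⟨⌈Real.exp (4 / min ε 1)⌉₊,
    fun p hp hpp _ s r _ _ hsp hrp f hf hdeg k hk => ?_⟩⟩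
  have : Fact p.Prime := ⟨hpp⟩
  have hL : 4 / min ε 1 ≤ Real.log p :=
    (Real.le_log_iff_exp_le (by exact_mod_cast hpp.pos)).2 (Nat.ceil_le.1 hp)
  refine corrK_le (lt_min hε one_pos) (min_le_right _ _) (min_le_left _ _) hL hsp hrp hf hdeg
    (@Finset.filter_subset _ _ (fun _ => Classical.propDecidable _) _) (fun n hn => ?_) hk
  refine (@Finset.mem_filter _ _ (fun _ => Classical.propDecidable _) _ _).trans ?_
  rw [Finset.mem_range]
  constructor
  · rintro ⟨-, g, hg, hg', hx⟩
    exact ⟨⟨g, hg, hg'⟩, hx⟩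
  · rintro ⟨⟨g, hg, hg'⟩, hx⟩
    exact ⟨hn, g, hg, hg', hx⟩
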